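/- Let X be a central simple algebra over a number field F. If X ⊗_F F_v is a matrix algebra over F_v for every place v of F, then X is a matrix algebra over F. -/

import Mathlib

open scoped TensorProduct

/-- `X` splits at the finite place `v` of the number field `F`: the base change of `X` to
the `v`-adic completion `F_v` is a matrix algebra over `F_v`. -/
def SplitsAtFinitePlace (F : Type*) [Field F] [NumberField F]
    (X : Type*) [Ring X] [Algebra F X]
    (v : IsDedekindDomain.HeightOneSpectrum (NumberField.RingOfIntegers F)) : Prop :=
  letI : SMulCommClass F (v.adicCompletion F) (v.adicCompletion F) :=
    Algebra.to_smulCommClass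
  ∃ n : ℕ, 0 < n ∧ Nonempty (((v.adicCompletion F) ⊗[F] X) ≃ₐ[v.adicCompletion F]
    Matrix (Fin n) (Fin n) (v.adicCompletion F))

/-- `X` splits at the real place of `F` given by the embedding `τ : F → ℝ`. -/
def SplitsAtRealPlace (F : Type*) [Field F] (X : Type*) [Ring X] [Algebra F X]
    (τ : F →+* ℝ) : Prop :=
  letI : Algebra F ℝ := τ.toAlgebra
  ∃ n : ℕ, 0 < n ∧ Nonempty ((ℝ ⊗[F] X) ≃ₐ[ℝ] Matrix (Fin n) (Fin n) ℝ)

/-- `X` splits at the complex place of `F` given by the embedding `τ : F → ℂ`. -/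
def SplitsAtComplexPlace (F : Type*) [Field F] (X : Type*) [Ring X] [Algebra F X]
    (τ : F →+* ℂ) : Prop :=
  letI : Algebra F ℂ := τ.toAlgebra
  ∃ n : ℕ, 0 < n ∧ Nonempty ((ℂ ⊗[F] X) ≃ₐ[ℂ] Matrix (Fin n) (Fin n) ℂ)

set_option linter.unusedSectionVars false

section GroupIndex

open Polynomial

theorem AddMonoidHom.index_range_comp_mul_card_ker {A : Type*} [AddCommGroup A] (f g : A →+ A) :
    (f.comp g).range.index * (Nat.card f.ker * Nat.card g.ker) =
      Nat.card (f.comp g).ker * (f.range.index * g.range.index) := by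
  have h1 : (f.comp g).range.index = (g.range ⊔ f.ker).index * f.range.index := by
    rw [AddMonoidHom.range_comp, AddSubgroup.index_map]
  have h2 : g.range.relIndex f.ker * (g.range ⊔ f.ker).index = g.range.index := by
    rw [← AddSubgroup.relIndex_sup_left]
    exact AddSubgroup.relIndex_mul_index le_sup_left
  have h3 : g.range.relIndex f.ker * Nat.card (g.range ⊓ f.ker : AddSubgroup A) =
      Nat.card f.ker := by
    have := AddSubgroup.relIndex_mul_relIndex (⊥ : AddSubgroup A) (g.range ⊓ f.ker) f.ker
      bot_le inf_le_right
    rw [AddSubgroup.relIndex_bot_left, AddSubgroup.relIndex_bot_left,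
      AddSubgroup.inf_relIndex_right] at this
    rw [mul_comm]; exact this
  have h4 : Nat.card (f.comp g).ker = Nat.card g.ker * Nat.card
      (g.range ⊓ f.ker : AddSubgroup A) := by
    have h5 : g.ker ≤ (f.comp g).ker := fun x hx => by
      simp only [AddMonoidHom.mem_ker, AddMonoidHom.comp_apply] at hx ⊢
      rw [hx, map_zero]
    have := AddSubgroup.relIndex_mul_relIndex (⊥ : AddSubgroup A) g.ker (f.comp g).ker
      bot_le h5
    rw [AddSubgroup.relIndex_bot_left, AddSubgroup.relIndex_bot_left,
      AddSubgroup.relIndex_ker] at this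
    rw [← this]
    congr 2
    have : ((f.comp g).ker.map g) = g.range ⊓ f.ker := by
      ext x
      simp only [AddSubgroup.mem_map, AddMonoidHom.mem_ker, AddMonoidHom.comp_apply,
        AddSubgroup.mem_inf, AddMonoidHom.mem_range]
      constructor
      · rintro ⟨y, hy, rfl⟩
        exact ⟨⟨y, rfl⟩, hy⟩
      · rintro ⟨⟨y, rfl⟩, hy⟩
        exact ⟨y, hy, rfl⟩
    rw [this]
  rw [h1, h4, ← h2, ← h3]
  ring

/-- The order of the cokernel of an endomorphism (zero if infinite). -/
noncomputable def LinearMap.cokerCard {A : Type*} [AddCommGroup A] (f : A →ₗ[ℤ] A) : ℕ :=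
  (LinearMap.range f).toAddSubgroup.index

/-- The order of the kernel of an endomorphism (zero if infinite). -/
noncomputable def LinearMap.kerCard {A : Type*} [AddCommGroup A] (f : A →ₗ[ℤ] A) : ℕ :=
  Nat.card (LinearMap.ker f)

section

variable {A : Type*} [AddCommGroup A]

theorem LinearMap.cokerCard_mul (f g : A →ₗ[ℤ] A) :
    (f * g).cokerCard * (f.kerCard * g.kerCard) =
      (f * g).kerCard * (f.cokerCard * g.cokerCard) :=
  AddMonoidHom.index_range_comp_mul_card_ker f.toAddMonoidHom g.toAddMonoidHom

theorem LinearMap.kerCard_one : (1 : A →ₗ[ℤ] A).kerCard = 1 := by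
  have : LinearMap.ker (1 : A →ₗ[ℤ] A) = ⊥ := LinearMap.ker_id
  rw [LinearMap.kerCard, this]; simp

theorem LinearMap.cokerCard_one : (1 : A →ₗ[ℤ] A).cokerCard = 1 := by
  have : LinearMap.range (1 : A →ₗ[ℤ] A) = ⊤ := LinearMap.range_id
  rw [LinearMap.cokerCard, this]; simp

theorem LinearMap.kerCard_mul_ne_zero (f g : A →ₗ[ℤ] A) (hf : f.kerCard ≠ 0)
    (hg : g.kerCard ≠ 0) : (f * g).kerCard ≠ 0 := by
  have : Finite (LinearMap.ker f) := Nat.finite_of_card_ne_zero hf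
  have : Finite (LinearMap.ker g) := Nat.finite_of_card_ne_zero hg
  have h1 : Finite (LinearMap.ker (f * g)) := by
    let φ : LinearMap.ker (f * g) →+ LinearMap.ker f :=
      { toFun := fun x => ⟨g x, x.2⟩
        map_zero' := by ext; simp
        map_add' := fun x y => by ext; simp }
    rw [AddMonoidHom.finite_iff_finite_ker_range φ]
    refine ⟨?_, inferInstance⟩
    refine Finite.of_injective (β := LinearMap.ker g)
      (fun x => ⟨x.1.1, congrArg Subtype.val x.2⟩) ?_
    intro x y h
    have h' : (x.1.1 : A) = y.1.1 := congrArg (fun z : LinearMap.ker g => (z : A)) h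
    exact Subtype.ext (Subtype.ext h')
  exact Nat.card_pos.ne'

theorem LinearMap.kerCard_pow_ne_zero (f : A →ₗ[ℤ] A) (hf : f.kerCard ≠ 0) (n : ℕ) :
    (f ^ n).kerCard ≠ 0 := by
  induction n with
  | zero => rw [pow_zero, LinearMap.kerCard_one]; exact one_ne_zero
  | succ n ih => rw [pow_succ]; exact LinearMap.kerCard_mul_ne_zero _ _ ih hf

theorem LinearMap.cokerCard_pow (f : A →ₗ[ℤ] A) (hf : f.kerCard ≠ 0) (n : ℕ) :
    (f ^ n).cokerCard * f.kerCard ^ n = (f ^ n).kerCard * f.cokerCard ^ n := by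
  induction n with
  | zero => rw [pow_zero, LinearMap.kerCard_one, LinearMap.cokerCard_one]; simp
  | succ n ih =>
    have := LinearMap.cokerCard_mul f (f ^ n)
    rw [← pow_succ'] at this
    apply mul_right_cancel₀ (LinearMap.kerCard_pow_ne_zero f hf n)
    calc _ = (f ^ (n + 1)).cokerCard * (f.kerCard * (f ^ n).kerCard) * f.kerCard ^ n := by ring
        _ = (f ^ (n + 1)).kerCard * f.cokerCard * ((f ^ n).cokerCard * f.kerCard ^ n) := by
          rw [this]; ring
        _ = _ := by rw [ih]; ring

theorem LinearMap.cokerCard_congr {B : Type*} [AddCommGroup B] (e : A ≃+ B) (p : ℕ) :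
    (p : A →ₗ[ℤ] A).cokerCard = (p : B →ₗ[ℤ] B).cokerCard := by
  rw [LinearMap.cokerCard, LinearMap.cokerCard, ← AddSubgroup.index_map_equiv _ e]
  congr 1
  ext x
  simp only [AddSubgroup.mem_map, Submodule.mem_toAddSubgroup, LinearMap.mem_range]
  constructor
  · rintro ⟨y, ⟨z, rfl⟩, rfl⟩
    exact ⟨e z, by simp⟩
  · rintro ⟨z, rfl⟩
    exact ⟨p • e.symm z, ⟨e.symm z, by simp⟩, by simp⟩

theorem LinearMap.kerCard_congr {B : Type*} [AddCommGroup B] (e : A ≃+ B) (p : ℕ) :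
    (p : A →ₗ[ℤ] A).kerCard = (p : B →ₗ[ℤ] B).kerCard := by
  refine Nat.card_congr (e.toEquiv.subtypeEquiv fun a => ?_)
  simp only [LinearMap.mem_ker, Module.End.natCast_apply, AddEquiv.toEquiv_eq_coe,
    EquivLike.coe_coe]
  rw [← map_nsmul, map_eq_zero_iff e e.injective]

theorem LinearMap.cokerCard_natCast_aux {T : Type*} [AddCommGroup T] [Finite T] {n : ℕ}
    (e : A ≃+ (Fin n → ℤ) × T) (p : ℕ) (hp : p ≠ 0) :
    (p : A →ₗ[ℤ] A).cokerCard = p ^ Module.finrank ℤ A * (p : A →ₗ[ℤ] A).kerCard ∧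
    (p : A →ₗ[ℤ] A).kerCard ≠ 0 := by
  have hrk : Module.finrank ℤ A = n := by
    let g : A →ₗ[ℤ] (Fin n → ℤ) := ((AddMonoidHom.fst _ _).comp e.toAddMonoidHom).toIntLinearMap
    have hg : Function.Surjective g := fun x => ⟨e.symm (x, 0), by simp [g]⟩
    rw [← finrank_quotient_eq_of_le_torsion (M' := LinearMap.ker g),
      (g.quotKerEquivOfSurjective hg).finrank_eq, Module.finrank_fin_fun]
    intro x hx
    rw [Submodule.mem_torsion_iff]
    refine ⟨⟨(Nat.card T : ℤ), by simp [Nat.card_pos.ne']⟩, ?_⟩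
    apply e.injective
    rw [LinearMap.mem_ker] at hx
    have h1 : (e x).1 = 0 := hx
    rw [Submonoid.mk_smul, map_zsmul, map_zero]
    ext i
    · simp [h1]
    · simp
  have hprodker : (p : A →ₗ[ℤ] A).kerCard = (p : T →ₗ[ℤ] T).kerCard := by
    rw [LinearMap.kerCard_congr e]
    refine Nat.card_congr ⟨fun x => ⟨x.1.2, ?_⟩, fun x => ⟨(0, x.1), ?_⟩, ?_, ?_⟩
    · have := x.2
      rw [LinearMap.mem_ker, Module.End.natCast_apply] at this ⊢
      exact congrArg Prod.snd this
    · have := x.2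
      rw [LinearMap.mem_ker, Module.End.natCast_apply] at this ⊢
      ext i
      · simp
      · simpa using this
    · intro x
      have := x.2
      rw [LinearMap.mem_ker, Module.End.natCast_apply] at this
      have h1 := congrArg Prod.fst this
      ext i
      · have := congrFun h1 i
        simp at this
        simp [this.resolve_left hp]
      · simp
    · intro x; rfl
  have hprodcok : (p : A →ₗ[ℤ] A).cokerCard = p ^ n * (p : T →ₗ[ℤ] T).cokerCard := by
    rw [LinearMap.cokerCard_congr e]
    have h1 : (LinearMap.range (p : ((Fin n → ℤ) × T) →ₗ[ℤ] _)).toAddSubgroup =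
        (AddSubgroup.pi Set.univ fun _ : Fin n => AddSubgroup.zmultiples (p : ℤ)).prod
          (LinearMap.range (p : T →ₗ[ℤ] T)).toAddSubgroup := by
      ext x
      simp only [Submodule.mem_toAddSubgroup, LinearMap.mem_range, Module.End.natCast_apply,
        AddSubgroup.mem_prod, AddSubgroup.mem_pi, Set.mem_univ, forall_true_left,
        Int.mem_zmultiples_iff]
      constructor
      · rintro ⟨y, rfl⟩
        exact ⟨fun i => by simp, ⟨y.2, rfl⟩⟩
      · rintro ⟨h1, ⟨y, hy⟩⟩
        choose z hz using h1
        refine ⟨(z, y), ?_⟩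
        ext i
        · simp [hz i]
        · simpa using hy
    rw [LinearMap.cokerCard, h1, AddSubgroup.index_prod, AddSubgroup.index_pi]
    simp [LinearMap.cokerCard, Int.index_zmultiples]
  have hT : (p : T →ₗ[ℤ] T).cokerCard = (p : T →ₗ[ℤ] T).kerCard :=
    AddSubgroup.index_range (f := (p : T →ₗ[ℤ] T).toAddMonoidHom)
  rw [hprodker, hprodcok, hrk, hT]
  exact ⟨rfl, Nat.card_pos.ne'⟩

/-- Multiplication by `p ≠ 0` on a finitely generated abelian group. -/
theorem LinearMap.cokerCard_natCast [Module.Finite ℤ A] (p : ℕ) (hp : p ≠ 0) :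
    (p : A →ₗ[ℤ] A).cokerCard = p ^ Module.finrank ℤ A * (p : A →ₗ[ℤ] A).kerCard ∧
    (p : A →ₗ[ℤ] A).kerCard ≠ 0 := by
  have hfg : AddGroup.FG A := Module.Finite.iff_addGroup_fg.mp inferInstance
  obtain ⟨n, ι, fι, q, hq, e, ⟨f⟩⟩ := AddCommGroup.equiv_free_prod_directSum_zmod A
  have hT0 (i : ι) : NeZero (q i ^ e i) := ⟨pow_ne_zero _ (hq i).ne_zero⟩
  have hT : Finite (DirectSum ι fun i => ZMod (q i ^ e i)) :=
    Finite.of_equiv _ (DirectSum.addEquivProd (fun i => ZMod (q i ^ e i))).symm.toEquiv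
  exact LinearMap.cokerCard_natCast_aux (f.trans
    ((Finsupp.linearEquivFunOnFinite ℤ ℤ (Fin n)).toAddEquiv.prodCongr (AddEquiv.refl _))) p hp

end

/-- In `ℤ[X] / (1 + X + ⋯ + X ^ (p - 1))`, the elements `p` and `(X - 1) ^ (p - 1)` are
associated. -/
theorem cyclotomic_natCast_assoc (p : ℕ) [hp : Fact p.Prime] :
    (∃ U W : ℤ[X], (p : ℤ[X]) = (X - 1) ^ (p - 1) * U + (∑ i ∈ Finset.range p, X ^ i) * W) ∧
    (∃ U W : ℤ[X], (X - 1) ^ (p - 1) = (p : ℤ[X]) * U + (∑ i ∈ Finset.range p, X ^ i) * W) := by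
  set Φ : ℤ[X] := ∑ i ∈ Finset.range p, X ^ i with hΦ
  have hV : ∃ V : ℤ[X], (X - 1) ^ (p - 1) = (p : ℤ[X]) * V + Φ := by
    have h : (C (p : ℤ)) ∣ (X - 1) ^ (p - 1) - Φ := by
      rw [Polynomial.C_dvd_iff_dvd_coeff]
      intro i
      rw [← ZMod.intCast_zmod_eq_zero_iff_dvd]
      change Int.castRingHom (ZMod p) _ = 0
      rw [← Polynomial.coeff_map]
      have h2 : (((X : ℤ[X]) - 1) ^ (p - 1) - Φ).map (Int.castRingHom (ZMod p)) = 0 := by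
        have h3 := Polynomial.cyclotomic_mul_prime_eq_pow_of_not_dvd (ZMod p) (n := 1) (p := p)
          (by simpa using hp.1.one_lt.ne')
        rw [one_mul, cyclotomic_one, cyclotomic_prime] at h3
        simp [hΦ, Polynomial.map_sum, h3]
      rw [h2, coeff_zero]
    obtain ⟨V, hV⟩ := h
    refine ⟨V, ?_⟩
    rw [sub_eq_iff_eq_add] at hV
    simpa using hV
  obtain ⟨V, hV⟩ := hV
  refine ⟨?_, V, 1, by rw [hV, mul_one]⟩
  have hev : Φ.eval 1 = p := by simp [hΦ, Polynomial.eval_finsetSum]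
  have hV1 : V.eval 1 = -1 := by
    have := congrArg (Polynomial.eval 1) hV
    simp only [eval_pow, eval_sub, eval_X, eval_one, sub_self, eval_add, eval_mul,
      eval_natCast, hev, ne_eq, Nat.sub_ne_zero_of_lt hp.1.one_lt, not_false_eq_true,
      zero_pow] at this
    have hp0 : (p : ℤ) ≠ 0 := by exact_mod_cast hp.1.ne_zero
    have : (p : ℤ) * (V.eval 1 + 1) = 0 := by linarith
    have := (mul_eq_zero.1 this).resolve_left hp0
    linarith
  obtain ⟨h, hh⟩ : (X - 1) ∣ V + 1 := by
    rw [← C_1, dvd_iff_isRoot]; simp [hV1]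
  have key : ∀ j ≤ p - 1, ∃ U W : ℤ[X], (p : ℤ[X]) = (X - 1) ^ j * U + Φ * W := by
    intro j
    induction j with
    | zero => exact fun _ => ⟨p, 0, by simp⟩
    | succ j ih =>
      intro hj
      obtain ⟨U, W, hUW⟩ := ih (by omega)
      obtain ⟨k, hk⟩ : ∃ k, p - 1 = j + 1 + k := ⟨p - 1 - (j + 1), by omega⟩
      refine ⟨-(X - 1) ^ k + U * h, 1 + W * (X - 1) * h, ?_⟩
      have hV' : V = (X - 1) * h - 1 := by rw [← hh]; ring
      have e1 : (p : ℤ[X]) = (p : ℤ[X]) * ((X - 1) * h) - (X - 1) ^ (p - 1) + Φ := by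
        rw [hV, hV']; ring
      rw [e1, hk]
      nth_rewrite 1 [hUW]
      ring
  exact key _ le_rfl

/-- A Herbrand quotient computation for a finitely generated abelian group with an automorphism
of prime order `p` and trivial first cohomology. -/
theorem relIndex_norm_fixed {M : Type*} [AddCommGroup M] [Module.Finite ℤ M] (p : ℕ)
    [hp : Fact p.Prime] (σ : M →ₗ[ℤ] M) (hσ : σ ^ p = 1)
    (h90 : ∀ x, (∑ i ∈ Finset.range p, σ ^ i) x = 0 → ∃ y, (σ - 1) y = x) (k : ℕ)
    (hk : Module.finrank ℤ M = Module.finrank ℤ (LinearMap.ker (σ - 1)) + (p - 1) * k) :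
    (LinearMap.range (∑ i ∈ Finset.range p, σ ^ i)).toAddSubgroup.relIndex
      (LinearMap.ker (σ - 1)).toAddSubgroup * p ^ k =
        p ^ Module.finrank ℤ (LinearMap.ker (σ - 1)) := by
  set N : M →ₗ[ℤ] M := ∑ i ∈ Finset.range p, σ ^ i with hN
  set A := LinearMap.range (σ - 1) with hA
  set G := LinearMap.ker (σ - 1) with hG
  have hNσ : N * (σ - 1) = 0 := by rw [hN, geom_sum_mul, hσ, sub_self]
  have hσN : (σ - 1) * N = 0 := by rw [hN, mul_geom_sum, hσ, sub_self]
  have hAN : A = LinearMap.ker N := by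
    ext x
    constructor
    · rintro ⟨y, rfl⟩
      exact LinearMap.congr_fun hNσ y
    · intro hx
      exact h90 x hx
  have hGfix : ∀ x ∈ G, σ x = x := fun x hx => by
    rw [hG, LinearMap.mem_ker, LinearMap.sub_apply, Module.End.one_apply, sub_eq_zero] at hx
    exact hx
  have hGpow : ∀ x ∈ G, ∀ i, (σ ^ i) x = x := fun x hx i => by
    induction i with
    | zero => simp
    | succ i ih => rw [pow_succ', Module.End.mul_apply, ih, hGfix x hx]
  have hNG : ∀ x ∈ G, N x = p • x := fun x hx => by
    rw [hN, LinearMap.sum_apply, Finset.sum_congr rfl fun i _ => hGpow x hx i]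
    simp
  have hrank : Module.finrank ℤ A = (p - 1) * k := by
    have := Submodule.finrank_quotient_add_finrank G
    rw [(LinearMap.quotKerEquivRange (σ - 1)).finrank_eq, ← hA] at this
    omega
  have hstab : ∀ x ∈ A, σ x ∈ A := by
    rintro _ ⟨y, rfl⟩
    exact ⟨σ y, by simp⟩
  let ρ : A →ₗ[ℤ] A := σ.restrict hstab
  let τ : A →ₗ[ℤ] A := ρ - 1
  have hρN : ∑ i ∈ Finset.range p, ρ ^ i = 0 := by
    ext x
    have h1 : N x = 0 := hAN.le x.2
    rw [hN, LinearMap.sum_apply] at h1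
    rw [LinearMap.sum_apply, AddSubmonoidClass.coe_finsetSum, LinearMap.zero_apply,
      ZeroMemClass.coe_zero, ← h1]
    refine Finset.sum_congr rfl fun i _ => ?_
    clear * -
    induction i with
    | zero => rfl
    | succ i ih =>
      rw [pow_succ', pow_succ', Module.End.mul_apply, Module.End.mul_apply, ← ih]
      rfl
  obtain ⟨⟨U, W, h1⟩, ⟨U', W', h2⟩⟩ := cyclotomic_natCast_assoc p
  have hpτ : (p : A →ₗ[ℤ] A) = τ ^ (p - 1) * aeval ρ U := by
    simpa [hρN, τ] using congrArg (aeval ρ) h1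
  have hτp : τ ^ (p - 1) = (p : A →ₗ[ℤ] A) * aeval ρ U' := by
    simpa [hρN, τ] using congrArg (aeval ρ) h2
  have hpτ' : (p : A →ₗ[ℤ] A) = aeval ρ U * τ ^ (p - 1) := by
    rw [mul_comm] at h1
    simpa [hρN, τ] using congrArg (aeval ρ) h1
  have hτp' : τ ^ (p - 1) = aeval ρ U' * (p : A →ₗ[ℤ] A) := by
    rw [mul_comm] at h2
    simpa [hρN, τ] using congrArg (aeval ρ) h2
  have hrange : LinearMap.range (p : A →ₗ[ℤ] A) = LinearMap.range (τ ^ (p - 1)) := by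
    apply le_antisymm
    · rintro _ ⟨x, rfl⟩
      rw [hpτ]; exact ⟨aeval ρ U x, rfl⟩
    · rintro _ ⟨x, rfl⟩
      rw [hτp]; exact ⟨aeval ρ U' x, rfl⟩
  have hker : LinearMap.ker (p : A →ₗ[ℤ] A) = LinearMap.ker (τ ^ (p - 1)) := by
    apply le_antisymm
    · intro x hx
      rw [LinearMap.mem_ker] at hx ⊢
      rw [hτp', Module.End.mul_apply, hx, map_zero]
    · intro x hx
      rw [LinearMap.mem_ker] at hx ⊢
      rw [hpτ', Module.End.mul_apply, hx, map_zero]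
  have hτker : τ.kerCard = (p : G →ₗ[ℤ] G).kerCard := by
    refine Nat.card_congr ⟨fun x => ⟨⟨x.1.1, ?_⟩, ?_⟩, fun x => ⟨⟨x.1.1, ?_⟩, ?_⟩, ?_, ?_⟩
    · exact congrArg Subtype.val x.2
    · have hx : (x.1.1 : M) ∈ G := congrArg Subtype.val x.2
      have h3 : N x.1.1 = 0 := hAN.le x.1.2
      rw [hNG _ hx] at h3
      ext
      simpa using h3
    · rw [hAN, LinearMap.mem_ker, hNG _ x.1.2]
      have := x.2
      rw [LinearMap.mem_ker, Module.End.natCast_apply] at this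
      exact congrArg Subtype.val this
    · ext
      exact x.1.2
    · intro x; rfl
    · intro x; rfl
  obtain ⟨hG1, hG2⟩ := LinearMap.cokerCard_natCast (A := G) p hp.1.ne_zero
  obtain ⟨hA1, hA2⟩ := LinearMap.cokerCard_natCast (A := A) p hp.1.ne_zero
  have hτcok : τ.cokerCard = p ^ k * τ.kerCard := by
    have h3 := LinearMap.cokerCard_pow τ (hτker ▸ hG2) (p - 1)
    have h4 : (τ ^ (p - 1)).cokerCard = (p : A →ₗ[ℤ] A).cokerCard := by
      rw [LinearMap.cokerCard, LinearMap.cokerCard, hrange]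
    have h5 : (τ ^ (p - 1)).kerCard = (p : A →ₗ[ℤ] A).kerCard := by
      rw [LinearMap.kerCard, LinearMap.kerCard, hker]
    rw [h4, h5, hA1, hrank, mul_comm (p ^ _) (LinearMap.kerCard _), mul_assoc] at h3
    have h6 := mul_left_cancel₀ hA2 h3
    rw [mul_comm (p - 1), pow_mul, ← mul_pow] at h6
    exact (Nat.pow_left_injective (Nat.sub_ne_zero_of_lt hp.1.one_lt) h6).symm
  have hτidx : τ.cokerCard = (A ⊔ G).toAddSubgroup.index := by
    have h3 := AddSubgroup.relIndex_map_map (σ - 1).toAddMonoidHom A.toAddSubgroup ⊤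
    have h4 : (σ - 1).toAddMonoidHom.ker = G.toAddSubgroup := rfl
    have h5 : (⊤ : AddSubgroup M).map (σ - 1).toAddMonoidHom = A.toAddSubgroup := by
      ext x; simp [hA]
    rw [h4, h5, top_sup_eq, AddSubgroup.relIndex_top_right] at h3
    rw [Submodule.sup_toAddSubgroup, ← h3, LinearMap.cokerCard, AddSubgroup.relIndex]
    congr 1
    ext x
    simp only [Submodule.mem_toAddSubgroup, LinearMap.mem_range]
    constructor
    · rintro ⟨y, rfl⟩
      exact ⟨y, y.2, rfl⟩
    · rintro ⟨y, hy, hy2⟩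
      exact ⟨⟨y, hy⟩, Subtype.ext hy2⟩
  have hNidx : (G.toAddSubgroup.map N.toAddMonoidHom).relIndex
      (LinearMap.range N).toAddSubgroup = (A ⊔ G).toAddSubgroup.index := by
    have h3 := AddSubgroup.relIndex_map_map N.toAddMonoidHom G.toAddSubgroup ⊤
    have h4 : N.toAddMonoidHom.ker = A.toAddSubgroup := by rw [hAN]; rfl
    have h5 : (⊤ : AddSubgroup M).map N.toAddMonoidHom = (LinearMap.range N).toAddSubgroup := by
      ext x; simp
    rw [h4, h5, top_sup_eq, AddSubgroup.relIndex_top_right] at h3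
    rw [h3, sup_comm, Submodule.sup_toAddSubgroup]
  have hpG : (G.toAddSubgroup.map N.toAddMonoidHom).relIndex G.toAddSubgroup =
      (p : G →ₗ[ℤ] G).cokerCard := by
    rw [LinearMap.cokerCard, AddSubgroup.relIndex]
    congr 1
    ext x
    simp only [Submodule.mem_toAddSubgroup, LinearMap.mem_range, AddSubgroup.mem_addSubgroupOf,
      AddSubgroup.mem_map]
    constructor
    · rintro ⟨y, hy, hy2⟩
      refine ⟨⟨y, hy⟩, Subtype.ext ?_⟩
      rw [← hy2]
      simpa using (hNG y hy).symm
    · rintro ⟨y, rfl⟩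
      exact ⟨y, y.2, by simpa using hNG y y.2⟩
  have hfin := AddSubgroup.relIndex_mul_relIndex (G.toAddSubgroup.map N.toAddMonoidHom)
    (LinearMap.range N).toAddSubgroup G.toAddSubgroup
    (by
      rintro _ ⟨y, -, rfl⟩
      exact ⟨y, rfl⟩)
    (by
      rintro _ ⟨y, rfl⟩
      exact LinearMap.congr_fun hσN y)
  rw [hpG, hNidx, ← hτidx, hτcok, hτker, hG1] at hfin
  apply mul_right_cancel₀ hG2
  rw [← hfin]
  ring

end GroupIndex

section SUnits

open NumberField IsDedekindDomain WithZero

theorem Subgroup.relIndex_map_powMonoidHom {G : Type*} [CommGroup G] (U : Subgroup G) (p : ℕ) :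
    (U.map (powMonoidHom p)).relIndex U =
      LinearMap.cokerCard (p : Additive U →ₗ[ℤ] Additive U) := by
  rw [LinearMap.cokerCard, Subgroup.relIndex, ← Subgroup.index_toAddSubgroup]
  congr 1
  ext x
  simp only [Submodule.mem_toAddSubgroup, LinearMap.mem_range, Module.End.natCast_apply]
  change (x.toMul : U) ∈ (U.map (powMonoidHom p)).subgroupOf U ↔ _
  rw [Subgroup.mem_subgroupOf, Subgroup.mem_map]
  constructor
  · rintro ⟨y, hy, hxy⟩
    exact ⟨Additive.ofMul ⟨y, hy⟩, congrArg Additive.ofMul (Subtype.ext hxy)⟩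
  · rintro ⟨y, rfl⟩
    exact ⟨y.toMul, y.toMul.2, rfl⟩

variable {K : Type*} [Field K] [NumberField K]

theorem valuation_of_span_eq_pow (v : HeightOneSpectrum (𝓞 K)) {x : 𝓞 K} {n : ℕ}
    (hx : Ideal.span {x} = v.asIdeal ^ n) :
    v.valuation K (x : K) = exp (-(n : ℤ)) ∧ ∀ v' ≠ v, v'.valuation K (x : K) = 1 := by
  constructor
  · have h1 : x ∈ v.asIdeal ^ n := by rw [← hx]; exact Ideal.mem_span_singleton_self x
    have h2 : x ∉ v.asIdeal ^ (n + 1) := fun h => by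
      rw [← Ideal.span_singleton_le_iff_mem, hx] at h
      have := (Ideal.pow_right_strictAnti v.asIdeal v.ne_bot v.isPrime.ne_top) (Nat.lt_succ_self n)
      exact absurd h (not_le_of_gt this)
    change v.valuation K (algebraMap (𝓞 K) K x) = _
    rw [HeightOneSpectrum.valuation_of_algebraMap]
    apply le_antisymm
    · exact (v.intValuation_le_pow_iff_mem x n).2 h1
    · have h3 : ¬ v.intValuation x ≤ exp (-((n + 1 : ℕ) : ℤ)) := fun h =>
        h2 ((v.intValuation_le_pow_iff_mem x (n + 1)).1 h)
      rw [not_le] at h3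
      have hx0 : x ≠ 0 := by
        rintro rfl; simp at h3
      have h4 := v.intValuation_if_neg hx0
      rw [h4, exp_lt_exp] at h3
      rw [h4, exp_le_exp]
      push_cast at h3
      omega
  · intro v' hv'
    change v'.valuation K (algebraMap (𝓞 K) K x) = _
    rw [HeightOneSpectrum.valuation_eq_one_iff_notMem]
    intro h
    rw [← Ideal.span_singleton_le_iff_mem, hx] at h
    have h5 : v.asIdeal ≤ v'.asIdeal := v'.isPrime.le_of_pow_le h
    exact hv' (HeightOneSpectrum.ext ((v.isMaximal.eq_of_le v'.isPrime.ne_top h5).symm))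

theorem exists_span_eq_pow_classNumber (v : HeightOneSpectrum (𝓞 K)) :
    ∃ x : 𝓞 K, x ≠ 0 ∧ Ideal.span {x} = v.asIdeal ^ Nat.card (ClassGroup (𝓞 K)) := by
  have hv : v.asIdeal ∈ nonZeroDivisors (Ideal (𝓞 K)) :=
    mem_nonZeroDivisors_of_ne_zero v.ne_bot
  have h1 : ClassGroup.mk0 (⟨v.asIdeal, hv⟩ ^ Nat.card (ClassGroup (𝓞 K))) = 1 := by
    rw [map_pow]; exact pow_card_eq_one'
  rw [ClassGroup.mk0_eq_one_iff] at h1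
  obtain ⟨x, hx⟩ := h1.principal
  have hx' : Ideal.span {x} = v.asIdeal ^ Nat.card (ClassGroup (𝓞 K)) := by
    rw [← Ideal.submodule_span_eq, ← hx]; rfl
  refine ⟨x, ?_, hx'⟩
  rintro rfl
  rw [Ideal.span_singleton_eq_bot.2 rfl] at hx'
  exact pow_ne_zero _ v.ne_bot hx'.symm

/-- The `v`-adic orders of an `S`-unit for `v ∈ S`. -/
noncomputable def sUnitOrd (S : Set (HeightOneSpectrum (𝓞 K))) :
    Additive (S.unit K) →ₗ[ℤ] (S → ℤ) :=
  AddMonoidHom.toIntLinearMap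
    { toFun := fun x v => ((v : HeightOneSpectrum (𝓞 K)).valuationOfNeZero (K := K)
        (x.toMul : Kˣ)).toAdd
      map_zero' := by ext; simp
      map_add' := fun x y => by ext; simp }

theorem sUnitOrd_eq_zero_iff (S : Set (HeightOneSpectrum (𝓞 K))) (x : Additive (S.unit K)) :
    sUnitOrd S x = 0 ↔ ∀ v : HeightOneSpectrum (𝓞 K), v.valuation K ((x.toMul : Kˣ) : K) = 1 := by
  constructor
  · intro h v
    by_cases hv : v ∈ S
    · have := congrFun h ⟨v, hv⟩
      rw [← HeightOneSpectrum.valuationOfNeZero_eq]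
      have h1 : v.valuationOfNeZero (K := K) (x.toMul : Kˣ) = 1 := this
      rw [h1]; rfl
    · exact x.toMul.2 v hv
  · intro h
    ext v
    have := h v
    rw [← HeightOneSpectrum.valuationOfNeZero_eq] at this
    exact congrArg Multiplicative.toAdd (WithZero.coe_injective this)

/-- The units of the ring of integers, mapped to the `S`-units. -/
noncomputable def unitsToSUnits (S : Set (HeightOneSpectrum (𝓞 K))) :
    Additive (𝓞 K)ˣ →ₗ[ℤ] Additive (S.unit K) :=
  AddMonoidHom.toIntLinearMap (MonoidHom.toAdditive
    ((Units.map (algebraMap (𝓞 K) K : 𝓞 K →* K)).codRestrict (S.unit K) fun x v _ => by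
      rw [← HeightOneSpectrum.valuationOfNeZero_eq, HeightOneSpectrum.valuation_of_unit_eq]; rfl))

theorem unitsToSUnits_injective (S : Set (HeightOneSpectrum (𝓞 K))) :
    Function.Injective (unitsToSUnits S) := by
  intro x y h
  have h1 : (algebraMap (𝓞 K) K) x.toMul = (algebraMap (𝓞 K) K) y.toMul :=
    congrArg (fun z : Additive (S.unit K) => ((z.toMul : Kˣ) : K)) h
  exact Additive.toMul.injective (Units.ext (FaithfulSMul.algebraMap_injective (𝓞 K) K h1))

theorem range_unitsToSUnits (S : Set (HeightOneSpectrum (𝓞 K))) :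
    LinearMap.range (unitsToSUnits S) = LinearMap.ker (sUnitOrd S) := by
  ext x
  rw [LinearMap.mem_ker, sUnitOrd_eq_zero_iff]
  constructor
  · rintro ⟨y, rfl⟩ v
    change v.valuation K ((Units.map (algebraMap (𝓞 K) K : 𝓞 K →* K) y.toMul : Kˣ) : K) = 1
    rw [← HeightOneSpectrum.valuationOfNeZero_eq, HeightOneSpectrum.valuation_of_unit_eq]; rfl
  · intro h
    obtain ⟨a, ha⟩ := HeightOneSpectrum.mem_integers_of_valuation_le_one K
      ((x.toMul : Kˣ) : K) fun v => (h v).le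
    obtain ⟨b, hb⟩ := HeightOneSpectrum.mem_integers_of_valuation_le_one K
      (((x.toMul : Kˣ)⁻¹ : Kˣ) : K) fun v => by
        rw [Units.val_inv_eq_inv_val, map_inv₀, h v, inv_one]
    have hab : a * b = 1 := by
      apply FaithfulSMul.algebraMap_injective (𝓞 K) K
      rw [map_mul, ha, hb, map_one, Units.mul_inv]
    refine ⟨Additive.ofMul ⟨a, b, hab, by rw [mul_comm, hab]⟩, ?_⟩
    exact Additive.toMul.injective (Subtype.ext (Units.ext ha))

theorem sUnit_finite_and_finrank (S : Set (HeightOneSpectrum (𝓞 K))) (hS : S.Finite) :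
    Module.Finite ℤ (Additive (S.unit K)) ∧
      Module.finrank ℤ (Additive (S.unit K)) = S.ncard + Units.rank K := by
  have : Fintype S := hS.fintype
  have hker : Module.Finite ℤ (LinearMap.ker (sUnitOrd S)) := by
    rw [← range_unitsToSUnits]; infer_instance
  have hran : Module.Finite ℤ (LinearMap.range (sUnitOrd S)) := inferInstance
  have hfin : Module.Finite ℤ (Additive (S.unit K)) := by
    have : Module.Finite ℤ (Additive (S.unit K) ⧸ LinearMap.ker (sUnitOrd S)) :=
      Module.Finite.equiv (sUnitOrd S).quotKerEquivRange.symm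
    exact Module.Finite.of_submodule_quotient (LinearMap.ker (sUnitOrd S))
  refine ⟨hfin, ?_⟩
  rw [← Submodule.finrank_quotient_add_finrank (LinearMap.ker (sUnitOrd S)),
    (sUnitOrd S).quotKerEquivRange.finrank_eq]
  congr 1
  · apply le_antisymm
    · refine (Submodule.finrank_le _).trans ?_
      rw [Module.finrank_fintype_fun_eq_card, Set.ncard_eq_toFinset_card', Set.toFinset_card]
    · set h := Nat.card (ClassGroup (𝓞 K)) with hh
      have hh0 : (h : ℤ) ≠ 0 := by
        rw [hh]; exact_mod_cast Nat.card_pos.ne'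
      have hmem : ∀ f : S → ℤ, (h : ℤ) • f ∈ LinearMap.range (sUnitOrd S) := by
        intro f
        classical
        have : (h : ℤ) • f = ∑ v : S, f v • Pi.single v (h : ℤ) := by
          ext w
          simp [Finset.sum_apply, Pi.single_apply, mul_comm]
        rw [this]
        refine Submodule.sum_mem _ fun v _ => Submodule.smul_mem _ _ ?_
        obtain ⟨x, hx0, hx⟩ := exists_span_eq_pow_classNumber (v : HeightOneSpectrum (𝓞 K))
        obtain ⟨h1, h2⟩ := valuation_of_span_eq_pow _ hx
        have hxK : (x : K) ≠ 0 := by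
          rwa [Ne, RingOfIntegers.coe_eq_zero_iff]
        let u : S.unit K := ⟨Units.mk0 (x : K) hxK, fun w hw => h2 w fun e => hw (e ▸ v.2)⟩
        refine ⟨-Additive.ofMul u, ?_⟩
        rw [map_neg]
        ext w
        rw [Pi.neg_apply]
        have h3 : ((w : HeightOneSpectrum (𝓞 K)).valuationOfNeZero (K := K)
            (Units.mk0 (x : K) hxK) : ℤᵐ⁰) = (w : HeightOneSpectrum (𝓞 K)).valuation K (x : K) :=
          HeightOneSpectrum.valuationOfNeZero_eq _ _
        change -((w : HeightOneSpectrum (𝓞 K)).valuationOfNeZero (K := K)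
            (Units.mk0 (x : K) hxK)).toAdd = _
        by_cases hwv : w = v
        · subst hwv
          rw [h1] at h3
          have h4 : (w : HeightOneSpectrum (𝓞 K)).valuationOfNeZero (K := K)
            (Units.mk0 (x : K) hxK) = Multiplicative.ofAdd (-(h : ℤ)) := WithZero.coe_injective h3
          rw [h4]; simp
        · rw [h2 w fun e => hwv (Subtype.ext e)] at h3
          have h4 : (w : HeightOneSpectrum (𝓞 K)).valuationOfNeZero (K := K)
            (Units.mk0 (x : K) hxK) = 1 := WithZero.coe_injective h3
          rw [h4]; simp [hwv]
      let g : (S → ℤ) →ₗ[ℤ] LinearMap.range (sUnitOrd S) :=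
        LinearMap.codRestrict _ ((h : ℤ) • LinearMap.id) hmem
      have hg : Function.Injective g := by
        intro a b hab
        have h5 : (h : ℤ) • a = (h : ℤ) • b := congrArg Subtype.val hab
        exact smul_right_injective _ hh0 h5
      have := LinearMap.finrank_le_finrank_of_injective hg
      rwa [Module.finrank_fintype_fun_eq_card, ← Set.toFinset_card,
        ← Set.ncard_eq_toFinset_card'] at this
  · rw [← range_unitsToSUnits, LinearMap.finrank_range_of_inj (unitsToSUnits_injective S),
      Units.finrank_eq]

theorem card_infinitePlace_eq_rank_add_one :
    Fintype.card (InfinitePlace K) = Units.rank K + 1 := by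
  have : 0 < Fintype.card (InfinitePlace K) := Fintype.card_pos
  rw [Units.rank]
  omega

theorem sUnit_relIndex_pow (S : Set (HeightOneSpectrum (𝓞 K))) (hS : S.Finite) (p : ℕ)
    [hp : Fact p.Prime] {ζ : K} (hζ : IsPrimitiveRoot ζ p) :
    ((S.unit K).map (powMonoidHom p)).relIndex (S.unit K) =
      p ^ (S.ncard + Fintype.card (InfinitePlace K)) := by
  obtain ⟨h1, h2⟩ := sUnit_finite_and_finrank S hS
  rw [Subgroup.relIndex_map_powMonoidHom,
    (LinearMap.cokerCard_natCast (A := Additive (S.unit K)) p hp.1.ne_zero).1, h2,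
    card_infinitePlace_eq_rank_add_one, ← add_assoc, pow_succ]
  congr 1
  have : NeZero p := ⟨hp.1.ne_zero⟩
  have hc : Nat.card (rootsOfUnity p K) = p := by
    exact hζ.card_rootsOfUnity
  refine Eq.trans ?_ hc
  refine Nat.card_congr ⟨fun x => ⟨(x.1.toMul : Kˣ), ?_⟩,
    fun x => ⟨Additive.ofMul ⟨x.1, fun v _ => ?_⟩, ?_⟩, fun x => rfl, fun x => rfl⟩
  · have := x.2
    rw [LinearMap.mem_ker, Module.End.natCast_apply] at this
    rw [mem_rootsOfUnity]
    exact congrArg (fun z : Additive (S.unit K) => (z.toMul : Kˣ)) this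
  · have h3 := (mem_rootsOfUnity' p _).1 x.2
    have h4 := congrArg (v.valuation K) h3
    rw [map_pow, map_one] at h4
    exact (pow_eq_one_iff_left hp.1.ne_zero).1 h4
  · rw [LinearMap.mem_ker, Module.End.natCast_apply]
    exact Additive.toMul.injective (Subtype.ext ((mem_rootsOfUnity p _).1 x.2))

end SUnits

section PrimeFibers

open NumberField IsDedekindDomain WithZero
open scoped Pointwise

variable {K L : Type*} [Field K] [NumberField K] [Field L] [NumberField L] [Algebra K L]

variable (L) in
/-- The primes of `L` above the prime `v` of `K`. -/
def primeFiber (v : HeightOneSpectrum (𝓞 K)) : Set (HeightOneSpectrum (𝓞 L)) :=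
  {w | w.under (𝓞 K) = v}

variable (K) in
/-- The ramification index over `K` of a prime `w` of `L`. -/
noncomputable def ramIdx (w : HeightOneSpectrum (𝓞 L)) : ℕ :=
  (w.under (𝓞 K)).asIdeal.ramificationIdx' w.asIdeal

theorem valuation_algebraMap_eq_pow (w : HeightOneSpectrum (𝓞 L)) (x : K) :
    w.valuation L (algebraMap K L x) = (w.under (𝓞 K)).valuation K x ^ ramIdx K w := by
  have : w.asIdeal.LiesOver (w.under (𝓞 K)).asIdeal := ⟨rfl⟩
  rw [ramIdx, HeightOneSpectrum.valuation_liesOver L]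

theorem ramIdx_ne_zero (w : HeightOneSpectrum (𝓞 L)) : ramIdx K w ≠ 0 := by
  have : w.asIdeal.LiesOver (w.under (𝓞 K)).asIdeal := ⟨rfl⟩
  exact Ideal.IsDedekindDomain.ramificationIdx'_ne_zero_of_liesOver w.asIdeal (w.under (𝓞 K)).ne_bot

theorem valuation_algebraMap_eq_one_iff (w : HeightOneSpectrum (𝓞 L)) (x : K) :
    w.valuation L (algebraMap K L x) = 1 ↔ (w.under (𝓞 K)).valuation K x = 1 := by
  rw [valuation_algebraMap_eq_pow, pow_eq_one_iff_left (ramIdx_ne_zero w)]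

theorem under_surjective (v : HeightOneSpectrum (𝓞 K)) :
    ∃ w : HeightOneSpectrum (𝓞 L), w.under (𝓞 K) = v := by
  obtain ⟨⟨P, hP, hPv⟩⟩ := v.asIdeal.nonempty_primesOver (S := 𝓞 L)
  refine ⟨⟨P, hP, Ideal.ne_bot_of_mem_primesOver v.ne_bot ⟨hP, hPv⟩⟩, ?_⟩
  ext1
  exact hPv.over.symm

theorem primeFiber_image (v : HeightOneSpectrum (𝓞 K)) :
    Set.image HeightOneSpectrum.asIdeal (primeFiber L v) = v.asIdeal.primesOver (𝓞 L) := by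
  ext P
  constructor
  · rintro ⟨w, rfl, rfl⟩
    exact ⟨w.isPrime, ⟨rfl⟩⟩
  · rintro ⟨hP, hPv⟩
    refine ⟨⟨P, hP, Ideal.ne_bot_of_mem_primesOver v.ne_bot ⟨hP, hPv⟩⟩, ?_, rfl⟩
    change HeightOneSpectrum.under _ _ = _
    ext1
    exact hPv.over.symm

theorem asIdeal_injective :
    Function.Injective (HeightOneSpectrum.asIdeal : HeightOneSpectrum (𝓞 L) → Ideal (𝓞 L)) :=
  fun _ _ h => HeightOneSpectrum.ext h

theorem primeFiber_finite (v : HeightOneSpectrum (𝓞 K)) : (primeFiber L v).Finite := by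
  have := v.isMaximal
  refine Set.Finite.of_finite_image ?_ asIdeal_injective.injOn
  rw [primeFiber_image]
  exact IsDedekindDomain.primesOver_finite _ _

theorem ncard_primeFiber (v : HeightOneSpectrum (𝓞 K)) :
    (primeFiber L v).ncard = (v.asIdeal.primesOver (𝓞 L)).ncard := by
  rw [← primeFiber_image, Set.ncard_image_of_injective _ asIdeal_injective]

/-- The image of a prime `w` of `L` under an automorphism `σ`. -/
noncomputable def galPrime (σ : L ≃ₐ[K] L) (w : HeightOneSpectrum (𝓞 L)) :
    HeightOneSpectrum (𝓞 L) where
  asIdeal := σ • w.asIdeal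
  isPrime := inferInstance
  ne_bot h := w.ne_bot (by
    rw [← inv_smul_smul σ w.asIdeal, h]
    exact Ideal.map_bot)

theorem intValuation_galPrime (σ : L ≃ₐ[K] L) (w : HeightOneSpectrum (𝓞 L)) (x : 𝓞 L) :
    (galPrime σ w).intValuation (σ • x) = w.intValuation x := by
  have key : ∀ n : ℕ, (galPrime σ w).intValuation (σ • x) ≤ exp (-(n : ℤ)) ↔
      w.intValuation x ≤ exp (-(n : ℤ)) := by
    intro n
    rw [HeightOneSpectrum.intValuation_le_pow_iff_mem,
      HeightOneSpectrum.intValuation_le_pow_iff_mem]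
    change σ • x ∈ (σ • w.asIdeal) ^ n ↔ _
    rw [← smul_pow', Ideal.smul_mem_pointwise_smul_iff]
  by_cases hx : x = 0
  · simp [hx]
  have hx' : σ • x ≠ 0 := (smul_ne_zero_iff_ne σ).2 hx
  rw [HeightOneSpectrum.intValuation_if_neg _ hx, HeightOneSpectrum.intValuation_if_neg _ hx'] at *
  simp only [exp_le_exp, neg_le_neg_iff, Nat.cast_le] at key
  congr 3
  exact le_antisymm ((key _).1 le_rfl) ((key _).2 le_rfl)

theorem valuation_galPrime (σ : L ≃ₐ[K] L) (w : HeightOneSpectrum (𝓞 L)) (x : L) :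
    (galPrime σ w).valuation L (σ x) = w.valuation L x := by
  obtain ⟨x, y, hy, rfl⟩ := IsFractionRing.div_surjective (A := 𝓞 L) x
  have h : ∀ z : 𝓞 L, σ (algebraMap (𝓞 L) L z) = algebraMap (𝓞 L) L (σ • z) := fun _ => rfl
  simp [h, HeightOneSpectrum.valuation_of_algebraMap, intValuation_galPrime]

theorem galPrime_under (σ : L ≃ₐ[K] L) (w : HeightOneSpectrum (𝓞 L)) :
    (galPrime σ w).under (𝓞 K) = w.under (𝓞 K) := by
  ext1
  ext x
  have h : algebraMap (𝓞 K) (𝓞 L) x = σ • algebraMap (𝓞 K) (𝓞 L) x := by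
    apply RingOfIntegers.ext
    exact (σ.commutes (x : K)).symm
  change algebraMap (𝓞 K) (𝓞 L) x ∈ σ • w.asIdeal ↔ algebraMap (𝓞 K) (𝓞 L) x ∈ w.asIdeal
  rw [h, Ideal.smul_mem_pointwise_smul_iff, ← h]

theorem exists_galPrime_eq [IsGalois K L] {w w' : HeightOneSpectrum (𝓞 L)}
    (h : w.under (𝓞 K) = w'.under (𝓞 K)) : ∃ σ : L ≃ₐ[K] L, galPrime σ w = w' := by
  have h1 : w.asIdeal.LiesOver (w.under (𝓞 K)).asIdeal := ⟨rfl⟩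
  have h2 : w'.asIdeal.LiesOver (w.under (𝓞 K)).asIdeal := by rw [h]; exact ⟨rfl⟩
  obtain ⟨σ, hσ⟩ := Ideal.exists_smul_eq_of_isGaloisGroup (w.under (𝓞 K)).asIdeal
    w.asIdeal w'.asIdeal (L ≃ₐ[K] L)
  exact ⟨σ, HeightOneSpectrum.ext hσ⟩

theorem ncard_mul_ramIdx_mul [IsGalois K L] (w : HeightOneSpectrum (𝓞 L)) :
    ∃ f : ℕ, (primeFiber L (w.under (𝓞 K))).ncard * (ramIdx K w * f) = Module.finrank K L ∧
      Ideal.absNorm w.asIdeal = Ideal.absNorm (w.under (𝓞 K)).asIdeal ^ f := by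
  have h1 : w.asIdeal.LiesOver (w.under (𝓞 K)).asIdeal := ⟨rfl⟩
  have := (w.under (𝓞 K)).isMaximal
  have := w.isMaximal
  refine ⟨(w.under (𝓞 K)).asIdeal.inertiaDeg' w.asIdeal, ?_,
    Ideal.absNorm_eq_pow_inertiaDeg'_of_liesOver _ _ (w.under (𝓞 K)).isPrime
      (w.under (𝓞 K)).ne_bot⟩
  have h2 := Ideal.ncard_primesOver_mul_ramificationIdxIn_mul_inertiaDegIn
    (w.under (𝓞 K)).asIdeal (𝓞 L) (L ≃ₐ[K] L)
  rw [Ideal.ramificationIdxIn_eq_ramificationIdx _ w.asIdeal (L ≃ₐ[K] L),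
    Ideal.inertiaDegIn_eq_inertiaDeg _ w.asIdeal (L ≃ₐ[K] L), IsGalois.card_aut_eq_finrank] at h2
  rw [← h2, ncard_primeFiber, ramIdx,
    Ideal.ramificationIdx'_eq_ramificationIdx _ _ (w.under (𝓞 K)).ne_bot,
    Ideal.inertiaDeg'_eq_inertiaDeg]

theorem prime_degree_trichotomy [IsGalois K L] {p : ℕ} (hp : p.Prime)
    (hL : Module.finrank K L = p) (w : HeightOneSpectrum (𝓞 L)) :
    ((primeFiber L (w.under (𝓞 K))).ncard = p ∧ ramIdx K w = 1 ∧
      Ideal.absNorm w.asIdeal = Ideal.absNorm (w.under (𝓞 K)).asIdeal) ∨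
    ((primeFiber L (w.under (𝓞 K))).ncard = 1 ∧ ramIdx K w = 1 ∧
      Ideal.absNorm w.asIdeal = Ideal.absNorm (w.under (𝓞 K)).asIdeal ^ p) ∨
    ((primeFiber L (w.under (𝓞 K))).ncard = 1 ∧ ramIdx K w = p ∧
      Ideal.absNorm w.asIdeal = Ideal.absNorm (w.under (𝓞 K)).asIdeal) := by
  obtain ⟨f, h1, h2⟩ := ncard_mul_ramIdx_mul (K := K) w
  rw [hL] at h1
  rcases hp.eq_one_or_self_of_dvd _ ⟨_, h1.symm⟩ with h3 | h3
  · rw [h3, one_mul] at h1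
    rcases hp.eq_one_or_self_of_dvd _ ⟨_, h1.symm⟩ with h4 | h4
    · rw [h4, one_mul] at h1
      exact Or.inr (Or.inl ⟨h3, h4, h1 ▸ h2⟩)
    · rw [h4, mul_eq_left₀ hp.ne_zero] at h1
      rw [h1, pow_one] at h2
      exact Or.inr (Or.inr ⟨h3, h4, h2⟩)
  · rw [h3, mul_eq_left₀ hp.ne_zero] at h1
    obtain ⟨h4, h5⟩ := mul_eq_one.1 h1
    rw [h5, pow_one] at h2
    exact Or.inl ⟨h3, h4, h2⟩

theorem galPrime_eq_of_ncard_eq_one {w : HeightOneSpectrum (𝓞 L)}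
    (h : (primeFiber L (w.under (𝓞 K))).ncard = 1) (σ : L ≃ₐ[K] L) : galPrime σ w = w := by
  obtain ⟨w', hw'⟩ := Set.ncard_eq_one.1 h
  have h1 : galPrime σ w ∈ primeFiber L (w.under (𝓞 K)) := galPrime_under σ w
  have h2 : w ∈ primeFiber L (w.under (𝓞 K)) := rfl
  rw [hw'] at h1 h2
  exact h1.trans h2.symm

theorem valuation_gal_of_ncard_eq_one {w : HeightOneSpectrum (𝓞 L)}
    (h : (primeFiber L (w.under (𝓞 K))).ncard = 1) (σ : L ≃ₐ[K] L) (x : L) :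
    w.valuation L (σ x) = w.valuation L x := by
  conv_lhs => rw [← galPrime_eq_of_ncard_eq_one h σ]
  exact valuation_galPrime σ w x

/-- If the residue field does not grow, every integer of `L` is congruent to an integer of `K`. -/
theorem exists_sub_mem_of_absNorm_eq {w : HeightOneSpectrum (𝓞 L)}
    (h : Ideal.absNorm w.asIdeal = Ideal.absNorm (w.under (𝓞 K)).asIdeal) (x : 𝓞 L) :
    ∃ y : 𝓞 K, x - algebraMap (𝓞 K) (𝓞 L) y ∈ w.asIdeal := by
  have h1 : w.asIdeal.LiesOver (w.under (𝓞 K)).asIdeal := ⟨rfl⟩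
  have hfin : Finite (𝓞 L ⧸ w.asIdeal) := Ideal.finiteQuotientOfFreeOfNeBot _ w.ne_bot
  have hinj : Function.Injective (algebraMap (𝓞 K ⧸ (w.under (𝓞 K)).asIdeal) (𝓞 L ⧸ w.asIdeal)) :=
    Ideal.algebraMap_quotient_injective
  have hbij := hinj.bijective_of_nat_card_le (by
    rw [Ideal.absNorm_apply, Ideal.absNorm_apply] at h
    exact h.le)
  obtain ⟨y, hy⟩ := hbij.2 (Ideal.Quotient.mk _ x)
  obtain ⟨y, rfl⟩ := Ideal.Quotient.mk_surjective y
  refine ⟨y, ?_⟩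
  rw [← Ideal.Quotient.eq, ← hy]
  rfl

end PrimeFibers

section Kummer

open Polynomial

/-- The extension `L / K` of prime degree `p` is generated by a `p`-th root `α` of `a`, where `K`
contains the primitive `p`-th root of unity `ζ`, and `σ` is the automorphism with `σ α = ζ α`. -/
structure KummerDatum {K L : Type*} [Field K] [Field L] [Algebra K L] (p : ℕ) (ζ a : K) (α : L)
    (σ : L ≃ₐ[K] L) : Prop where
  prime : p.Prime
  prim : IsPrimitiveRoot ζ p
  ne_zero : a ≠ 0
  pow_eq : α ^ p = algebraMap K L a
  finrank_eq : Module.finrank K L = p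
  gal : σ α = algebraMap K L ζ * α

/-- Kummer extensions of prime degree exist. -/
theorem exists_kummerDatum {K : Type*} [Field K] {p : ℕ} (hp : p.Prime) {ζ a : K}
    (hζ : IsPrimitiveRoot ζ p) (ha0 : a ≠ 0) (ha : ∀ c : K, c ^ p ≠ a) :
    ∃ (_ : Fact (Irreducible (X ^ p - C a))) (σ : AdjoinRoot (X ^ p - C a) ≃ₐ[K] _),
      KummerDatum p ζ a (AdjoinRoot.root (X ^ p - C a)) σ := by
  have hirr : Irreducible (X ^ p - C a) := X_pow_sub_C_irreducible_of_prime hp ha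
  have : NeZero p := ⟨hp.ne_zero⟩
  have hF : Fact (Irreducible (X ^ p - C a)) := ⟨hirr⟩
  have hmem : (primitiveRoots p K).Nonempty := ⟨ζ, (mem_primitiveRoots hp.pos).2 hζ⟩
  refine ⟨hF, autAdjoinRootXPowSubC p a hζ.toRootsOfUnity, hp, hζ, ha0, ?_, ?_, ?_⟩
  · have h := AdjoinRoot.eval₂_root (X ^ p - C a)
    rw [eval₂_sub, eval₂_X_pow, eval₂_C, sub_eq_zero] at h
    exact h
  · have := (AdjoinRoot.powerBasis hirr.ne_zero).finrank
    rw [this, AdjoinRoot.powerBasis_dim, natDegree_X_pow_sub_C]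
  · rw [autAdjoinRootXPowSubC_root, Algebra.smul_def]
    rfl

namespace KummerDatum

variable {K L : Type*} [Field K] [Field L] [Algebra K L] {p : ℕ} {ζ a : K} {α : L}
  {σ : L ≃ₐ[K] L} (D : KummerDatum p ζ a α σ)
include D

theorem finiteDimensional : FiniteDimensional K L :=
  Module.finite_of_finrank_pos (D.finrank_eq ▸ D.prime.pos)

theorem root_ne_zero : α ≠ 0 := by
  rintro rfl
  have := D.pow_eq
  rw [zero_pow D.prime.ne_zero, eq_comm, map_eq_zero] at this
  exact D.ne_zero this

theorem pow_apply_root (i : ℕ) : (σ ^ i) α = algebraMap K L ζ ^ i * α := by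
  induction i with
  | zero => simp
  | succ n ih =>
    rw [pow_succ', AlgEquiv.mul_apply, ih, map_mul, map_pow, AlgEquiv.commutes, D.gal]
    ring

theorem orderOf_ge : p ≤ orderOf σ ∨ orderOf σ = 0 := by
  by_cases h : orderOf σ = 0
  · exact Or.inr h
  left
  have h1 := D.pow_apply_root (orderOf σ)
  rw [pow_orderOf_eq_one, AlgEquiv.one_apply] at h1
  have h2 : algebraMap K L (ζ ^ orderOf σ) = algebraMap K L 1 := by
    rw [map_pow, map_one]
    exact mul_right_cancel₀ D.root_ne_zero (by rw [one_mul]; exact h1.symm)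
  exact Nat.le_of_dvd (Nat.pos_of_ne_zero h)
    (D.prim.dvd_of_pow_eq_one _ ((algebraMap K L).injective h2))

theorem orderOf_eq_and_card : orderOf σ = p ∧ Nat.card (L ≃ₐ[K] L) = p := by
  have := D.finiteDimensional
  have h1 : Nat.card (L ≃ₐ[K] L) ≤ p := by
    rw [Nat.card_eq_fintype_card, ← D.finrank_eq]
    exact AlgEquiv.card_le
  have h2 : orderOf σ ≤ Nat.card (L ≃ₐ[K] L) := orderOf_le_card
  have h3 : 0 < orderOf σ := orderOf_pos σ
  have := D.orderOf_ge
  omega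

theorem pow_eq_one : σ ^ p = 1 := by
  rw [← D.orderOf_eq_and_card.1, pow_orderOf_eq_one]

theorem isGalois : IsGalois K L := by
  have := D.finiteDimensional
  exact IsGalois.of_card_aut_eq_finrank K L (D.orderOf_eq_and_card.2.trans D.finrank_eq.symm)

theorem mem_zpowers (τ : L ≃ₐ[K] L) : τ ∈ Subgroup.zpowers σ := by
  have := D.finiteDimensional
  have : Subgroup.zpowers σ = ⊤ := by
    rw [← Subgroup.card_eq_iff_eq_top, Nat.card_zpowers, D.orderOf_eq_and_card.1,
      D.orderOf_eq_and_card.2]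
  rw [this]
  trivial

theorem exists_eq_pow (τ : L ≃ₐ[K] L) : ∃ i < p, τ = σ ^ i := by
  classical
  have := D.finiteDimensional
  obtain ⟨i, hi, h⟩ := mem_zpowers_iff_mem_range_orderOf.1 (D.mem_zpowers τ) |> Finset.mem_image.1
  rw [D.orderOf_eq_and_card.1] at hi
  exact ⟨i, Finset.mem_range.1 hi, h.symm⟩

theorem algebraMap_norm (y : L) :
    algebraMap K L (Algebra.norm K y) = ∏ i ∈ Finset.range p, (σ ^ i) y := by
  have := D.finiteDimensional
  have := D.isGalois
  rw [Algebra.norm_eq_prod_automorphisms]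
  symm
  refine Finset.prod_bij (fun i _ => σ ^ i) (fun _ _ => Finset.mem_univ _) ?_ ?_ (fun _ _ => rfl)
  · intro i hi j hj h
    rw [Finset.mem_range] at hi hj
    exact pow_injOn_Iio_orderOf (by rw [D.orderOf_eq_and_card.1]; exact hi)
      (by rw [D.orderOf_eq_and_card.1]; exact hj) h
  · intro τ _
    obtain ⟨i, hi, rfl⟩ := D.exists_eq_pow τ
    exact ⟨i, Finset.mem_range.2 hi, rfl⟩

theorem exists_algebraMap_eq {x : L} (hx : σ x = x) : ∃ y : K, algebraMap K L y = x := by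
  have := D.finiteDimensional
  have := D.isGalois
  refine (IsGalois.mem_bot_iff_fixed (F := K) x).2 fun τ => ?_
  obtain ⟨i, -, rfl⟩ := D.exists_eq_pow τ
  induction i with
  | zero => rfl
  | succ n ih => rw [pow_succ, AlgEquiv.mul_apply, hx, ih]

theorem pow_injective : Function.Injective fun i : Fin p => σ ^ (i : ℕ) := by
  intro i j h
  exact Fin.ext (pow_injOn_Iio_orderOf (by rw [D.orderOf_eq_and_card.1]; exact i.2)
    (by rw [D.orderOf_eq_and_card.1]; exact j.2) h)

/-- Hilbert's Theorem 90. -/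
theorem exists_eq_div_of_norm_eq_one {x : L} (hx : Algebra.norm K x = 1) :
    ∃ y : L, y ≠ 0 ∧ x = σ y / y := by
  have hN : ∏ i ∈ Finset.range p, (σ ^ i) x = 1 := by
    rw [← D.algebraMap_norm, hx, map_one]
  let c : ℕ → L := fun i => ∏ j ∈ Finset.range i, (σ ^ j) x
  have hc : ∀ i, c (i + 1) = x * σ (c i) := by
    intro i
    simp only [c]
    rw [Finset.prod_range_succ', map_prod, mul_comm]
    congr 1
    exact Finset.prod_congr rfl fun k _ => by rw [pow_succ', AlgEquiv.mul_apply]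
  obtain ⟨z, hz⟩ : ∃ z : L, ∑ i : Fin p, c i * (σ ^ (i : ℕ)) z ≠ 0 := by
    by_contra! hcon
    have hli : LinearIndependent L
        (fun i : Fin p => ((σ ^ (i : ℕ) : L ≃ₐ[K] L) : L →* L) : Fin p → L → L) :=
      (linearIndependent_monoidHom L L).comp _ (fun i j h => D.pow_injective
        (AlgEquiv.ext fun t => DFunLike.congr_fun h t))
    have h0 := Fintype.linearIndependent_iff.1 hli (fun i => c i) (by
      ext z
      rw [Finset.sum_apply]
      exact hcon z) ⟨0, D.prime.pos⟩
    simp [c] at h0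
  set y := ∑ i : Fin p, c i * (σ ^ (i : ℕ)) z with hy
  have h1 : x * σ y = y := by
    rw [hy, Fin.sum_univ_eq_sum_range (fun i => c i * (σ ^ i) z), map_sum, Finset.mul_sum]
    have h2 : ∀ i ∈ Finset.range p, x * σ (c i * (σ ^ i) z) = c (i + 1) * (σ ^ (i + 1)) z := by
      intro i _
      rw [map_mul, ← mul_assoc, ← hc, pow_succ', AlgEquiv.mul_apply]
    rw [Finset.sum_congr rfl h2]
    have h3 := Finset.sum_range_succ (fun i => c i * (σ ^ i) z) p
    rw [Finset.sum_range_succ'] at h3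
    have h4 : c p = 1 := hN
    have h5 : c 0 = 1 := rfl
    rw [h4, h5, D.pow_eq_one, pow_zero] at h3
    exact add_right_cancel h3
  refine ⟨y⁻¹, inv_ne_zero hz, ?_⟩
  have h6 : σ y ≠ 0 := by simpa using hz
  rw [map_inv₀, inv_div_inv, eq_div_iff h6, h1]

theorem exists_zeta_mul {x : L} {u : K} (hu : u ≠ 0) (hx : x ^ p = algebraMap K L u) :
    ∃ j < p, σ x = algebraMap K L ζ ^ j * x := by
  have hx0 : x ≠ 0 := by
    rintro rfl
    rw [zero_pow D.prime.ne_zero, eq_comm, map_eq_zero] at hx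
    exact hu hx
  have h1 : (σ x / x) ^ p = 1 := by
    rw [div_pow, ← map_pow, hx, AlgEquiv.commutes, div_self]
    simpa using hu
  have hζ := D.prim.map_of_injective (algebraMap K L).injective
  have : NeZero p := ⟨D.prime.ne_zero⟩
  obtain ⟨j, hj, h⟩ := hζ.eq_pow_of_pow_eq_one h1
  exact ⟨j, hj, by rw [h, div_mul_cancel₀ _ hx0]⟩

/-- An element of `K` that becomes a `p`-th power in `L` is a power of `a` times a `p`-th power. -/
theorem eq_pow_mul_pow_of_isPow {x : L} {u : K} (hu : u ≠ 0) (hx : x ^ p = algebraMap K L u) :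
    ∃ (j : ℕ) (c : K), u = a ^ j * c ^ p := by
  obtain ⟨j, -, hj⟩ := D.exists_zeta_mul hu hx
  have hα := D.root_ne_zero
  have hζ0 : algebraMap K L ζ ≠ 0 := by simpa using D.prim.ne_zero D.prime.ne_zero
  have h1 : σ (x / α ^ j) = x / α ^ j := by
    rw [map_div₀, map_pow, hj, D.gal, mul_pow]
    field_simp
  obtain ⟨c, hc⟩ := D.exists_algebraMap_eq h1
  refine ⟨j, c, (algebraMap K L).injective ?_⟩
  rw [map_mul, map_pow, map_pow, hc, ← hx, ← D.pow_eq, div_pow]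
  field_simp
  ring

theorem not_isPow (c : K) : c ^ p ≠ a := by
  intro h
  have hc : c ≠ 0 := by
    rintro rfl
    rw [zero_pow D.prime.ne_zero] at h
    exact D.ne_zero h.symm
  have hα : (α / algebraMap K L c) ^ p = 1 := by
    rw [div_pow, D.pow_eq, ← map_pow, h, div_self]
    simpa using D.ne_zero
  have : NeZero p := ⟨D.prime.ne_zero⟩
  obtain ⟨j, -, hj⟩ :=
    (D.prim.map_of_injective (algebraMap K L).injective).eq_pow_of_pow_eq_one hα
  have h1 : α = algebraMap K L (ζ ^ j * c) := by
    rw [map_mul, map_pow, hj, div_mul_cancel₀]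
    simpa using hc
  have h2 := D.gal
  rw [h1, AlgEquiv.commutes, ← map_mul] at h2
  have h3 := (algebraMap K L).injective h2
  have h4 : ζ = 1 := by
    have : ζ ^ j * c ≠ 0 := mul_ne_zero (pow_ne_zero _ (D.prim.ne_zero D.prime.ne_zero)) hc
    exact (mul_eq_right₀ this).1 h3.symm
  exact D.prim.ne_one D.prime.one_lt h4

end KummerDatum

end Kummer

section RootsOfUnity

variable {K : Type*} [Field K] {p : ℕ} {ζ : K}

open Polynomial in
theorem IsPrimitiveRoot.prod_X_sub_pow (hp : 0 < p) (hζ : IsPrimitiveRoot ζ p) :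
    ∏ i ∈ Finset.range p, (X - C (ζ ^ i)) = X ^ p - 1 := by
  have := X_pow_sub_C_eq_prod hζ hp (one_pow p : (1 : K) ^ p = 1)
  simpa using this.symm

theorem IsPrimitiveRoot.prod_sub_pow (hp : 0 < p) (hζ : IsPrimitiveRoot ζ p) (x : K) :
    ∏ i ∈ Finset.range p, (x - ζ ^ i) = x ^ p - 1 := by
  simpa [Polynomial.eval_prod] using congrArg (Polynomial.eval x) (hζ.prod_X_sub_pow hp)

open Polynomial in
theorem IsPrimitiveRoot.prod_one_sub_pow_succ (hp : 0 < p) (hζ : IsPrimitiveRoot ζ p) :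
    ∏ i ∈ Finset.range (p - 1), (1 - ζ ^ (i + 1)) = (p : K) := by
  have h1 := hζ.prod_X_sub_pow hp
  obtain ⟨n, rfl⟩ : ∃ n, p = n + 1 := ⟨p - 1, by omega⟩
  rw [Finset.prod_range_succ', ← geom_sum_mul, pow_zero, C_1] at h1
  have h2 := mul_right_cancel₀ (X_sub_C_ne_zero (1 : K)) (by simpa using h1)
  simpa [Polynomial.eval_prod, Polynomial.eval_finsetSum] using congrArg (Polynomial.eval 1) h2

variable {Γ : Type*} [LinearOrderedCommGroupWithZero Γ] (ν : Valuation K Γ)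

theorem Valuation.eq_one_of_pow_eq_one (hp : p ≠ 0) {x : K} (hx : x ^ p = 1) : ν x = 1 :=
  (pow_eq_one_iff_left hp).1 (by rw [← map_pow, hx, map_one])

theorem Valuation.zeta_eq_one (hp : p ≠ 0) (hζ : IsPrimitiveRoot ζ p) : ν ζ = 1 :=
  ν.eq_one_of_pow_eq_one hp hζ.pow_eq_one

theorem Valuation.zeta_pow_eq_one (hp : p ≠ 0) (hζ : IsPrimitiveRoot ζ p) (i : ℕ) :
    ν (ζ ^ i) = 1 := by
  rw [map_pow, ν.zeta_eq_one hp hζ, one_pow]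

theorem Valuation.one_sub_zeta_pow_le_one (hp : p ≠ 0) (hζ : IsPrimitiveRoot ζ p) (i : ℕ) :
    ν (1 - ζ ^ i) ≤ 1 :=
  (ν.map_sub _ _).trans (by rw [map_one, ν.zeta_pow_eq_one hp hζ, max_self])

theorem Valuation.le_one_sub_zeta_pow (hp : p.Prime) (hζ : IsPrimitiveRoot ζ p) {j : ℕ}
    (hj : ¬ p ∣ j) : ν p ≤ ν (1 - ζ ^ j) := by
  have h0 : j % p ≠ 0 := fun h => hj (Nat.dvd_of_mod_eq_zero h)
  have hlt := Nat.mod_lt j hp.pos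
  have hmod : ζ ^ j = ζ ^ (j % p) := by
    conv_lhs => rw [← Nat.mod_add_div j p, pow_add, pow_mul, hζ.pow_eq_one, one_pow, mul_one]
  rw [hmod, ← hζ.prod_one_sub_pow_succ hp.pos, map_prod,
    ← Finset.mul_prod_erase _ _ (Finset.mem_range.2 (show j % p - 1 < p - 1 by omega)),
    Nat.sub_add_cancel (by omega)]
  exact mul_le_of_le_one_right' (Finset.prod_le_one' fun i _ =>
    ν.one_sub_zeta_pow_le_one hp.ne_zero hζ _)

theorem Valuation.exists_sub_zeta_pow_lt (hp : p.Prime) (hζ : IsPrimitiveRoot ζ p) {x : K}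
    (hx : ν (x ^ p - 1) < ν p ^ p) : ∃ i < p, ν (x - ζ ^ i) < ν p := by
  by_contra! h
  rw [← hζ.prod_sub_pow hp.pos, map_prod] at hx
  refine hx.not_ge ?_
  calc ν p ^ p = ∏ i ∈ Finset.range p, ν p := by simp
    _ ≤ _ := Finset.prod_le_prod' fun i hi => h i (Finset.mem_range.1 hi)

/-- An element whose `p`-th power is close to `1` is close to a `p`-th root of unity. -/
theorem Valuation.exists_sub_zeta_pow_mul_lt (hp : p.Prime) (hζ : IsPrimitiveRoot ζ p) {x : K}
    (hx : ν (x ^ p - 1) < ν p ^ p) : ∃ i < p, ν (x - ζ ^ i) * ν p < ν p ^ p := by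
  obtain ⟨i, hi, hlt⟩ := ν.exists_sub_zeta_pow_lt hp hζ hx
  refine ⟨i, hi, lt_of_le_of_lt ?_ hx⟩
  have hz : ζ ^ i ≠ 0 := pow_ne_zero _ (hζ.ne_zero hp.ne_zero)
  set y := x / ζ ^ i with hy
  have hνz := ν.zeta_pow_eq_one hp.ne_zero hζ i
  have hxy : x - ζ ^ i = ζ ^ i * (y - 1) := by rw [hy]; field_simp
  have hyp : x ^ p = y ^ p := by
    rw [hy, div_pow, ← pow_mul, mul_comm i p, pow_mul, hζ.pow_eq_one, one_pow, div_one]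
  rw [hxy, map_mul, hνz, one_mul] at hlt ⊢
  rw [hyp, ← hζ.prod_sub_pow hp.pos, map_prod]
  have hpp : p = p - 1 + 1 := by have := hp.pos; omega
  conv_rhs => rw [hpp, Finset.prod_range_succ', pow_zero, mul_comm]
  refine mul_le_mul_right ?_ _
  rw [← hζ.prod_one_sub_pow_succ hp.pos, map_prod]
  refine Finset.prod_le_prod' fun j hj => ?_
  have h1 : ν (y - 1) < ν (1 - ζ ^ (j + 1)) :=
    hlt.trans_le (ν.le_one_sub_zeta_pow hp hζ (Nat.not_dvd_of_pos_of_lt (by omega)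
      (by have := Finset.mem_range.1 hj; omega)))
  have h2 : y - ζ ^ (j + 1) = (1 - ζ ^ (j + 1)) + (y - 1) := by ring
  rw [h2, ν.map_add_eq_of_lt_left h1]

theorem Valuation.prod_sub_pow_lt_one {f : ℕ → K} {t : K} (ht : ν t ≤ 1)
    (hf : ∀ i, ν (f i - t) < 1) (n : ℕ) : ν (∏ i ∈ Finset.range n, f i - t ^ n) < 1 := by
  induction n with
  | zero => simp
  | succ n ih =>
    have hfn : ν (f n) ≤ 1 := by
      simpa using ν.map_add_le (hf n).le ht
    have : ∏ i ∈ Finset.range (n + 1), f i - t ^ (n + 1) =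
        (∏ i ∈ Finset.range n, f i - t ^ n) * f n + t ^ n * (f n - t) := by
      rw [Finset.prod_range_succ]; ring
    rw [this]
    refine ν.map_add_lt ?_ ?_
    · rw [map_mul]; exact mul_lt_one_of_lt_of_le ih hfn
    · rw [map_mul, map_pow]
      exact mul_lt_one_of_nonneg_of_lt_one_right (pow_le_one₀ zero_le ht) zero_le (hf n)

end RootsOfUnity

section LocalPowers

open NumberField IsDedekindDomain WithZero

variable {K : Type*} [Field K] [NumberField K]

theorem HeightOneSpectrum.valuation_natCast_le_one (v : HeightOneSpectrum (𝓞 K)) (n : ℕ) :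
    v.valuation K n ≤ 1 := by
  have := v.valuation_le_one (K := K) (n : 𝓞 K)
  simpa using this

/-- The units of `K` that are `v`-adically closer to `1` than `p ^ p`. -/
def near (p : ℕ) (v : HeightOneSpectrum (𝓞 K)) : Subgroup Kˣ where
  carrier := {x | v.valuation K x = 1 ∧ v.valuation K ((x : K) - 1) < v.valuation K p ^ p ∨ x = 1}
  one_mem' := Or.inr rfl
  mul_mem' := by
    rintro x y (⟨hx, hx1⟩ | rfl) (⟨hy, hy1⟩ | rfl)
    · left
      refine ⟨by simp [hx, hy], ?_⟩
      have : ((x * y : Kˣ) : K) - 1 = x * (y - 1) + (x - 1) := by push_cast; ring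
      rw [this]
      exact Valuation.map_add_lt _ (by rwa [map_mul, hx, one_mul]) hx1
    · left; simpa using ⟨hx, hx1⟩
    · left; simpa using ⟨hy, hy1⟩
    · right; simp
  inv_mem' := by
    rintro x (⟨hx, hx1⟩ | rfl)
    · left
      refine ⟨by simp [hx], ?_⟩
      have : ((x⁻¹ : Kˣ) : K) - 1 = -(x⁻¹ * (x - 1)) := by
        have := x.ne_zero
        push_cast; field_simp; ring
      rw [this, Valuation.map_neg, map_mul, Units.val_inv_eq_inv_val, map_inv₀, hx, inv_one,
        one_mul]
      exact hx1
    · right; simp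

theorem mem_near {p : ℕ} (hp : p ≠ 0) {v : HeightOneSpectrum (𝓞 K)} {x : Kˣ} :
    x ∈ near p v ↔ v.valuation K ((x : K) - 1) < v.valuation K p ^ p := by
  have h0 : (0 : ℤᵐ⁰) < v.valuation K p ^ p :=
    pow_pos (zero_lt_iff.2 ((Valuation.ne_zero_iff _).2 (Nat.cast_ne_zero.2 hp))) _
  constructor
  · rintro (⟨-, h⟩ | rfl)
    · exact h
    · simpa using h0
  · intro h
    left
    refine ⟨?_, h⟩
    have h1 : v.valuation K ((x : K) - 1) < 1 :=
      h.trans_le (pow_le_one₀ zero_le (HeightOneSpectrum.valuation_natCast_le_one v p))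
    have := (v.valuation K).map_one_add_of_lt h1
    simpa using this

theorem valuation_eq_one_of_mem_near {p : ℕ} {v : HeightOneSpectrum (𝓞 K)} {x : Kˣ}
    (h : x ∈ near p v) : v.valuation K x = 1 := by
  rcases h with ⟨h, -⟩ | rfl
  · exact h
  · simp

/-- The subgroup of `Kˣ` generated by the `p`-th powers and the elements close to `1` at `v`. -/
def locPow (p : ℕ) (v : HeightOneSpectrum (𝓞 K)) : Subgroup Kˣ :=
  near p v ⊔ (powMonoidHom p).range

theorem mem_locPow {p : ℕ} {v : HeightOneSpectrum (𝓞 K)} {x : Kˣ} :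
    x ∈ locPow p v ↔ ∃ z ∈ near p v, ∃ c : Kˣ, x = z * c ^ p := by
  rw [locPow, Subgroup.mem_sup]
  constructor
  · rintro ⟨z, hz, _, ⟨c, rfl⟩, rfl⟩
    exact ⟨z, hz, c, rfl⟩
  · rintro ⟨z, hz, c, rfl⟩
    exact ⟨z, hz, _, ⟨c, rfl⟩, rfl⟩

theorem pow_mem_locPow (p : ℕ) (v : HeightOneSpectrum (𝓞 K)) (x : Kˣ) : x ^ p ∈ locPow p v :=
  mem_locPow.2 ⟨1, one_mem _, x, by simp⟩

/-- In the residue field at a place not above `p`, some unit is not a `p`-th power. -/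
theorem exists_unit_not_pow_mod {p : ℕ} (hp : p.Prime) {ζ : K} (hζ : IsPrimitiveRoot ζ p)
    (v : HeightOneSpectrum (𝓞 K)) (hv : v.valuation K p = 1) :
    ∃ u : 𝓞 K, v.valuation K u = 1 ∧ ∀ y : 𝓞 K, u - y ^ p ∉ v.asIdeal := by
  have := v.isMaximal
  let _ : Field (𝓞 K ⧸ v.asIdeal) := Ideal.Quotient.field _
  have hfin : Finite (𝓞 K ⧸ v.asIdeal) := Ideal.finiteQuotientOfFreeOfNeBot _ v.ne_bot
  have hζi : IsIntegral ℤ ζ := hζ.isIntegral hp.pos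
  obtain ⟨z, hz⟩ : ∃ z : 𝓞 K, algebraMap (𝓞 K) K z = ζ := ⟨⟨ζ, hζi⟩, rfl⟩
  have hz1 : Ideal.Quotient.mk v.asIdeal z ^ p = 1 := by
    rw [← map_pow, show z ^ p = 1 from FaithfulSMul.algebraMap_injective (𝓞 K) K
      (by rw [map_pow, map_one, hz, hζ.pow_eq_one]), map_one]
  have hz2 : Ideal.Quotient.mk v.asIdeal z ≠ 1 := by
    rw [← map_one (Ideal.Quotient.mk v.asIdeal), Ne, Ideal.Quotient.mk_eq_mk_iff_sub_mem,
      ← v.valuation_lt_one_iff_mem (K := K), not_lt]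
    have := (v.valuation K).le_one_sub_zeta_pow hp hζ (j := 1) hp.not_dvd_one
    rw [hv, pow_one, Valuation.map_sub_swap] at this
    simpa [hz] using this
  have hns : ¬ Function.Surjective (fun x : 𝓞 K ⧸ v.asIdeal => x ^ p) := fun hs => by
    have := (Finite.injective_iff_surjective.2 hs) (a₁ := Ideal.Quotient.mk v.asIdeal z) (a₂ := 1)
      (by simpa using hz1)
    exact hz2 this
  simp only [Function.Surjective, not_forall, not_exists] at hns
  obtain ⟨u, hu⟩ := hns
  obtain ⟨u, rfl⟩ := Ideal.Quotient.mk_surjective u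
  refine ⟨u, ?_, fun y hy => hu (Ideal.Quotient.mk _ y) ?_⟩
  · rw [v.valuation_eq_one_iff_notMem]
    intro h
    refine hu 0 ?_
    simp only [zero_pow hp.ne_zero]
    exact (Ideal.Quotient.eq_zero_iff_mem.2 h).symm
  · simp only [← map_pow]
    exact (Ideal.Quotient.mk_eq_mk_iff_sub_mem _ _).2 hy |>.symm

theorem near_le_locPow (p : ℕ) (v : HeightOneSpectrum (𝓞 K)) : near p v ≤ locPow p v := le_sup_left

namespace KummerDatum

variable {L : Type*} [Field L] [NumberField L] [Algebra K L] {p : ℕ} {ζ a : K} {α : L}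
  {σ : L ≃ₐ[K] L} (D : KummerDatum p ζ a α σ)
include D

theorem valuation_norm {w : HeightOneSpectrum (𝓞 L)}
    (hw : (primeFiber L (w.under (𝓞 K))).ncard = 1) (y : L) :
    w.valuation L (algebraMap K L (Algebra.norm K y)) = w.valuation L y ^ p := by
  rw [D.algebraMap_norm, map_prod]
  simp only [valuation_gal_of_ncard_eq_one hw, Finset.prod_const, Finset.card_range]

/-- If `a` is a local `p`-th power at `v` then `v` splits completely. -/
theorem ncard_primeFiber_of_mem_locPow {v : HeightOneSpectrum (𝓞 K)} {a' : Kˣ} (ha : (a' : K) = a)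
    (h : a' ∈ locPow p v) : (primeFiber L v).ncard = p := by
  have hp := D.prime
  have := D.isGalois
  obtain ⟨w, rfl⟩ := under_surjective (L := L) v
  by_contra hne
  have hcard : (primeFiber L (w.under (𝓞 K))).ncard = 1 := by
    have := prime_degree_trichotomy hp D.finrank_eq w
    tauto
  obtain ⟨z, hz, c, hzc⟩ := mem_locPow.1 h
  have hzc' : a = z * (c : K) ^ p := by rw [← ha, hzc]; push_cast; rfl
  have hc0 : algebraMap K L c ≠ 0 := by simp
  set β : L := α / algebraMap K L c with hβ
  have hζL : IsPrimitiveRoot (algebraMap K L ζ) p :=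
    D.prim.map_of_injective (algebraMap K L).injective
  have hβp : β ^ p = algebraMap K L z := by
    rw [hβ, div_pow, D.pow_eq, hzc', map_mul, map_pow]; field_simp
  have hσβ : σ β = algebraMap K L ζ * β := by
    rw [hβ, map_div₀, AlgEquiv.commutes, D.gal, mul_div_assoc]
  rw [mem_near hp.ne_zero] at hz
  have hwz : w.valuation L (β ^ p - 1) < w.valuation L p ^ p := by
    rw [hβp, ← map_one (algebraMap K L), ← map_sub, valuation_algebraMap_eq_pow,
      ← map_natCast (algebraMap K L), valuation_algebraMap_eq_pow, ← pow_mul, mul_comm, pow_mul]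
    exact pow_lt_pow_left₀ hz zero_le (ramIdx_ne_zero w)
  obtain ⟨i, hi, hlt⟩ := (w.valuation L).exists_sub_zeta_pow_lt hp hζL hwz
  have h2 : w.valuation L (σ (β - algebraMap K L ζ ^ i)) < w.valuation L p := by
    rwa [valuation_gal_of_ncard_eq_one hcard]
  have h3 : σ (β - algebraMap K L ζ ^ i) - algebraMap K L ζ * (β - algebraMap K L ζ ^ i)
      = - (algebraMap K L ζ ^ i * (1 - algebraMap K L ζ ^ 1)) := by
    rw [map_sub, hσβ, map_pow, AlgEquiv.commutes]; ring
  have hνζ := (w.valuation L).zeta_eq_one hp.ne_zero hζL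
  have h4 := Valuation.map_sub_lt (w.valuation L) h2
    (show w.valuation L (algebraMap K L ζ * (β - algebraMap K L ζ ^ i)) < _ by
      rwa [map_mul, hνζ, one_mul])
  rw [h3, Valuation.map_neg, map_mul, (w.valuation L).zeta_pow_eq_one hp.ne_zero hζL, one_mul] at h4
  exact h4.not_ge ((w.valuation L).le_one_sub_zeta_pow hp hζL hp.not_dvd_one)

/-- Elements fixed by inertia: at a totally ramified or non-residual place, conjugation is trivial
modulo the place. -/
theorem valuation_gal_sub_lt {w : HeightOneSpectrum (𝓞 L)}
    (hw : (primeFiber L (w.under (𝓞 K))).ncard = 1)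
    (hN : Ideal.absNorm w.asIdeal = Ideal.absNorm (w.under (𝓞 K)).asIdeal)
    {x : L} (hx : w.valuation L x ≤ 1) :
    ∃ y : 𝓞 K, ∀ i, w.valuation L ((σ ^ i) x - algebraMap K L y) < 1 := by
  obtain ⟨x', hx'⟩ := w.exists_valuation_sub_lt_of_integer hx 1
  obtain ⟨y, hy⟩ := exists_sub_mem_of_absNorm_eq hN x'
  refine ⟨y, fun i => ?_⟩
  have h1 : w.valuation L (x - algebraMap K L y) < 1 := by
    have h2 := (w.valuation_lt_one_iff_mem (K := L) _).2 hy
    have h3 : x - algebraMap K L y = (algebraMap (𝓞 L) L (x' - algebraMap (𝓞 K) (𝓞 L) y)) -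
        (algebraMap (𝓞 L) L x' - x) := by
      rw [map_sub, ← IsScalarTower.algebraMap_apply (𝓞 K) (𝓞 L) L,
        IsScalarTower.algebraMap_apply (𝓞 K) K L]
      ring
    rw [h3]
    exact Valuation.map_sub_lt _ h2 hx'
  rw [← AlgEquiv.commutes (σ ^ i) (y : K), ← map_sub, valuation_gal_of_ncard_eq_one hw]
  exact h1

/-- Kummer extensions by units are unramified away from `p`. -/
theorem ramIdx_eq_one {w : HeightOneSpectrum (𝓞 L)} (hp1 : (w.under (𝓞 K)).valuation K p = 1)
    (ha1 : (w.under (𝓞 K)).valuation K a = 1) : ramIdx K w = 1 := by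
  have hp := D.prime
  have := D.isGalois
  obtain h | h | ⟨h1, h2, h3⟩ := prime_degree_trichotomy hp D.finrank_eq w
  · exact h.2.1
  · exact h.2.1
  exfalso
  have hα : w.valuation L α = 1 := by
    rw [← pow_eq_one_iff_left hp.ne_zero, ← map_pow, D.pow_eq, valuation_algebraMap_eq_one_iff]
    exact ha1
  obtain ⟨y, hy⟩ := D.valuation_gal_sub_lt h1 h3 hα.le
  have h4 := Valuation.map_sub_lt (w.valuation L) (hy 0) (hy 1)
  have h5 : (σ ^ 0) α - algebraMap K L y - ((σ ^ 1) α - algebraMap K L y) =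
      α * (algebraMap K L (1 - ζ ^ 1)) := by
    rw [pow_zero, AlgEquiv.one_apply, pow_one, D.gal, map_sub, map_one, pow_one]; ring
  rw [h5, map_mul, hα, one_mul, valuation_algebraMap_eq_pow] at h4
  have h6 := ((w.under (𝓞 K)).valuation K).le_one_sub_zeta_pow hp D.prim hp.not_dvd_one
  rw [hp1] at h6
  exact h4.not_ge (one_le_pow₀ h6)

/-- At a place away from `p` that does not split, not every element is a local norm up to
local `p`-th powers. -/
theorem locPow_sup_norm_ne_top {v : HeightOneSpectrum (𝓞 K)} (hv : v.valuation K p = 1)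
    (hne : (primeFiber L v).ncard ≠ p) :
    locPow p v ⊔ (Units.map (Algebra.norm K : L →* K)).range ≠ ⊤ := by
  have hp := D.prime
  have := D.isGalois
  have := D.finiteDimensional
  obtain ⟨w, rfl⟩ := under_surjective (L := L) v
  set v := w.under (𝓞 K) with hvdef
  intro htop
  have hmem : ∀ x : Kˣ, ∃ z ∈ near p v, ∃ (c : Kˣ) (y : Lˣ),
      (x : K) = z * (c : K) ^ p * Algebra.norm K (y : L) := by
    intro x
    have hx : x ∈ locPow p v ⊔ (Units.map (Algebra.norm K : L →* K)).range := by
      rw [htop]; trivial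
    obtain ⟨u, hu, _, ⟨y, rfl⟩, rfl⟩ := Subgroup.mem_sup.1 hx
    obtain ⟨z, hz, c, rfl⟩ := mem_locPow.1 hu
    exact ⟨z, hz, c, y, by simp⟩
  obtain ⟨h1, -⟩ | ⟨h1, h2, h3⟩ | ⟨h1, h2, h3⟩ := prime_degree_trichotomy hp D.finrank_eq w
  · exact hne h1
  · obtain ⟨π, hπ⟩ := v.valuation_exists_uniformizer K
    have hπ0 : π ≠ 0 := by
      rintro rfl
      rw [map_zero] at hπ
      exact exp_ne_zero hπ.symm
    obtain ⟨z, hz, c, y, hx⟩ := hmem (Units.mk0 π hπ0)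
    have h4 := D.valuation_norm h1 (y : L)
    rw [valuation_algebraMap_eq_pow, h2, pow_one] at h4
    have h5 := congrArg (v.valuation K) hx
    rw [Units.val_mk0, hπ, map_mul, map_mul, valuation_eq_one_of_mem_near hz, one_mul, h4, map_pow,
      ← mul_pow] at h5
    have h6 : v.valuation K c * w.valuation L y ≠ 0 := by
      rintro h
      rw [h, zero_pow hp.ne_zero] at h5
      simp at h5
    obtain ⟨m, hm⟩ : ∃ m : ℤ, v.valuation K c * w.valuation L y = exp m :=
      ⟨log _, (exp_log h6).symm⟩
    rw [hm, ← exp_nsmul, exp_inj, nsmul_eq_mul] at h5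
    have : (p : ℤ) ∣ 1 := ⟨-m, by linarith⟩
    exact hp.not_dvd_one (by exact_mod_cast this)
  · obtain ⟨u, hu1, hu⟩ := exists_unit_not_pow_mod hp D.prim v hv
    have hu0 : (u : K) ≠ 0 := fun h => by rw [h, map_zero] at hu1; exact zero_ne_one hu1
    obtain ⟨z, hz, c, y, hx⟩ := hmem (Units.mk0 _ hu0)
    rw [Units.val_mk0] at hx
    set y' : L := algebraMap K L c * y with hy'
    have hx' : (u : K) = z * Algebra.norm K y' := by
      rw [hx, hy', map_mul, Algebra.norm_algebraMap, D.finrank_eq, mul_assoc]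
    have h4 := D.valuation_norm h1 y'
    have h5 : v.valuation K (Algebra.norm K y') = 1 := by
      have := congrArg (v.valuation K) hx'
      rw [map_mul, valuation_eq_one_of_mem_near hz, one_mul, hu1] at this
      exact this.symm
    rw [valuation_algebraMap_eq_pow, h5, one_pow, eq_comm, pow_eq_one_iff_left hp.ne_zero] at h4
    obtain ⟨t, ht⟩ := D.valuation_gal_sub_lt h1 h3 h4.le
    refine hu t ?_
    have ht1 : w.valuation L (algebraMap K L (t : K)) ≤ 1 := by
      rw [valuation_algebraMap_eq_pow]
      exact pow_le_one₀ zero_le (HeightOneSpectrum.valuation_le_one _ t)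
    have h6 := (w.valuation L).prod_sub_pow_lt_one ht1 ht p
    rw [← D.algebraMap_norm, ← map_pow, ← map_sub, valuation_algebraMap_eq_pow,
      pow_lt_one_iff_of_nonneg zero_le (ramIdx_ne_zero w)] at h6
    have h7 := (mem_near hp.ne_zero).1 hz
    rw [hv, one_pow] at h7
    rw [← v.valuation_lt_one_iff_mem (K := K)]
    have h8 : ((u - t ^ p : 𝓞 K) : K) =
        (z - 1) * Algebra.norm K y' + (Algebra.norm K y' - (t : K) ^ p) := by
      have h9 : ((u - t ^ p : 𝓞 K) : K) = (u : K) - (t : K) ^ p := by simp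
      rw [h9, hx']; ring
    refine (congrArg (v.valuation K) h8).trans_lt (Valuation.map_add_lt _ ?_ h6)
    rwa [map_mul, h5, mul_one]

end KummerDatum

end LocalPowers

section IndexBounds

open NumberField IsDedekindDomain WithZero

/-- A subgroup whose cosets are separated by a map to a finite set has bounded index. -/
theorem Subgroup.relIndex_le_card_of_separating {G κ : Type*} [Group G] [Finite κ]
    (H J : Subgroup G) (f : G → κ) (hf : ∀ x ∈ J, ∀ y ∈ J, f x = f y → x⁻¹ * y ∈ H) :
    H.relIndex J ≠ 0 ∧ H.relIndex J ≤ Nat.card κ := by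
  let g : J ⧸ H.subgroupOf J → κ := fun q => f q.out
  have hg : Function.Injective g := by
    intro q r hqr
    have := hf _ q.out.2 _ r.out.2 hqr
    rw [← QuotientGroup.out_eq' q, ← QuotientGroup.out_eq' r, QuotientGroup.eq]
    exact this
  have := Finite.of_injective g hg
  exact ⟨Nat.card_pos.ne', Nat.card_le_card_of_injective g hg⟩

theorem Subgroup.index_le_card_of_separating {G κ : Type*} [Group G] [Finite κ]
    (H : Subgroup G) (f : G → κ) (hf : ∀ x y, f x = f y → x⁻¹ * y ∈ H) :
    H.index ≠ 0 ∧ H.index ≤ Nat.card κ := by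
  have := H.relIndex_le_card_of_separating ⊤ f fun x _ y _ => hf x y
  rwa [Subgroup.relIndex_top_right] at this

variable {K : Type*} [Field K] [NumberField K]

/-- The units at `v` that are congruent to `1` modulo `v ^ n`. -/
def unitBall (v : HeightOneSpectrum (𝓞 K)) (n : ℕ) : Subgroup Kˣ where
  carrier := {x | v.valuation K x = 1 ∧ v.valuation K ((x : K) - 1) ≤ exp (-(n : ℤ))}
  one_mem' := by simp
  mul_mem' := by
    rintro x y ⟨hx, hx1⟩ ⟨hy, hy1⟩
    refine ⟨by simp [hx, hy], ?_⟩
    have : ((x * y : Kˣ) : K) - 1 = x * (y - 1) + (x - 1) := by push_cast; ring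
    rw [this]
    exact Valuation.map_add_le _ (by rwa [map_mul, hx, one_mul]) hx1
  inv_mem' := by
    rintro x ⟨hx, hx1⟩
    refine ⟨by simp [hx], ?_⟩
    have : ((x⁻¹ : Kˣ) : K) - 1 = -(x⁻¹ * (x - 1)) := by
      have := x.ne_zero
      push_cast; field_simp; ring
    rw [this, Valuation.map_neg, map_mul, Units.val_inv_eq_inv_val, map_inv₀, hx, inv_one, one_mul]
    exact hx1

variable (v : HeightOneSpectrum (𝓞 K))

theorem mem_unitBall_zero {x : Kˣ} : x ∈ unitBall v 0 ↔ v.valuation K x = 1 := by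
  refine ⟨And.left, fun h => ⟨h, ?_⟩⟩
  have := (v.valuation K).map_sub (x : K) 1
  rw [h, map_one, max_self] at this
  simpa using this

theorem unitBall_anti {m n : ℕ} (h : m ≤ n) : unitBall v n ≤ unitBall v m := fun _ hx =>
  ⟨hx.1, hx.2.trans (by rw [exp_le_exp]; omega)⟩

theorem unitBall_relIndex_succ (n : ℕ) :
    (unitBall v (n + 1)).relIndex (unitBall v n) ≠ 0 ∧
    (unitBall v (n + 1)).relIndex (unitBall v n) ≤ Ideal.absNorm v.asIdeal := by
  have hfin : Finite (𝓞 K ⧸ v.asIdeal) := Ideal.finiteQuotientOfFreeOfNeBot _ v.ne_bot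
  obtain ⟨π, hπ⟩ := v.valuation_exists_uniformizer K
  have hπn : v.valuation K (π ^ n) = exp (-(n : ℤ)) := by
    rw [map_pow, hπ, ← exp_nsmul]; simp
  have hπ0 : π ^ n ≠ 0 := by
    rw [← (v.valuation K).ne_zero_iff, hπn]; exact exp_ne_zero
  have hex : ∀ x : Kˣ, ∃ s : 𝓞 K, x ∈ unitBall v n →
      v.valuation K ((s : K) - ((x : K) - 1) / π ^ n) < 1 := by
    intro x
    by_cases hx : x ∈ unitBall v n
    · obtain ⟨s, hs⟩ := v.exists_valuation_sub_lt_of_integer (K := K)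
        (x := ((x : K) - 1) / π ^ n) (by
          rw [map_div₀, hπn, div_le_one₀ (by simp)]
          exact hx.2) 1
      exact ⟨s, fun _ => hs⟩
    · exact ⟨0, fun h => absurd h hx⟩
  choose s hs using hex
  rw [show Ideal.absNorm v.asIdeal = Nat.card (𝓞 K ⧸ v.asIdeal) from rfl]
  refine Subgroup.relIndex_le_card_of_separating _ _
    (fun x => Ideal.Quotient.mk v.asIdeal (s x)) fun x hx y hy hxy => ?_
  rw [Ideal.Quotient.mk_eq_mk_iff_sub_mem, ← v.valuation_lt_one_iff_mem (K := K)] at hxy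
  refine ⟨((unitBall v n).mul_mem ((unitBall v n).inv_mem hx) hy).1, ?_⟩
  have h1 : v.valuation K (((y : K) - x) / π ^ n) < 1 := by
    have : ((y : K) - x) / π ^ n = (((s x : K) - ((x : K) - 1) / π ^ n) -
        ((s y : K) - ((y : K) - 1) / π ^ n)) - ((s x : K) - (s y : K)) := by
      field_simp; ring
    rw [this]
    refine Valuation.map_sub_lt _ (Valuation.map_sub_lt _ (hs x hx) (hs y hy)) ?_
    simpa using hxy
  have h2 : ((x⁻¹ * y : Kˣ) : K) - 1 = (x : K)⁻¹ * ((((y : K) - x) / π ^ n) * π ^ n) := by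
    have := x.ne_zero
    push_cast; field_simp
  rw [h2, map_mul, map_inv₀, hx.1, inv_one, one_mul, map_mul, hπn]
  have h3 : v.valuation K (((y : K) - x) / π ^ n) ≤ exp (-1 : ℤ) := by
    rw [← lt_mul_exp_iff_le exp_ne_zero, ← exp_add]
    simpa using h1
  calc _ ≤ exp (-1 : ℤ) * exp (-(n : ℤ)) := mul_le_mul_left h3 _
    _ = _ := by rw [← exp_add]; congr 1; push_cast; ring

theorem unitBall_relIndex_add (n m : ℕ) :
    (unitBall v (n + m)).relIndex (unitBall v n) ≠ 0 ∧
    (unitBall v (n + m)).relIndex (unitBall v n) ≤ Ideal.absNorm v.asIdeal ^ m := by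
  induction m with
  | zero => simp
  | succ m ih =>
    have h1 := unitBall_relIndex_succ v (n + m)
    rw [← add_assoc, ← Subgroup.relIndex_mul_relIndex (unitBall v (n + m + 1)) (unitBall v (n + m))
      (unitBall v n) (unitBall_anti v (by omega)) (unitBall_anti v (by omega))]
    exact ⟨mul_ne_zero h1.1 ih.1, (Nat.mul_le_mul h1.2 ih.2).trans_eq (by ring)⟩

theorem near_eq_unitBall {p : ℕ} (hp : p ≠ 0) {e : ℕ} (he : v.valuation K p = exp (-(e : ℤ))) :
    near p v = unitBall v (p * e + 1) := by
  ext x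
  have h1 : v.valuation K p ^ p = exp (-((p * e + 1 : ℕ) : ℤ)) * exp 1 := by
    rw [he, ← exp_nsmul, ← exp_add]; congr 1; simp
  rw [mem_near hp, h1, lt_mul_exp_iff_le exp_ne_zero]
  refine ⟨fun h => ⟨?_, h⟩, And.right⟩
  have : v.valuation K ((x : K) - 1) < v.valuation K p ^ p := by
    rwa [h1, lt_mul_exp_iff_le exp_ne_zero]
  exact valuation_eq_one_of_mem_near ((mem_near hp).2 this)

theorem unitBall_relIndex_pow_le {p : ℕ} (hp : p.Prime) {ζ : K} (hζ : IsPrimitiveRoot ζ p) {e : ℕ}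
    (he : v.valuation K p = exp (-(e : ℤ))) :
    (unitBall v (p * e + 1)).relIndex
      ((unitBall v (p * e + 1)).comap (powMonoidHom p) ⊓ unitBall v 0) ≤
      p * Ideal.absNorm v.asIdeal ^ e := by
  set B := unitBall v (p * e + 1) with hB
  set C := B.comap (powMonoidHom p) ⊓ unitBall v 0 with hC
  set B' := unitBall v ((p - 1) * e + 1) with hB'
  have hBB' : B ≤ B' := unitBall_anti v (by
    have : (p - 1) * e ≤ p * e := Nat.mul_le_mul_right _ (by omega)
    omega)
  have hBC : B ≤ C := fun x hx => ⟨B.pow_mem hx p, unitBall_anti v (by omega) hx⟩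
  have hex : ∀ x : Kˣ, ∃ i : Fin p, x ∈ C → v.valuation K ((x : K) - ζ ^ (i : ℕ)) <
      exp (-(((p - 1) * e : ℕ) : ℤ)) := by
    intro x
    by_cases hx : x ∈ C
    · have h1 : x ^ p ∈ near p v := by rw [near_eq_unitBall v hp.ne_zero he]; exact hx.1
      rw [mem_near hp.ne_zero] at h1
      obtain ⟨i, hi, hlt⟩ := (v.valuation K).exists_sub_zeta_pow_mul_lt hp hζ (x := x)
        (by simpa using h1)
      refine ⟨⟨i, hi⟩, fun _ => ?_⟩
      have h2 : v.valuation K p ^ p = exp (-(((p - 1) * e : ℕ) : ℤ)) * v.valuation K p := by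
        rw [he, ← exp_nsmul, ← exp_add]
        congr 1
        have := hp.one_lt.le
        push_cast [this]; simp; ring
      rw [h2] at hlt
      exact lt_of_mul_lt_mul_right hlt zero_le
    · exact ⟨⟨0, hp.pos⟩, fun h => absurd h hx⟩
  choose f hf using hex
  have h1 := (B' ⊓ C).relIndex_le_card_of_separating C f fun x hx y hy hxy => by
    refine ⟨⟨((unitBall v 0).mul_mem ((unitBall v 0).inv_mem hx.2) hy.2).1, ?_⟩,
      C.mul_mem (C.inv_mem hx) hy⟩
    have h2 : ((x⁻¹ * y : Kˣ) : K) - 1 =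
        (x : K)⁻¹ * (((y : K) - ζ ^ (f y : ℕ)) - ((x : K) - ζ ^ (f x : ℕ))) := by
      have := x.ne_zero
      rw [hxy]; push_cast; field_simp; ring
    have h3 := Valuation.map_sub_lt (v.valuation K) (hf y hy) (hf x hx)
    rw [h2, map_mul, map_inv₀, hx.2.1, inv_one, one_mul]
    rw [← lt_mul_exp_iff_le exp_ne_zero, ← exp_add]
    convert h3 using 2
    push_cast; ring
  have h2 := unitBall_relIndex_add v ((p - 1) * e + 1) e
  have h3 : (p - 1) * e + 1 + e = p * e + 1 := by
    obtain ⟨k, rfl⟩ : ∃ k, p = k + 1 := ⟨p - 1, by have := hp.pos; omega⟩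
    simp; ring
  rw [h3, ← hB, ← hB'] at h2
  rw [← Subgroup.relIndex_mul_relIndex B (B' ⊓ C) C (le_inf hBB' hBC) inf_le_right, mul_comm]
  refine Nat.mul_le_mul (h1.2.trans_eq (by simp)) ?_
  exact (Subgroup.relIndex_le_of_le_right inf_le_left h2.1).trans h2.2

/-- The local power subgroup has finite index, with the expected bound. -/
theorem locPow_relIndex_unitBall {p : ℕ} (hp : p.Prime) {ζ : K} (hζ : IsPrimitiveRoot ζ p) {e : ℕ}
    (he : v.valuation K p = exp (-(e : ℤ))) :
    (locPow p v).relIndex (unitBall v 0) ≠ 0 ∧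
      (locPow p v).relIndex (unitBall v 0) ≤ p * Ideal.absNorm v.asIdeal ^ e := by
  set B := unitBall v (p * e + 1) with hB
  set B0 := unitBall v 0 with hB0
  set P := locPow p v with hP
  have hBB0 : B ≤ B0 := unitBall_anti v (by omega)
  have hB1 := (unitBall_relIndex_add v 0 (p * e + 1)).1
  rw [zero_add, ← hB, ← hB0] at hB1
  set C := B.comap (powMonoidHom p) ⊓ B0 with hC
  set Q := B ⊔ B0.map (powMonoidHom p) with hQ
  have hBC : B ≤ C := fun x hx => ⟨B.pow_mem hx p, hBB0 hx⟩
  have hQB0 : Q ≤ B0 := sup_le hBB0 (by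
    rintro _ ⟨x, hx, rfl⟩
    exact B0.pow_mem hx p)
  have e1 := Subgroup.relIndex_mul_relIndex B Q B0 le_sup_left hQB0
  rw [hQ, Subgroup.relIndex_sup_left, ← Subgroup.relIndex_comap, ← hQ] at e1
  have e2 := Subgroup.relIndex_mul_relIndex B C B0 hBC inf_le_right
  rw [hC, Subgroup.inf_relIndex_right, ← hC] at e2
  have hCne : (B.comap (powMonoidHom p)).relIndex B0 ≠ 0 := by
    rintro h
    rw [h, zero_mul] at e1
    exact hB1 e1.symm
  have e3 : Q.relIndex B0 = B.relIndex C :=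
    Nat.eq_of_mul_eq_mul_left (Nat.pos_of_ne_zero hCne) (by rw [e1, ← e2, mul_comm])
  have hQne : Q.relIndex B0 ≠ 0 := by
    rintro h
    rw [h, mul_zero] at e1
    exact hB1 e1.symm
  have hQP : Q ≤ P := by
    rw [hQ, hB, ← near_eq_unitBall v hp.ne_zero he]
    refine sup_le (near_le_locPow p v) ?_
    rintro _ ⟨x, -, rfl⟩
    exact pow_mem_locPow p v x
  have e4 : P.relIndex B0 ≤ p * Ideal.absNorm v.asIdeal ^ e :=
    (Subgroup.relIndex_le_of_le_left hQP hQne).trans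
      (e3.trans_le (unitBall_relIndex_pow_le v hp hζ he))
  have e5 : P.relIndex B0 ≠ 0 := fun h =>
    hQne (Nat.eq_zero_of_zero_dvd (h ▸ Subgroup.relIndex_dvd_of_le_left B0 hQP))
  exact ⟨e5, e4⟩

theorem locPow_index {p : ℕ} (hp : p.Prime) {ζ : K} (hζ : IsPrimitiveRoot ζ p) {e : ℕ}
    (he : v.valuation K p = exp (-(e : ℤ))) :
    (locPow p v).index ≠ 0 ∧ (locPow p v).index ≤ p ^ 2 * Ideal.absNorm v.asIdeal ^ e := by
  obtain ⟨e5, e4⟩ := locPow_relIndex_unitBall v hp hζ he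
  set B0 := unitBall v 0 with hB0
  set P := locPow p v with hP
  obtain ⟨π, hπ⟩ := v.valuation_exists_uniformizer K
  have hπ0 : π ≠ 0 := by rw [← (v.valuation K).ne_zero_iff, hπ]; exact exp_ne_zero
  have : NeZero p := ⟨hp.ne_zero⟩
  have e6 := (P ⊔ B0).index_le_card_of_separating
    (fun x : Kˣ => ((log (v.valuation K x) : ℤ) : ZMod p)) fun x y hxy => by
      rw [ZMod.intCast_eq_intCast_iff_dvd_sub] at hxy
      obtain ⟨m, hm⟩ := hxy
      have hx : v.valuation K x ≠ 0 := by simp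
      have hy : v.valuation K y ≠ 0 := by simp
      rw [Subgroup.mem_sup]
      set c : Kˣ := (Units.mk0 π hπ0) ^ (-m) with hc
      refine ⟨c ^ p, pow_mem_locPow p v c, (c ^ p)⁻¹ * (x⁻¹ * y), ?_, by group⟩
      rw [hB0, mem_unitBall_zero]
      have h1 : v.valuation K (((c ^ p)⁻¹ * (x⁻¹ * y) : Kˣ) : K) =
          exp (-(p * m) + (log (v.valuation K y) - log (v.valuation K x))) := by
        rw [exp_add, exp_sub, exp_log hy, exp_log hx]
        simp only [hc, Units.val_mul, Units.val_inv_eq_inv_val, Units.val_pow_eq_pow_val,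
          Units.val_zpow_eq_zpow_val, Units.val_mk0, map_mul, map_inv₀, map_pow, map_zpow₀, hπ]
        rw [← exp_zsmul, ← exp_nsmul, ← exp_neg]
        congr 1
        · congr 1; simp
        · rw [div_eq_mul_inv, mul_comm]
      rw [h1, hm]
      simp
  rw [Nat.card_zmod] at e6
  rw [← Subgroup.relIndex_mul_index (le_sup_left : P ≤ P ⊔ B0), Subgroup.relIndex_sup_left]
  exact ⟨mul_ne_zero e5 e6.1, (Nat.mul_le_mul e4 e6.2).trans_eq (by ring)⟩

variable (K) in
/-- The elements of `Kˣ` that are positive at all real embeddings. -/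
def totPos : Subgroup Kˣ where
  carrier := {x | ∀ τ : K →+* ℝ, 0 < τ x}
  one_mem' τ := by simp
  mul_mem' hx hy τ := by simpa using mul_pos (hx τ) (hy τ)
  inv_mem' hx τ := by simpa using hx τ

theorem pow_mem_totPos {p : ℕ} (hp : p.Prime) {ζ : K} (hζ : IsPrimitiveRoot ζ p) (x : Kˣ) :
    x ^ p ∈ totPos K := by
  intro τ
  have hτ : IsPrimitiveRoot (τ ζ) p := hζ.map_of_injective τ.injective
  rcases hp.eq_two_or_odd' with rfl | hodd
  · have : τ x ≠ 0 := by simp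
    rw [Units.val_pow_eq_pow_val, map_pow]
    positivity
  · exact absurd (hodd.strictMono_pow.injective (by simp [hτ.pow_eq_one] : τ ζ ^ p = 1 ^ p))
      (hτ.ne_one hp.one_lt)

theorem card_realEmbeddings_le : Nat.card (K →+* ℝ) ≤ InfinitePlace.nrRealPlaces K := by
  classical
  have hconj : ∀ τ : K →+* ℝ, ComplexEmbedding.conjugate (Complex.ofRealHom.comp τ) =
      Complex.ofRealHom.comp τ := fun τ => by
    ext x
    simp [ComplexEmbedding.conjugate_coe_eq]
  let f : (K →+* ℝ) → {w : InfinitePlace K // w.IsReal} := fun τ =>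
    ⟨InfinitePlace.mk (Complex.ofRealHom.comp τ), by
      rw [InfinitePlace.isReal_mk_iff, ComplexEmbedding.isReal_iff]
      exact hconj τ⟩
  have hf : Function.Injective f := by
    intro τ τ' h
    have h1 := InfinitePlace.mk_eq_iff.1 (congrArg Subtype.val h)
    rw [hconj, or_self] at h1
    ext x
    exact Complex.ofReal_injective (congrArg (fun φ : K →+* ℂ => φ x) h1)
  rw [InfinitePlace.nrRealPlaces, ← Nat.card_eq_fintype_card]
  exact Nat.card_le_card_of_injective f hf

theorem totPos_index {p : ℕ} (hp : p.Prime) {ζ : K} (hζ : IsPrimitiveRoot ζ p) :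
    (totPos K).index ≠ 0 ∧ (totPos K).index ≤ p ^ InfinitePlace.nrRealPlaces K := by
  classical
  have hfin : Finite (K →+* ℝ) := inferInstance
  rcases hp.eq_two_or_odd' with rfl | hodd
  · have h := (totPos K).index_le_card_of_separating
      (fun (x : Kˣ) (τ : K →+* ℝ) => decide (0 < τ x)) fun x y hxy τ => by
        have h1 := congrFun hxy τ
        rw [decide_eq_decide] at h1
        have hx : τ x ≠ 0 := by simp
        have hy : τ y ≠ 0 := by simp
        rw [Units.val_mul, map_mul, Units.val_inv_eq_inv_val, map_inv₀]
        rcases lt_or_gt_of_ne hx with h2 | h2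
        · have h3 : τ y < 0 := lt_of_le_of_ne (not_lt.1 fun h => h2.not_gt (h1.2 h)) hy
          exact mul_pos_of_neg_of_neg (inv_lt_zero.2 h2) h3
        · exact mul_pos (inv_pos.2 h2) (h1.1 h2)
    refine ⟨h.1, h.2.trans ?_⟩
    rw [Nat.card_fun]
    simpa using Nat.pow_le_pow_right two_pos (card_realEmbeddings_le (K := K))
  · have h1 : totPos K = ⊤ := by
      rw [eq_top_iff]
      intro x _ τ
      have hτ : IsPrimitiveRoot (τ ζ) p := hζ.map_of_injective τ.injective
      exact absurd (hodd.strictMono_pow.injective (by simp [hτ.pow_eq_one] : τ ζ ^ p = 1 ^ p))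
        (hτ.ne_one hp.one_lt)
    rw [h1, Subgroup.index_top]
    exact ⟨one_ne_zero, Nat.one_le_pow _ _ hp.pos⟩

/-- The intersection of the local power subgroups at the places in `S`. -/
def locPows (p : ℕ) (S : Finset (HeightOneSpectrum (𝓞 K))) : Subgroup Kˣ := ⨅ v ∈ S, locPow p v

theorem mem_locPows {p : ℕ} {S : Finset (HeightOneSpectrum (𝓞 K))} {x : Kˣ} :
    x ∈ locPows p S ↔ ∀ v ∈ S, x ∈ locPow p v := by
  simp [locPows, Subgroup.mem_iInf]

theorem locPows_insert [DecidableEq (HeightOneSpectrum (𝓞 K))] (p : ℕ)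
    (v : HeightOneSpectrum (𝓞 K)) (S : Finset (HeightOneSpectrum (𝓞 K))) :
    locPows p (insert v S) = locPow p v ⊓ locPows p S := by
  ext x
  simp [mem_locPows, Subgroup.mem_inf]

theorem prod_absNorm_pow_le {p : ℕ} (hp : p.Prime) (S : Finset (HeightOneSpectrum (𝓞 K)))
    (e : HeightOneSpectrum (𝓞 K) → ℕ) (he : ∀ v, v.valuation K p = exp (-(e v : ℤ))) :
    ∏ v ∈ S, Ideal.absNorm v.asIdeal ^ e v ≤ p ^ Module.finrank ℚ K := by
  have h0 : (Ideal.span {(p : 𝓞 K)}) ≠ ⊥ := by simpa using hp.ne_zero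
  have h1 : ∏ v ∈ S, v.asIdeal ^ e v ∣ Ideal.span {(p : 𝓞 K)} := by
    refine Finset.prod_dvd_of_coprime ?_ ?_
    · intro v _ w _ hvw
      exact (Ideal.isCoprime_of_isMaximal fun h => hvw (asIdeal_injective h)).pow
    · intro v _
      rw [Ideal.dvd_span_singleton, ← v.intValuation_le_pow_iff_mem,
        ← v.valuation_of_algebraMap (K := K)]
      simpa using (he v).le
  have h2 := Nat.le_of_dvd (Nat.pos_of_ne_zero ?_) (map_dvd Ideal.absNorm h1)
  · rw [map_prod, Ideal.absNorm_span_singleton] at h2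
    simp only [map_pow] at h2
    refine h2.trans_eq ?_
    rw [← map_natCast (algebraMap ℤ (𝓞 K)), Algebra.norm_algebraMap, Int.natAbs_pow,
      RingOfIntegers.rank]
    simp
  · rwa [Ne, Ideal.absNorm_eq_zero_iff]

theorem locPows_index {p : ℕ} (hp : p.Prime) {ζ : K} (hζ : IsPrimitiveRoot ζ p)
    (S : Finset (HeightOneSpectrum (𝓞 K)))
    (e : HeightOneSpectrum (𝓞 K) → ℕ) (he : ∀ v, v.valuation K p = exp (-(e v : ℤ))) :
    (locPows p S).index ≠ 0 ∧
      (locPows p S).index ≤ p ^ (2 * S.card) * ∏ v ∈ S, Ideal.absNorm v.asIdeal ^ e v := by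
  classical
  induction S using Finset.induction_on with
  | empty => simp [locPows]
  | insert v S hv ih =>
    have h := locPow_index v hp hζ (he v)
    rw [locPows_insert, Finset.card_insert_of_notMem hv, Finset.prod_insert hv]
    refine ⟨Subgroup.index_inf_ne_zero h.1 ih.1, (Subgroup.index_inf_le).trans
      ((Nat.mul_le_mul h.2 ih.2).trans_eq (by ring))⟩

theorem totPos_inf_locPows_index {p : ℕ} (hp : p.Prime) {ζ : K} (hζ : IsPrimitiveRoot ζ p)
    (S : Finset (HeightOneSpectrum (𝓞 K))) :
    (totPos K ⊓ locPows p S).index ≠ 0 ∧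
      (totPos K ⊓ locPows p S).index ≤ p ^ (2 * (S.card + Fintype.card (InfinitePlace K))) := by
  have hex : ∀ v : HeightOneSpectrum (𝓞 K), ∃ e : ℕ, v.valuation K p = exp (-(e : ℤ)) := by
    intro v
    have h0 : v.valuation K p ≠ 0 := by simpa using hp.ne_zero
    have h1 := HeightOneSpectrum.valuation_natCast_le_one v p
    rw [← exp_log h0, ← exp_zero, exp_le_exp] at h1
    exact ⟨(-log (v.valuation K p)).toNat, by
      rw [Int.toNat_of_nonneg (by omega), neg_neg, exp_log h0]⟩
  choose e he using hex
  have h1 := locPows_index hp hζ S e he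
  have h2 := prod_absNorm_pow_le hp S e he
  have hcard := InfinitePlace.card_eq_nrRealPlaces_add_nrComplexPlaces K
  have hrank := InfinitePlace.card_add_two_mul_card_eq_rank K
  have h3 := totPos_index hp hζ
  refine ⟨Subgroup.index_inf_ne_zero h3.1 h1.1, Subgroup.index_inf_le.trans ?_⟩
  calc _ ≤ p ^ InfinitePlace.nrRealPlaces K * (p ^ (2 * S.card) * p ^ Module.finrank ℚ K) :=
        Nat.mul_le_mul h3.2 (h1.2.trans (Nat.mul_le_mul_left _ h2))
    _ = _ := by
        rw [← pow_add, ← pow_add, ← hrank, hcard]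
        congr 1
        ring

end IndexBounds

section Approximation

open NumberField IsDedekindDomain WithZero

variable {K : Type*} [Field K] [NumberField K]

/-- Approximation at finitely many finite places. -/
theorem exists_forall_valuation_sub_le (S : Finset (HeightOneSpectrum (𝓞 K)))
    (x : HeightOneSpectrum (𝓞 K) → K) (n : ℕ) :
    ∃ y : K, ∀ v ∈ S, v.valuation K (y - x v) ≤ exp (-(n : ℤ)) := by
  obtain ⟨⟨d, hd⟩, h_int⟩ := IsLocalization.exist_integer_multiples (nonZeroDivisors (𝓞 K)) S x
  choose! s hs using h_int
  have hd0 : (d : 𝓞 K) ≠ 0 := nonZeroDivisors.ne_zero hd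
  have hdK : algebraMap (𝓞 K) K d ≠ 0 := by simpa using hd0
  have hex : ∀ v : HeightOneSpectrum (𝓞 K), ∃ m : ℕ, v.valuation K (algebraMap (𝓞 K) K d) =
      exp (-(m : ℤ)) := by
    intro v
    have h0 : v.valuation K (algebraMap (𝓞 K) K d) ≠ 0 := by simpa using hd0
    have h1 := v.valuation_le_one (K := K) d
    rw [← exp_log h0, ← exp_zero, exp_le_exp] at h1
    exact ⟨(-log (v.valuation K (algebraMap (𝓞 K) K d))).toNat, by
      rw [Int.toNat_of_nonneg (by omega), neg_neg, exp_log h0]⟩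
  choose m hm using hex
  obtain ⟨y, hy⟩ := IsDedekindDomain.exists_forall_sub_mem_ideal (s := S)
    (fun v => v.asIdeal) (fun v => n + m v) (fun v _ => v.prime)
    (fun v _ w _ hvw h => hvw (asIdeal_injective h)) (fun v => s v)
  refine ⟨algebraMap (𝓞 K) K y / algebraMap (𝓞 K) K d, fun v hv => ?_⟩
  have h1 := (v.intValuation_le_pow_iff_mem _ _).2 (hy v hv)
  rw [← v.valuation_of_algebraMap (K := K)] at h1
  have h3 : (((y - s v : 𝓞 K)) : K) = algebraMap (𝓞 K) K y - d • x v := by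
    rw [show d • x v = algebraMap (𝓞 K) K (s v) from (hs v hv).symm, ← map_sub]
  replace h1 := (congrArg (v.valuation K) h3).symm.trans_le h1
  have h2 : algebraMap (𝓞 K) K y / algebraMap (𝓞 K) K d - x v =
      (algebraMap (𝓞 K) K y - d • x v) / algebraMap (𝓞 K) K d := by
    rw [Algebra.smul_def]; field_simp
  rw [h2, map_div₀, hm, div_le_iff₀ (by simp), ← exp_add]
  refine h1.trans_eq ?_
  congr 1; push_cast; ring

/-- Multiplicative approximation at finitely many finite places. -/
theorem exists_forall_inv_mul_mem_near {p : ℕ} (hp : p ≠ 0) (S : Finset (HeightOneSpectrum (𝓞 K)))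
    (x : HeightOneSpectrum (𝓞 K) → Kˣ) :
    ∃ y : Kˣ, ∀ v ∈ S, (x v)⁻¹ * y ∈ near p v := by
  have hex : ∀ v : HeightOneSpectrum (𝓞 K), ∃ n : ℕ,
      exp (-(n : ℤ)) < v.valuation K (x v) * v.valuation K p ^ p := by
    intro v
    have h0 : v.valuation K (x v) * v.valuation K p ^ p ≠ 0 := by simp [hp]
    refine ⟨(1 - log (v.valuation K (x v) * v.valuation K p ^ p)).toNat, ?_⟩
    conv_rhs => rw [← exp_log h0]
    rw [exp_lt_exp]
    have := Int.self_le_toNat (1 - log (v.valuation K (x v) * v.valuation K p ^ p))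
    omega
  choose n hn using hex
  obtain ⟨y, hy⟩ := exists_forall_valuation_sub_le S (fun v => (x v : K)) (S.sup n)
  have hlt : ∀ v ∈ S, v.valuation K (y - x v) < v.valuation K (x v) * v.valuation K p ^ p :=
    fun v hv => (hy v hv).trans_lt (lt_of_le_of_lt (by
      rw [exp_le_exp]; have := Finset.le_sup (f := n) hv; omega) (hn v))
  have key : ∀ v ∈ S, v.valuation K ((x v : K)⁻¹ * y - 1) < v.valuation K p ^ p := by
    intro v hv
    have h1 : (x v : K)⁻¹ * y - 1 = (x v : K)⁻¹ * (y - x v) := by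
      have := (x v).ne_zero
      field_simp
    rw [h1, map_mul, map_inv₀, inv_mul_lt_iff₀ (by simp [zero_lt_iff])]
    exact hlt v hv
  rcases S.eq_empty_or_nonempty with rfl | ⟨v0, hv0⟩
  · exact ⟨1, by simp⟩
  have hy0 : y ≠ 0 := by
    rintro rfl
    have := key v0 hv0
    rw [mul_zero, zero_sub, Valuation.map_neg, map_one] at this
    exact this.not_ge (pow_le_one₀ zero_le (HeightOneSpectrum.valuation_natCast_le_one v0 p))
  refine ⟨Units.mk0 y hy0, fun v hv => ?_⟩
  rw [mem_near hp]
  simpa using key v hv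

/-- The index of an intersection of "independent" subgroups. -/
theorem Subgroup.card_pow_le_relIndex_iInf {G ι : Type*} [CommGroup G] (J : Finset ι)
    (U : Subgroup G) (N : ι → Subgroup G) (p : ℕ) (hN : ∀ i ∈ J, N i ≠ ⊤)
    (hpow : ∀ i ∈ J, ∀ x : G, x ^ p ∈ N i) (hp : p.Prime) (hfin : ∀ i ∈ J, (N i).index ≠ 0)
    (hsurj : ∀ x : ι → G, ∃ y ∈ U, ∀ i ∈ J, (x i)⁻¹ * y ∈ N i) :
    p ^ J.card ≤ (⨅ i ∈ J, N i).relIndex U := by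
  classical
  let f : U →* ((i : J) → G ⧸ N i) := MonoidHom.pi fun i => (QuotientGroup.mk' (N i)).comp U.subtype
  have hf : Function.Surjective f := by
    intro q
    obtain ⟨y, hyU, hy⟩ := hsurj fun i => if h : i ∈ J then (q ⟨i, h⟩).out else 1
    refine ⟨⟨y, hyU⟩, funext fun i => ?_⟩
    have := hy i i.2
    simp only [i.2, dif_pos] at this
    rw [← QuotientGroup.out_eq' (q i)]
    exact (QuotientGroup.eq.2 this).symm
  have hker : f.ker = (⨅ i ∈ J, N i).subgroupOf U := by
    ext y
    simp only [MonoidHom.mem_ker, funext_iff, Subgroup.mem_subgroupOf, Subgroup.mem_iInf]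
    exact ⟨fun h i hi => (QuotientGroup.eq_one_iff _).1 (h ⟨i, hi⟩),
      fun h i => (QuotientGroup.eq_one_iff _).2 (h i i.2)⟩
  rw [Subgroup.relIndex, ← hker, Subgroup.index_ker, MonoidHom.range_eq_top.2 hf,
    Nat.card_congr Subgroup.topEquiv.toEquiv, Nat.card_pi]
  have h1 : ∀ i : J, p ≤ Nat.card (G ⧸ N i) := by
    intro i
    have : Finite (G ⧸ N i) := Nat.finite_of_card_ne_zero (hfin i i.2)
    have hnt : Nontrivial (G ⧸ N i) := QuotientGroup.nontrivial_iff.2 (hN i i.2)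
    obtain ⟨q, hq⟩ := exists_ne (1 : G ⧸ N i)
    have hqp : q ^ p = 1 := by
      obtain ⟨x, rfl⟩ := QuotientGroup.mk_surjective q
      rw [← QuotientGroup.mk_pow, QuotientGroup.eq_one_iff]
      exact hpow i i.2 x
    have := Fact.mk hp
    rw [← orderOf_eq_prime hqp hq]
    exact Nat.le_of_dvd Nat.card_pos (_root_.orderOf_dvd_natCard q)
  calc p ^ J.card = ∏ _i : J, p := by simp
    _ ≤ _ := Finset.prod_le_prod' fun i _ => h1 i

end Approximation

section HerbrandQuotient

open NumberField IsDedekindDomain WithZero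

variable {K : Type*} [Field K] [NumberField K]

/-- Every prime outside `S` is principal up to primes in `S`. -/
def GeneratesClassGroup (S : Finset (HeightOneSpectrum (𝓞 K))) : Prop :=
  ∀ v ∉ S, ∃ z : Kˣ, v.valuation K z = exp (-1 : ℤ) ∧
    ∀ v' ∉ S, v' ≠ v → v'.valuation K z = 1

theorem GeneratesClassGroup.mono {S T : Finset (HeightOneSpectrum (𝓞 K))}
    (h : GeneratesClassGroup S) (hST : S ⊆ T) : GeneratesClassGroup T := fun v hv => by
  obtain ⟨z, hz, hz'⟩ := h v fun h => hv (hST h)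
  exact ⟨z, hz, fun v' hv' => hz' v' fun h => hv' (hST h)⟩

theorem GeneratesClassGroup.exists_valuation_eq {S : Finset (HeightOneSpectrum (𝓞 K))}
    (h : GeneratesClassGroup S) (f : HeightOneSpectrum (𝓞 K) → ℤ)
    (T : Finset (HeightOneSpectrum (𝓞 K))) (hf : ∀ v, v ∉ T → v ∉ S → f v = 0) :
    ∃ z : Kˣ, ∀ v ∉ S, v.valuation K z = exp (f v) := by
  classical
  choose! z hz hz' using h
  refine ⟨∏ v ∈ T \ S, z v ^ (-f v), fun v hv => ?_⟩
  have h1 : v.valuation K ((∏ v ∈ T \ S, z v ^ (-f v) : Kˣ) : K) =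
      ∏ u ∈ T \ S, v.valuation K ((z u : K)) ^ (-f u) := by
    simp
  rw [h1]
  have h2 : ∀ u ∈ T \ S, u ≠ v → v.valuation K ((z u : K)) ^ (-f u) = 1 := fun u hu huv => by
    rw [hz' u (Finset.mem_sdiff.1 hu).2 v hv huv.symm, one_zpow]
  by_cases hvT : v ∈ T
  · rw [Finset.prod_eq_single_of_mem v (Finset.mem_sdiff.2 ⟨hvT, hv⟩) h2, hz v hv, ← exp_zsmul]
    simp
  · rw [hf v hvT hv, exp_zero]
    exact Finset.prod_eq_one fun u hu => h2 u hu fun h => hvT (h ▸ (Finset.mem_sdiff.1 hu).1)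

theorem finite_valuation_ne_one {x : K} (hx : x ≠ 0) :
    {v : HeightOneSpectrum (𝓞 K) | v.valuation K x ≠ 1}.Finite := by
  refine ((HeightOneSpectrum.Support.finite (𝓞 K) x).union
    (HeightOneSpectrum.Support.finite (𝓞 K) x⁻¹)).subset fun v hv => ?_
  rcases lt_or_gt_of_ne hv with h | h
  · right
    change 1 < v.valuation K x⁻¹
    rw [map_inv₀]
    exact (one_lt_inv₀ (zero_lt_iff.2 ((Valuation.ne_zero_iff _).2 hx))).2 h
  · exact Or.inl h

variable (L : Type*) [Field L] [NumberField L] [Algebra K L]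

/-- The primes of `L` above the primes in `S`. -/
def placesOver (S : Finset (HeightOneSpectrum (𝓞 K))) : Set (HeightOneSpectrum (𝓞 L)) :=
  {w | w.under (𝓞 K) ∈ S}

open scoped Classical in
/-- The places in `S` that do not split completely in `L / K` of degree `p`. -/
noncomputable def nonsplit (p : ℕ) (S : Finset (HeightOneSpectrum (𝓞 K))) :
    Finset (HeightOneSpectrum (𝓞 K)) :=
  S.filter fun v => (primeFiber L v).ncard ≠ p

theorem mem_nonsplit {p : ℕ} {S : Finset (HeightOneSpectrum (𝓞 K))}
    {v : HeightOneSpectrum (𝓞 K)} :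
    v ∈ nonsplit L p S ↔ v ∈ S ∧ (primeFiber L v).ncard ≠ p := by
  classical
  simp [nonsplit]

theorem placesOver_finite (S : Finset (HeightOneSpectrum (𝓞 K))) : (placesOver L S).Finite := by
  have : placesOver L S = ⋃ v ∈ S, primeFiber L v := by
    ext w; simp [placesOver, primeFiber]
  rw [this]
  exact S.finite_toSet.biUnion fun v _ => primeFiber_finite v

variable {L}

theorem ncard_placesOver [IsGalois K L] {p : ℕ} (hp : p.Prime) (hL : Module.finrank K L = p)
    (S : Finset (HeightOneSpectrum (𝓞 K))) :
    (placesOver L S).ncard + (p - 1) * (nonsplit L p S).card = p * S.card := by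
  classical
  induction S using Finset.induction_on with
  | empty => simp [placesOver, nonsplit]
  | insert v S hv ih =>
    have h1 : placesOver L (insert v S) = primeFiber L v ∪ placesOver L S := by
      ext w; simp [placesOver, primeFiber]
    have h2 : Disjoint (primeFiber L v) (placesOver L S) := by
      rw [Set.disjoint_left]
      intro w hw hw'
      exact hv (hw ▸ hw')
    rw [h1, Set.ncard_union_eq h2 (primeFiber_finite v) (placesOver_finite L S),
      Finset.card_insert_of_notMem hv, nonsplit, Finset.filter_insert]
    have h3 := ih
    rw [nonsplit] at h3
    obtain ⟨w, hw⟩ := under_surjective (L := L) v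
    have h4 := prime_degree_trichotomy hp hL w
    rw [hw] at h4
    obtain ⟨q, rfl⟩ : ∃ q, p = q + 1 := ⟨p - 1, by have := hp.pos; omega⟩
    split_ifs with h
    · rw [Finset.card_insert_of_notMem (by simp [hv])]
      have h5 : (primeFiber L v).ncard = 1 := by tauto
      rw [h5]
      simp only [Nat.add_sub_cancel] at h3 ⊢
      nlinarith
    · rw [not_not.1 h]
      simp only [Nat.add_sub_cancel] at h3 ⊢
      nlinarith

variable (L) in
/-- The inclusion of `S`-units of `K` in those of `L`. -/
noncomputable def sUnitIncl (S : Finset (HeightOneSpectrum (𝓞 K))) :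
    (S : Set (HeightOneSpectrum (𝓞 K))).unit K →* (placesOver L S).unit L :=
  ((Units.map (algebraMap K L : K →* L)).comp (Subgroup.subtype _)).codRestrict _ fun x w hw => by
    change w.valuation L (algebraMap K L ((x : Kˣ) : K)) = 1
    rw [valuation_algebraMap_eq_one_iff]
    exact x.2 _ hw

theorem coe_sUnitIncl (S : Finset (HeightOneSpectrum (𝓞 K)))
    (x : (S : Set (HeightOneSpectrum (𝓞 K))).unit K) :
    (((sUnitIncl L S x : (placesOver L S).unit L) : Lˣ) : L) = algebraMap K L ((x : Kˣ) : K) := rfl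

theorem sUnitIncl_injective (S : Finset (HeightOneSpectrum (𝓞 K))) :
    Function.Injective (sUnitIncl L S) := fun x y h => by
  apply Subtype.ext
  apply Units.ext
  apply (algebraMap K L).injective
  rw [← coe_sUnitIncl, h, coe_sUnitIncl]

theorem valuation_gal_eq (σ : L ≃ₐ[K] L) (w : HeightOneSpectrum (𝓞 L)) (x : L) :
    w.valuation L (σ x) = (galPrime σ.symm w).valuation L x := by
  rw [← valuation_galPrime σ.symm w (σ x), AlgEquiv.symm_apply_apply]

/-- The Galois action on `S`-units. -/
noncomputable def sUnitGal (S : Finset (HeightOneSpectrum (𝓞 K))) (σ : L ≃ₐ[K] L) :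
    (placesOver L S).unit L →* (placesOver L S).unit L :=
  ((Units.map (σ : L →* L)).comp (Subgroup.subtype _)).codRestrict _ fun x w hw => by
    change w.valuation L (σ ((x : Lˣ) : L)) = 1
    rw [valuation_gal_eq]
    refine x.2 _ fun h => hw ?_
    change (galPrime σ.symm w).under (𝓞 K) ∈ S at h
    rwa [galPrime_under] at h

/-- The Galois action on `S`-units, as a linear map. -/
noncomputable def sUnitGalLin (S : Finset (HeightOneSpectrum (𝓞 K))) (σ : L ≃ₐ[K] L) :
    Additive ((placesOver L S).unit L) →ₗ[ℤ] Additive ((placesOver L S).unit L) :=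
  (MonoidHom.toAdditive (sUnitGal S σ)).toIntLinearMap

/-- The underlying field element of an `S`-unit written additively. -/
def sUnitVal {T : Set (HeightOneSpectrum (𝓞 L))} (x : Additive (T.unit L)) : L :=
  ((x.toMul : Lˣ) : L)

theorem sUnitVal_injective {T : Set (HeightOneSpectrum (𝓞 L))} :
    Function.Injective (sUnitVal (T := T)) := fun _ _ h =>
  congrArg Additive.ofMul (Subtype.ext (Units.ext h))

theorem sUnitVal_ne_zero {T : Set (HeightOneSpectrum (𝓞 L))} (x : Additive (T.unit L)) :
    sUnitVal x ≠ 0 := (x.toMul : Lˣ).ne_zero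

theorem sUnitVal_add {T : Set (HeightOneSpectrum (𝓞 L))} (x y : Additive (T.unit L)) :
    sUnitVal (x + y) = sUnitVal x * sUnitVal y := rfl

theorem sUnitVal_zero {T : Set (HeightOneSpectrum (𝓞 L))} :
    sUnitVal (0 : Additive (T.unit L)) = 1 := rfl

theorem sUnitVal_sub {T : Set (HeightOneSpectrum (𝓞 L))} (x y : Additive (T.unit L)) :
    sUnitVal (x - y) = sUnitVal x / sUnitVal y := by
  rw [eq_div_iff (sUnitVal_ne_zero y), ← sUnitVal_add, sub_add_cancel]

theorem sUnitVal_sum {T : Set (HeightOneSpectrum (𝓞 L))} {ι : Type*} (s : Finset ι)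
    (f : ι → Additive (T.unit L)) : sUnitVal (∑ i ∈ s, f i) = ∏ i ∈ s, sUnitVal (f i) := by
  classical
  induction s using Finset.induction_on with
  | empty => simp [sUnitVal_zero]
  | insert a s ha ih => rw [Finset.sum_insert ha, Finset.prod_insert ha, sUnitVal_add, ih]

theorem sUnitVal_gal_pow (S : Finset (HeightOneSpectrum (𝓞 K))) (σ : L ≃ₐ[K] L) (i : ℕ)
    (x : Additive ((placesOver L S).unit L)) :
    sUnitVal ((sUnitGalLin S σ ^ i) x) = (σ ^ i) (sUnitVal x) := by
  induction i with
  | zero => rfl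
  | succ n ih =>
    rw [pow_succ', pow_succ', Module.End.mul_apply, AlgEquiv.mul_apply, ← ih]
    rfl

namespace KummerDatum

variable {p : ℕ} {ζ a : K} {α : L} {σ : L ≃ₐ[K] L} (D : KummerDatum p ζ a α σ)
  {S : Finset (HeightOneSpectrum (𝓞 K))}
include D

theorem sUnitVal_norm (x : Additive ((placesOver L S).unit L)) :
    sUnitVal ((∑ i ∈ Finset.range p, sUnitGalLin S σ ^ i) x) =
      algebraMap K L (Algebra.norm K (sUnitVal x)) := by
  rw [LinearMap.sum_apply, sUnitVal_sum, D.algebraMap_norm]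
  exact Finset.prod_congr rfl fun i _ => sUnitVal_gal_pow S σ i x

/-- Hilbert's Theorem 90 for `S`-units. -/
theorem exists_sub_eq_of_norm_eq_zero (hcl : GeneratesClassGroup S)
    (hram : ∀ w : HeightOneSpectrum (𝓞 L), w.under (𝓞 K) ∉ S → ramIdx K w = 1)
    (x : Additive ((placesOver L S).unit L))
    (hx : (∑ i ∈ Finset.range p, sUnitGalLin S σ ^ i) x = 0) :
    ∃ y, (sUnitGalLin S σ - 1) y = x := by
  have := D.isGalois
  have h1 : Algebra.norm K (sUnitVal x) = 1 := by
    apply (algebraMap K L).injective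
    rw [← D.sUnitVal_norm, hx, sUnitVal_zero, map_one]
  obtain ⟨y, hy0, hy⟩ := D.exists_eq_div_of_norm_eq_one h1
  have hinv : ∀ w : HeightOneSpectrum (𝓞 L), w.under (𝓞 K) ∉ S →
      w.valuation L (σ y) = w.valuation L y := by
    intro w hw
    have h2 : w.valuation L (sUnitVal x) = 1 := (x.toMul).2 w hw
    rw [hy, map_div₀, div_eq_one_iff_eq (by simpa using hy0)] at h2
    exact h2
  have hinv' : ∀ (i : ℕ) (w : HeightOneSpectrum (𝓞 L)), w.under (𝓞 K) ∉ S →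
      w.valuation L ((σ ^ i) y) = w.valuation L y := by
    intro i
    induction i with
    | zero => intro w _; rfl
    | succ n ih =>
      intro w hw
      have h3 : (galPrime σ.symm w).under (𝓞 K) ∉ S := by rwa [galPrime_under]
      rw [pow_succ', AlgEquiv.mul_apply, valuation_gal_eq, ih _ h3, ← valuation_gal_eq, hinv w hw]
  choose W hW using under_surjective (K := K) (L := L)
  have hconst : ∀ w : HeightOneSpectrum (𝓞 L), w.under (𝓞 K) ∉ S →
      (W (w.under (𝓞 K))).valuation L y = w.valuation L y := by
    intro w hw
    obtain ⟨τ, hτ⟩ := exists_galPrime_eq (hW (w.under (𝓞 K)))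
    obtain ⟨i, -, rfl⟩ := D.exists_eq_pow τ
    rw [← valuation_galPrime (σ ^ i), hτ, hinv' i w hw]
  obtain ⟨z, hz⟩ := hcl.exists_valuation_eq (fun v => log ((W v).valuation L y))
    ((finite_valuation_ne_one hy0).image fun w => w.under (𝓞 K)).toFinset (by
      intro v hv hvS
      have : (W v).valuation L y = 1 := by
        by_contra h
        exact hv (by
          rw [Set.Finite.mem_toFinset]
          exact ⟨W v, h, hW v⟩)
      simp [this])
  have hz0 : algebraMap K L z ≠ 0 := by simp
  have hy1 : y / algebraMap K L z ≠ 0 := div_ne_zero hy0 hz0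
  have hmem : Units.mk0 _ hy1 ∈ (placesOver L S).unit L := by
    intro w hw
    change w.valuation L (y / algebraMap K L z) = 1
    have hw' : w.under (𝓞 K) ∉ S := hw
    have hwy : w.valuation L y ≠ 0 := by simpa using hy0
    rw [map_div₀, valuation_algebraMap_eq_pow, hram w hw', pow_one, hz _ hw', hconst w hw',
      exp_log hwy, div_self hwy]
  refine ⟨Additive.ofMul ⟨Units.mk0 _ hy1, hmem⟩, sUnitVal_injective ?_⟩
  rw [LinearMap.sub_apply, sUnitVal_sub, hy]
  change σ (y / algebraMap K L z) / (y / algebraMap K L z) = _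
  rw [map_div₀, AlgEquiv.commutes]
  field_simp

/-- The norm index of `S`-units in a cyclic extension of prime degree unramified at infinity. -/
theorem relIndex_norm_sUnit (hcl : GeneratesClassGroup S)
    (hram : ∀ w : HeightOneSpectrum (𝓞 L), w.under (𝓞 K) ∉ S → ramIdx K w = 1)
    (hinf : Fintype.card (InfinitePlace L) = p * Fintype.card (InfinitePlace K)) :
    (((placesOver L S).unit L).map (Units.map (Algebra.norm K : L →* K))).relIndex
      ((S : Set (HeightOneSpectrum (𝓞 K))).unit K) * p = p ^ (nonsplit L p S).card := by
  have hp := D.prime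
  have hpf : Fact p.Prime := ⟨hp⟩
  have := D.isGalois
  set M := Additive ((placesOver L S).unit L) with hM
  obtain ⟨hMf, hMr⟩ := sUnit_finite_and_finrank (placesOver L S) (placesOver_finite L S)
  obtain ⟨hKf, hKr⟩ := sUnit_finite_and_finrank (S : Set (HeightOneSpectrum (𝓞 K))) S.finite_toSet
  set s : M →ₗ[ℤ] M := sUnitGalLin S σ with hs
  have hsp : s ^ p = 1 := by
    refine LinearMap.ext fun x => sUnitVal_injective ?_
    rw [sUnitVal_gal_pow, D.pow_eq_one]
    rfl
  set φ : Additive ((S : Set (HeightOneSpectrum (𝓞 K))).unit K) →ₗ[ℤ] M :=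
    (MonoidHom.toAdditive (sUnitIncl L S)).toIntLinearMap with hφ
  have hφi : Function.Injective φ := fun x y h => sUnitIncl_injective S h
  have hφv : ∀ x, sUnitVal (φ x) = algebraMap K L (sUnitVal x) := fun x => rfl
  have hφr : LinearMap.range φ = LinearMap.ker (s - 1) := by
    ext x
    rw [LinearMap.mem_range, LinearMap.mem_ker, LinearMap.sub_apply, sub_eq_zero]
    constructor
    · rintro ⟨y, rfl⟩
      apply sUnitVal_injective
      have := sUnitVal_gal_pow S σ 1 (φ y)
      rw [pow_one] at this
      rw [this, hφv, AlgEquiv.commutes]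
      rfl
    · intro h
      have h1 := sUnitVal_gal_pow S σ 1 x
      rw [pow_one, ← hs, h, pow_one] at h1
      obtain ⟨y, hy⟩ := D.exists_algebraMap_eq h1.symm
      have hy' : algebraMap K L y = sUnitVal x := hy
      have hy0 : y ≠ 0 := by
        rintro rfl
        rw [map_zero] at hy'
        exact sUnitVal_ne_zero x hy'.symm
      refine ⟨Additive.ofMul ⟨Units.mk0 y hy0, fun v hv => ?_⟩, sUnitVal_injective hy'⟩
      obtain ⟨w, rfl⟩ := under_surjective (L := L) v
      change (w.under (𝓞 K)).valuation K y = 1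
      rw [← valuation_algebraMap_eq_one_iff, hy']
      exact x.toMul.2 w hv
  have hrk : Module.finrank ℤ (LinearMap.ker (s - 1)) = S.card + Units.rank K := by
    rw [← hφr, ← (LinearEquiv.ofInjective φ hφi).finrank_eq, hKr, Set.ncard_coe_finset]
  have hc := ncard_placesOver hp D.finrank_eq S
  have hiK := card_infinitePlace_eq_rank_add_one (K := K)
  have hiL := card_infinitePlace_eq_rank_add_one (K := L)
  have hle : (nonsplit L p S).card ≤ S.card := Finset.card_filter_le _ _
  obtain ⟨c, hc'⟩ := Nat.exists_eq_add_of_le hle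
  obtain ⟨q, rfl⟩ : ∃ q, p = q + 1 := ⟨p - 1, by have := hp.pos; omega⟩
  have hk : Module.finrank ℤ M = Module.finrank ℤ (LinearMap.ker (s - 1)) +
      (q + 1 - 1) * (c + Fintype.card (InfinitePlace K)) := by
    rw [hMr, hrk]
    simp only [Nat.add_sub_cancel] at hc ⊢
    rw [hiK] at hinf ⊢
    rw [hiL] at hinf
    rw [hc'] at hc ⊢
    nlinarith
  have key := relIndex_norm_fixed (q + 1) s hsp
    (D.exists_sub_eq_of_norm_eq_zero hcl hram) _ hk
  have hrel : (LinearMap.range (∑ i ∈ Finset.range (q + 1), s ^ i)).toAddSubgroup.relIndex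
      (LinearMap.ker (s - 1)).toAddSubgroup =
      (((placesOver L S).unit L).map (Units.map (Algebra.norm K : L →* K))).relIndex
      ((S : Set (HeightOneSpectrum (𝓞 K))).unit K) := by
    rw [← hφr]
    refine (AddSubgroup.index_comap _ φ.toAddMonoidHom).symm.trans ?_
    rw [Subgroup.relIndex, ← Subgroup.index_toAddSubgroup]
    congr 1
    refine AddSubgroup.ext fun x => ?_
    rw [AddSubgroup.mem_comap, Submodule.mem_toAddSubgroup, LinearMap.mem_range]
    have hx : x ∈ Subgroup.toAddSubgroup ((((placesOver L S).unit L).map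
        (Units.map (Algebra.norm K : L →* K))).subgroupOf
        ((S : Set (HeightOneSpectrum (𝓞 K))).unit K)) ↔
        ∃ y : M, Algebra.norm K (sUnitVal y) = sUnitVal x := by
      change ((x.toMul : Kˣ) ∈ ((placesOver L S).unit L).map
        (Units.map (Algebra.norm K : L →* K))) ↔ _
      rw [Subgroup.mem_map]
      constructor
      · rintro ⟨y, hy, hyx⟩
        exact ⟨Additive.ofMul ⟨y, hy⟩, congrArg Units.val hyx⟩
      · rintro ⟨y, hy⟩
        exact ⟨y.toMul, y.toMul.2, Units.ext hy⟩
    rw [hx]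
    refine exists_congr fun y => ?_
    rw [← (algebraMap K L).injective.eq_iff, ← D.sUnitVal_norm, ← hφv]
    exact sUnitVal_injective.eq_iff.symm
  rw [hrel, hrk, hc', hiK] at key
  have hq : 0 < (q + 1) ^ (c + Units.rank K) := by positivity
  refine Nat.eq_of_mul_eq_mul_right hq ?_
  calc _ = _ * (q + 1) ^ (c + (Units.rank K + 1)) := by rw [mul_assoc]; congr 1; ring
    _ = _ := by rw [key]; ring

end KummerDatum

end HerbrandQuotient

section MultisetZeta

open scoped ENNReal

/-- The sum of the products of weights over all finite multisets avoiding `B`. -/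
noncomputable def multisetZeta {P : Type*} (n : P → ℝ≥0∞) (B : Set P) : ℝ≥0∞ :=
  open Classical in
  ∑' m : Multiset P, if ∀ w ∈ m, w ∉ B then (m.map n).prod else 0

theorem multisetZeta_empty {P : Type*} (n : P → ℝ≥0∞) :
    multisetZeta n ∅ = ∑' m : Multiset P, (m.map n).prod := by
  simp [multisetZeta]

theorem multisetZeta_le_insert {P : Type*} (n : P → ℝ≥0∞) (B : Set P) (w : P) :
    multisetZeta n B ≤ multisetZeta n (insert w B) + n w * multisetZeta n B := by
  classical
  simp only [multisetZeta]
  set f : Multiset P → ℝ≥0∞ := fun m => if ∀ w ∈ m, w ∉ B then (m.map n).prod else 0 with hf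
  have h1 : ∑' m, (if w ∈ m then f m else 0) ≤ n w * ∑' m, f m := by
    rw [← Function.Injective.tsum_eq (g := fun m => w ::ₘ m)
      (fun _ _ h => (Multiset.cons_inj_right w).mp h), ← ENNReal.tsum_mul_left]
    · refine ENNReal.tsum_le_tsum fun m => ?_
      simp only [hf, Multiset.mem_cons, true_or, if_true]
      split_ifs with h2 h3
      · simp
      · exact absurd (fun x hx => h2 x (Or.inr hx)) h3
      · exact zero_le
      · exact zero_le
    · intro m hm
      rw [Function.mem_support] at hm
      have hw : w ∈ m := by
        by_contra h
        exact hm (if_neg h)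
      exact ⟨m.erase w, Multiset.cons_erase hw⟩
  refine le_trans ?_ (add_le_add_right h1 _)
  rw [← ENNReal.tsum_add]
  refine ENNReal.tsum_le_tsum fun m => ?_
  by_cases hw : w ∈ m
  · rw [if_pos hw]
    exact le_add_self
  · have h4 : (∀ x ∈ m, x ∉ insert w B) ↔ ∀ x ∈ m, x ∉ B := by
      refine forall₂_congr fun x hx => ?_
      rw [Set.mem_insert_iff, not_or]
      exact and_iff_right (by rintro rfl; exact hw hx)
    simp only [h4, hw, if_false, add_zero]
    exact le_rfl

theorem multisetZeta_empty_le {P : Type*} (n : P → ℝ≥0∞) (hn : ∀ w, n w ≤ 2⁻¹)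
    (hfin : multisetZeta n ∅ ≠ ∞) (B : Finset P) :
    multisetZeta n ∅ ≤ 2 ^ B.card * multisetZeta n B := by
  classical
  have hB : ∀ B : Set P, multisetZeta n B ≠ ∞ := by
    intro B
    refine ne_top_of_le_ne_top hfin (ENNReal.tsum_le_tsum fun m => ?_)
    split_ifs with h1 h2
    · exact le_rfl
    · exact absurd (fun _ _ => Set.notMem_empty _) h2
    · exact zero_le
    · exact le_rfl
  induction B using Finset.induction_on with
  | empty => simp
  | insert w B hw ih =>
    refine ih.trans ?_
    rw [Finset.card_insert_of_notMem hw, pow_succ, mul_assoc]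
    gcongr
    rw [Finset.coe_insert]
    have h1 := multisetZeta_le_insert n (B : Set P) w
    have h2 : multisetZeta n (B : Set P) ≤
        multisetZeta n (insert w (B : Set P)) + 2⁻¹ * multisetZeta n (B : Set P) :=
      h1.trans (by gcongr; exact hn w)
    have h3 := hB (B : Set P)
    have h4 := hB (insert w (B : Set P))
    lift multisetZeta n (B : Set P) to NNReal using h3 with x
    lift multisetZeta n (insert w (B : Set P)) to NNReal using h4 with y
    have h5 : ((2⁻¹ : NNReal) : ℝ≥0∞) = 2⁻¹ := by simp
    rw [← h5] at h2
    norm_cast at h2 ⊢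
    have h6 : (x : ℝ) ≤ y + 2⁻¹ * x := by exact_mod_cast h2
    have : (x : ℝ) ≤ 2 * y := by linarith
    exact_mod_cast this

theorem multisetZeta_eq_tsum_compl {P : Type*} (n : P → ℝ≥0∞) (B : Set P) :
    multisetZeta n B =
      ∑' m : Multiset {w : P // w ∉ B}, (m.map fun w : {w : P // w ∉ B} => n w.1).prod := by
  classical
  rw [multisetZeta, ← (Multiset.map_injective
    (Subtype.val_injective (p := fun w => w ∉ B))).tsum_eq]
  · refine tsum_congr fun m => ?_
    rw [if_pos, Multiset.map_map]
    · rfl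
    · intro w hw
      obtain ⟨x, -, rfl⟩ := Multiset.mem_map.mp hw
      exact x.2
  · intro m hm
    rw [Function.mem_support] at hm
    have h : ∀ w ∈ m, w ∉ B := by
      by_contra h
      exact hm (if_neg h)
    exact ⟨m.attach.map fun w : {x // x ∈ m} => (⟨w.1, h w.1 w.2⟩ : {w : P // w ∉ B}), by
      rw [Multiset.map_map]
      exact Multiset.attach_map_val m⟩

theorem sq_tsum_multiset_le {P Q : Type*} (n : P → ℝ≥0∞) (n' : Q → ℝ≥0∞) (W : P ⊕ P → Q)
    (hW : Function.Injective W) (h1 : ∀ p, n' (W (Sum.inl p)) = n p)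
    (h2 : ∀ p, n' (W (Sum.inr p)) = n p) :
    (∑' m : Multiset P, (m.map n).prod) ^ 2 ≤ ∑' m : Multiset Q, (m.map n').prod := by
  classical
  have hinj : Function.Injective fun m : Multiset P × Multiset P =>
      (m.1.disjSum m.2).map W := by
    refine (Multiset.map_injective hW).comp fun x y h => ?_
    refine Prod.ext (Multiset.ext.mpr fun a => ?_) (Multiset.ext.mpr fun a => ?_)
    · have := congrArg (Multiset.count (Sum.inl a)) h
      simpa [Multiset.disjSum, Multiset.count_map_eq_count' _ _ Sum.inl_injective,
        Multiset.count_eq_zero] using this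
    · have := congrArg (Multiset.count (Sum.inr a)) h
      simpa [Multiset.disjSum, Multiset.count_map_eq_count' _ _ Sum.inr_injective,
        Multiset.count_eq_zero] using this
  refine le_trans (le_of_eq ?_) (ENNReal.tsum_comp_le_tsum_of_injective hinj _)
  rw [ENNReal.tsum_prod', sq, ← ENNReal.tsum_mul_right]
  refine tsum_congr fun a => ?_
  rw [← ENNReal.tsum_mul_left]
  refine tsum_congr fun b => ?_
  simp only [Multiset.disjSum, Multiset.map_add, Multiset.prod_add, Multiset.map_map,
    Function.comp_def, h1, h2]

theorem sq_multisetZeta_le {P Q : Type*} (n : P → ℝ≥0∞) (n' : Q → ℝ≥0∞) (B : Finset P)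
    (hn : ∀ w, n w ≤ 2⁻¹) (hfin : multisetZeta n ∅ ≠ ∞)
    (W₁ W₂ : P → Q) (hn₁ : ∀ w ∉ B, n' (W₁ w) = n w) (hn₂ : ∀ w ∉ B, n' (W₂ w) = n w)
    (u : Q → P) (hu₁ : ∀ w ∉ B, u (W₁ w) = w) (hu₂ : ∀ w ∉ B, u (W₂ w) = w)
    (hne : ∀ w ∉ B, W₁ w ≠ W₂ w) :
    multisetZeta n ∅ ^ 2 ≤ 4 ^ B.card * multisetZeta n' ∅ := by
  have h1 := multisetZeta_empty_le n hn hfin B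
  have h2 : multisetZeta n (B : Set P) ^ 2 ≤ multisetZeta n' ∅ := by
    rw [multisetZeta_eq_tsum_compl, multisetZeta_empty]
    refine sq_tsum_multiset_le _ n'
      (Sum.elim (fun w : {w : P // w ∉ (B : Set P)} => W₁ w.1) (fun w => W₂ w.1)) ?_
      (fun w => hn₁ w w.2) (fun w => hn₂ w w.2)
    rintro (x | x) (y | y) h <;> simp only [Sum.elim_inl, Sum.elim_inr] at h <;>
      have h' := congrArg u h
    · rw [hu₁ _ x.2, hu₁ _ y.2] at h'
      rw [Subtype.ext h']
    · rw [hu₁ _ x.2, hu₂ _ y.2] at h'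
      exact absurd (h.trans (by rw [h'])) (hne x x.2)
    · rw [hu₂ _ x.2, hu₁ _ y.2] at h'
      exact absurd (h.symm.trans (by rw [h'])) (hne y y.2)
    · rw [hu₂ _ x.2, hu₂ _ y.2] at h'
      rw [Subtype.ext h']
  calc _ ≤ (2 ^ B.card * multisetZeta n (B : Set P)) ^ 2 := by gcongr
    _ = 4 ^ B.card * multisetZeta n (B : Set P) ^ 2 := by
      rw [mul_pow, ← pow_mul, mul_comm B.card, pow_mul]; norm_num
    _ ≤ _ := by gcongr

end MultisetZeta

section DedekindZeta

open NumberField IsDedekindDomain Filter Topology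
open scoped ENNReal

variable {K : Type*} [Field K] [NumberField K]

/-- The weight `N(v)⁻ˢ` of a prime. -/
noncomputable def primeWeight (s : ℝ) (v : HeightOneSpectrum (𝓞 K)) : ℝ≥0∞ :=
  ENNReal.ofReal ((Ideal.absNorm v.asIdeal : ℝ) ^ (-s))

theorem primeWeight_le {s : ℝ} (hs : 1 ≤ s) (v : HeightOneSpectrum (𝓞 K)) :
    primeWeight s v ≤ 2⁻¹ := by
  have h : 2 ≤ Ideal.absNorm v.asIdeal := by
    have h0 : Ideal.absNorm v.asIdeal ≠ 0 := by
      rw [Ne, Ideal.absNorm_eq_zero_iff]; exact v.ne_bot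
    have h1 : Ideal.absNorm v.asIdeal ≠ 1 := by
      rw [Ne, Ideal.absNorm_eq_one_iff]; exact v.isPrime.ne_top
    omega
  have h2 : (2 : ℝ) ≤ Ideal.absNorm v.asIdeal := by exact_mod_cast h
  rw [primeWeight]
  refine ENNReal.ofReal_le_of_le_toReal ?_
  rw [ENNReal.toReal_inv, ENNReal.toReal_ofNat, Real.rpow_neg (by positivity)]
  refine inv_anti₀ (by norm_num) (h2.trans ?_)
  exact Real.self_le_rpow_of_one_le (by linarith) hs

theorem prod_primeWeight (s : ℝ) (m : Multiset (HeightOneSpectrum (𝓞 K))) :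
    (m.map (primeWeight s)).prod =
      ENNReal.ofReal ((Ideal.absNorm (m.map HeightOneSpectrum.asIdeal).prod : ℝ) ^ (-s)) := by
  induction m using Multiset.induction_on with
  | empty => simp
  | cons v m ih =>
    rw [Multiset.map_cons, Multiset.prod_cons, ih, Multiset.map_cons, Multiset.prod_cons, map_mul,
      Nat.cast_mul, Real.mul_rpow (by positivity) (by positivity),
      ENNReal.ofReal_mul (by positivity), primeWeight]

theorem multiset_prod_asIdeal_injective : Function.Injective
    fun m : Multiset (HeightOneSpectrum (𝓞 K)) => (m.map HeightOneSpectrum.asIdeal).prod := by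
  intro m m' h
  refine Multiset.map_injective (fun v w h => HeightOneSpectrum.ext h) ?_
  have hp : ∀ m : Multiset (HeightOneSpectrum (𝓞 K)),
      ∀ I ∈ m.map HeightOneSpectrum.asIdeal, Prime I := by
    intro m I hI
    obtain ⟨v, -, rfl⟩ := Multiset.mem_map.mp hI
    exact v.prime
  rw [← UniqueFactorizationMonoid.normalizedFactors_prod_of_prime (hp m),
    ← UniqueFactorizationMonoid.normalizedFactors_prod_of_prime (hp m')]
  exact congrArg _ h

theorem exists_multiset_prod_asIdeal {I : Ideal (𝓞 K)} (hI : I ≠ 0) :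
    ∃ m : Multiset (HeightOneSpectrum (𝓞 K)), (m.map HeightOneSpectrum.asIdeal).prod = I := by
  induction I using UniqueFactorizationMonoid.induction_on_prime with
  | h₁ => exact absurd rfl hI
  | h₂ J hJ => exact ⟨0, by simpa using (Ideal.isUnit_iff.mp hJ).symm⟩
  | h₃ J P hJ hP ih =>
    obtain ⟨m, rfl⟩ := ih hJ
    exact ⟨⟨P, Ideal.isPrime_of_prime hP, hP.ne_zero⟩ ::ₘ m, by simp⟩

theorem multisetZeta_primeWeight {s : ℝ} (hs : 0 < s) :
    multisetZeta (primeWeight (K := K) s) ∅ =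
      ∑' n : ℕ, ENNReal.ofReal
        (Nat.card {I : Ideal (𝓞 K) // Ideal.absNorm I = n} * (n : ℝ) ^ (-s)) := by
  rw [multisetZeta_empty]
  simp_rw [prod_primeWeight]
  rw [multiset_prod_asIdeal_injective.tsum_eq
    (f := fun I : Ideal (𝓞 K) => ENNReal.ofReal ((Ideal.absNorm I : ℝ) ^ (-s)))]
  · rw [← (Equiv.sigmaFiberEquiv (fun I : Ideal (𝓞 K) => Ideal.absNorm I)).tsum_eq,
      ENNReal.tsum_sigma']
    refine tsum_congr fun n => ?_
    have : ∀ I : {I : Ideal (𝓞 K) // Ideal.absNorm I = n},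
        ENNReal.ofReal ((Ideal.absNorm ((Equiv.sigmaFiberEquiv
          (fun I : Ideal (𝓞 K) => Ideal.absNorm I)) ⟨n, I⟩) : ℝ) ^ (-s)) =
        ENNReal.ofReal ((n : ℝ) ^ (-s)) := by
      rintro ⟨I, rfl⟩; rfl
    simp_rw [this]
    have hf : Finite {I : Ideal (𝓞 K) // Ideal.absNorm I = n} :=
      Ideal.finite_setOfPred_absNorm_eq n
    rw [ENNReal.tsum_const, ENNReal.ofReal_mul (by positivity), ENNReal.ofReal_natCast]
    congr 1
    rw [ENat.card_eq_coe_natCard]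
    simp
  · intro I hI
    rw [Function.mem_support] at hI
    refine exists_multiset_prod_asIdeal fun h => hI ?_
    rw [h]
    simp [Real.zero_rpow (neg_ne_zero.mpr hs.ne')]

theorem tendsto_multisetZeta_primeWeight :
    ∃ c : ℝ, 0 < c ∧ Tendsto
      (fun s : ℝ => (s - 1) * (multisetZeta (primeWeight (K := K) s) ∅).toReal)
      (𝓝[>] 1) (𝓝 c) ∧ ∀ᶠ s in 𝓝[>] (1 : ℝ), multisetZeta (primeWeight (K := K) s) ∅ ≠ ∞ := by
  have hlim := tendsto_sub_one_mul_dedekindZeta_nhdsGT K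
  have hne := hlim.eventually_ne
    (Complex.ofReal_ne_zero.mpr (dedekindZeta_residue_ne_zero K))
  have hev : ∀ᶠ s in 𝓝[>] (1 : ℝ), multisetZeta (primeWeight (K := K) s) ∅ ≠ ∞ ∧
      (((multisetZeta (primeWeight (K := K) s) ∅).toReal : ℝ) : ℂ) = dedekindZeta K s := by
    filter_upwards [hne, self_mem_nhdsWithin] with s hs hs1
    have hs0 : 0 < s := lt_trans one_pos hs1
    set f : ℕ → ℝ := fun n => Nat.card {I : Ideal (𝓞 K) // Ideal.absNorm I = n} * (n : ℝ) ^ (-s)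
      with hf
    have hterm : ∀ n : ℕ, LSeries.term
        (fun n ↦ (Nat.card {I : Ideal (𝓞 K) // Ideal.absNorm I = n} : ℂ)) s n = (f n : ℂ) := by
      intro n
      rcases eq_or_ne n 0 with rfl | hn
      · simp [hf, Real.zero_rpow (neg_ne_zero.mpr hs0.ne')]
      · rw [LSeries.term_of_ne_zero hn, hf, div_eq_mul_inv]
        push_cast
        rw [Complex.ofReal_cpow (by positivity), ← Complex.cpow_neg]
        simp
    have hz : dedekindZeta K s = ∑' n, (f n : ℂ) := tsum_congr hterm
    have hsum : Summable f := by
      by_contra h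
      refine hs ?_
      rw [hz, ← Complex.ofReal_tsum, tsum_eq_zero_of_not_summable h]
      simp
    have hf0 : ∀ n, 0 ≤ f n := fun n => by positivity
    have hm : multisetZeta (primeWeight (K := K) s) ∅ = ENNReal.ofReal (∑' n, f n) := by
      rw [multisetZeta_primeWeight hs0, ENNReal.ofReal_tsum_of_nonneg hf0 hsum]
    refine ⟨by rw [hm]; exact ENNReal.ofReal_ne_top, ?_⟩
    rw [hm, ENNReal.toReal_ofReal (tsum_nonneg hf0), hz, Complex.ofReal_tsum]
  refine ⟨_, dedekindZeta_residue_pos K, ?_, hev.mono fun s h => h.1⟩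
  rw [← tendsto_ofReal_iff]
  refine hlim.congr' (hev.mono fun s h => ?_)
  push_cast
  rw [h.2]

/-- Almost all primes of a number field cannot have two extensions of the same norm. -/
theorem exists_prime_not_two_extensions {M : Type*} [Field M] [NumberField M] [Algebra K M]
    (B : Finset (HeightOneSpectrum (𝓞 K))) :
    ∃ w ∉ B, ¬ ∃ W₁ W₂ : HeightOneSpectrum (𝓞 M), W₁ ≠ W₂ ∧ W₁.under (𝓞 K) = w ∧
      W₂.under (𝓞 K) = w ∧ Ideal.absNorm W₁.asIdeal = Ideal.absNorm w.asIdeal ∧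
      Ideal.absNorm W₂.asIdeal = Ideal.absNorm w.asIdeal := by
  by_contra! hcon
  have hne : Nonempty (HeightOneSpectrum (𝓞 M)) := by
    obtain ⟨I, hI⟩ := Ring.not_isField_iff_exists_prime.mp (RingOfIntegers.not_isField M)
    exact ⟨⟨I, hI.2, hI.1⟩⟩
  choose! W₁ W₂ h12 h1 h2 hN1 hN2 using hcon
  obtain ⟨c, hc, hlim, hfin⟩ := tendsto_multisetZeta_primeWeight (K := K)
  obtain ⟨c', hc', hlim', hfin'⟩ := tendsto_multisetZeta_primeWeight (K := M)
  have hle : ∀ᶠ s in 𝓝[>] (1 : ℝ),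
      ((s - 1) * (multisetZeta (primeWeight (K := K) s) ∅).toReal) ^ 2 ≤
      (s - 1) * (4 ^ B.card * ((s - 1) * (multisetZeta (primeWeight (K := M) s) ∅).toReal)) := by
    filter_upwards [hfin, hfin', self_mem_nhdsWithin] with s hs hs' hs1
    have hs1' : (0 : ℝ) ≤ s - 1 := sub_nonneg.mpr (le_of_lt hs1)
    have := sq_multisetZeta_le (primeWeight (K := K) s) (primeWeight (K := M) s) B
      (primeWeight_le (le_of_lt hs1)) hs W₁ W₂
      (fun w hw => by rw [primeWeight, hN1 w hw, primeWeight])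
      (fun w hw => by rw [primeWeight, hN2 w hw, primeWeight])
      (fun w => w.under (𝓞 K)) h1 h2 h12
    have h3 := ENNReal.toReal_mono (ENNReal.mul_ne_top (by finiteness) hs') this
    rw [ENNReal.toReal_pow, ENNReal.toReal_mul, ENNReal.toReal_pow, ENNReal.toReal_ofNat] at h3
    calc _ = (s - 1) ^ 2 * (multisetZeta (primeWeight (K := K) s) ∅).toReal ^ 2 := by ring
      _ ≤ (s - 1) ^ 2 * (4 ^ B.card * (multisetZeta (primeWeight (K := M) s) ∅).toReal) := by
        gcongr
      _ = _ := by ring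
  have hs0 : Tendsto (fun s : ℝ => s - 1) (𝓝[>] 1) (𝓝 0) := by
    have : Tendsto (fun s : ℝ => s - 1) (𝓝 1) (𝓝 (1 - 1)) := (continuous_sub_right 1).tendsto 1
    rw [sub_self] at this
    exact this.mono_left nhdsWithin_le_nhds
  have := le_of_tendsto_of_tendsto (hlim.pow 2) (hs0.mul (hlim'.const_mul (4 ^ B.card))) hle
  rw [zero_mul] at this
  have hc2 : 0 < c ^ 2 := by positivity
  linarith

end DedekindZeta

section SplittingPrimes

open NumberField IsDedekindDomain WithZero

theorem Subgroup.prime_dvd_relIndex {G : Type*} [CommGroup G] {H J : Subgroup G} {p : ℕ}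
    (hp : p.Prime) {a : G} (haJ : a ∈ J) (ha : a ∉ H) (hap : a ^ p ∈ H) : p ∣ H.relIndex J := by
  have : Fact p.Prime := ⟨hp⟩
  have h : orderOf (QuotientGroup.mk (s := H.subgroupOf J) ⟨a, haJ⟩) = p := by
    refine orderOf_eq_prime ?_ ?_
    · rw [← QuotientGroup.mk_pow, QuotientGroup.eq_one_iff]
      exact hap
    · rw [Ne, QuotientGroup.eq_one_iff]
      exact ha
  have h2 := _root_.orderOf_dvd_natCard (QuotientGroup.mk (s := H.subgroupOf J) (⟨a, haJ⟩ : J))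
  rw [h] at h2
  exact h2

theorem Subgroup.exists_zpow_mul_of_relIndex_le {G : Type*} [CommGroup G] {H U : Subgroup G} {p : ℕ}
    (hp : p.Prime) (hne : H.relIndex U ≠ 0) (hle : H.relIndex U ≤ p) {a : G} (haU : a ∈ U)
    (ha : a ∉ H) (hap : a ^ p ∈ H) {u : G} (hu : u ∈ U) : ∃ j : ℤ, ∃ h ∈ H, u = a ^ j * h := by
  have : Fact p.Prime := ⟨hp⟩
  have hcard : Nat.card (U ⧸ H.subgroupOf U) = p :=
    le_antisymm hle (Nat.le_of_dvd (Nat.pos_of_ne_zero hne) (prime_dvd_relIndex hp haU ha hap))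
  have h1 : QuotientGroup.mk (s := H.subgroupOf U) ⟨a, haU⟩ ≠ 1 := by
    rw [Ne, QuotientGroup.eq_one_iff]
    exact ha
  obtain ⟨j, hj⟩ := Subgroup.mem_zpowers_iff.mp (mem_zpowers_of_prime_card hcard h1
    (g' := QuotientGroup.mk (s := H.subgroupOf U) ⟨u, hu⟩))
  rw [← QuotientGroup.mk_zpow, QuotientGroup.eq] at hj
  exact ⟨j, _, hj, by simp⟩

variable {K L : Type*} [Field K] [NumberField K] [Field L] [NumberField L] [Algebra K L]

theorem map_mem_locPow {p : ℕ} (hp : p ≠ 0) (w : HeightOneSpectrum (𝓞 L)) {x : Kˣ}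
    (hx : x ∈ locPow p (w.under (𝓞 K))) :
    Units.map (algebraMap K L : K →* L) x ∈ locPow p w := by
  obtain ⟨z, hz, c, rfl⟩ := mem_locPow.mp hx
  refine mem_locPow.mpr ⟨Units.map (algebraMap K L : K →* L) z, ?_,
    Units.map (algebraMap K L : K →* L) c, by simp⟩
  rw [mem_near hp] at hz ⊢
  have h1 : ((Units.map (algebraMap K L : K →* L) z : Lˣ) : L) - 1 =
      algebraMap K L ((z : K) - 1) := by simp
  have h2 : (p : L) = algebraMap K L p := by simp
  rw [h1, h2, valuation_algebraMap_eq_pow, valuation_algebraMap_eq_pow, pow_right_comm]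
  exact pow_lt_pow_left₀ hz zero_le (ramIdx_ne_zero w)

namespace KummerDatum

variable {p : ℕ} {ζ a : K} {α : L} {σ : L ≃ₐ[K] L} (D : KummerDatum p ζ a α σ)
include D

/-- A prime where `a` is a local `p`-th power and an independent element `u` is not. -/
theorem exists_prime_locPow {a' u : Kˣ} (ha : (a' : K) = a)
    (hu : ∀ (j : ℕ) (c : K), (u : K) ≠ a ^ j * c ^ p) (B : Finset (HeightOneSpectrum (𝓞 K))) :
    ∃ t ∉ B, a' ∈ locPow p t ∧ u ∉ locPow p t := by
  classical
  by_contra! hcon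
  have hp := D.prime
  set u' : Lˣ := Units.map (algebraMap K L : K →* L) u with hu'
  have huL : ∀ c : L, c ^ p ≠ (u' : L) := fun c hc => by
    obtain ⟨j, c, h⟩ := D.eq_pow_mul_pow_of_isPow u.ne_zero hc
    exact hu j c h
  obtain ⟨hirr, τ, E⟩ := exists_kummerDatum hp (D.prim.map_of_injective (algebraMap K L).injective)
    u'.ne_zero huL
  set M := AdjoinRoot (Polynomial.X ^ p - Polynomial.C (u' : L)) with hM
  have := E.finiteDimensional
  have : CharZero M := charZero_of_injective_algebraMap (algebraMap L M).injective
  have : NumberField M := NumberField.of_module_finite L M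
  have := E.isGalois
  have hpK : (p : K) ≠ 0 := by exact_mod_cast hp.ne_zero
  set B' : Finset (HeightOneSpectrum (𝓞 K)) := B ∪ ((finite_valuation_ne_one hpK).toFinset ∪
    ((finite_valuation_ne_one a'.ne_zero).toFinset ∪ (finite_valuation_ne_one u.ne_zero).toFinset))
    with hB'
  obtain ⟨w, hw, hw2⟩ := exists_prime_not_two_extensions (M := M)
    (placesOver_finite L B').toFinset
  rw [Set.Finite.mem_toFinset] at hw
  replace hw : w.under (𝓞 K) ∉ B' := hw
  simp only [hB', Finset.mem_union, Set.Finite.mem_toFinset, Set.mem_ofPred_eq, not_or, not_not]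
    at hw
  obtain ⟨hwB, hwp, hwa, hwu⟩ := hw
  set t := w.under (𝓞 K) with ht
  have hmem : u' ∈ locPow p w := by
    by_cases hat : a' ∈ locPow p t
    · exact map_mem_locPow hp.ne_zero w (hcon t hwB hat)
    · have hidx := locPow_relIndex_unitBall t hp D.prim (e := 0) (by rw [hwp]; simp)
      obtain ⟨j, h, hh, hj⟩ := Subgroup.exists_zpow_mul_of_relIndex_le hp hidx.1
        (by simpa using hidx.2) ((mem_unitBall_zero t).mpr hwa) hat (pow_mem_locPow p t a')
        ((mem_unitBall_zero t).mpr hwu)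
      rw [hu', hj, map_mul, map_zpow]
      refine mul_mem ?_ (map_mem_locPow hp.ne_zero w hh)
      refine zpow_mem ?_ j
      have : Units.map (algebraMap K L : K →* L) a' = (Units.mk0 α D.root_ne_zero) ^ p := by
        apply Units.ext
        simp [D.pow_eq, ha]
      rw [this]
      exact pow_mem_locPow p w _
  have hsplit := E.ncard_primeFiber_of_mem_locPow rfl hmem
  have hN : ∀ W ∈ primeFiber M w, Ideal.absNorm W.asIdeal = Ideal.absNorm w.asIdeal := by
    rintro W rfl
    have := hp.one_lt
    rcases prime_degree_trichotomy hp E.finrank_eq W with h | h | h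
    · exact h.2.2
    · omega
    · omega
  obtain ⟨W₁, hW₁, W₂, hW₂, hne⟩ := (Set.one_lt_ncard (primeFiber_finite w)).mp
    (hsplit ▸ hp.one_lt)
  exact hw2 ⟨W₁, W₂, hne, hW₁, hW₂, hN _ hW₁, hN _ hW₂⟩

end KummerDatum

end SplittingPrimes

section ClassGroupAndInfinity

open NumberField IsDedekindDomain WithZero

theorem exists_generatesClassGroup (K : Type*) [Field K] [NumberField K] :
    ∃ S : Finset (HeightOneSpectrum (𝓞 K)), GeneratesClassGroup S := by
  classical
  choose I hI using ClassGroup.mk0_surjective (R := 𝓞 K)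
  have hfin : (⋃ c, {v : HeightOneSpectrum (𝓞 K) | v.asIdeal ∣ (I c : Ideal (𝓞 K))}).Finite :=
    Set.finite_iUnion fun c => Ideal.finite_factors (nonZeroDivisors.ne_zero (I c).2)
  refine ⟨hfin.toFinset, fun v hv => ?_⟩
  have hS : ∀ c (v : HeightOneSpectrum (𝓞 K)), v ∉ hfin.toFinset →
      ¬ v.asIdeal ∣ (I c : Ideal (𝓞 K)) := fun c v hv h => by
    rw [Set.Finite.mem_toFinset, Set.mem_iUnion] at hv
    exact hv ⟨c, h⟩
  let V : nonZeroDivisors (Ideal (𝓞 K)) := ⟨v.asIdeal, mem_nonZeroDivisors_of_ne_zero v.ne_bot⟩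
  set c := (ClassGroup.mk0 V)⁻¹ with hc
  have h1 : ClassGroup.mk0 (V * I c) = 1 := by rw [map_mul, hI, hc, mul_inv_cancel]
  rw [ClassGroup.mk0_eq_one_iff] at h1
  obtain ⟨g, hg⟩ := h1.principal
  have hg' : v.asIdeal * (I c : Ideal (𝓞 K)) = Ideal.span {g} := hg
  have hg0 : g ≠ 0 := by
    rintro rfl
    rw [Ideal.span_singleton_zero] at hg'
    rcases mul_eq_zero.mp hg' with h | h
    · exact v.ne_bot h
    · exact nonZeroDivisors.ne_zero (I c).2 h
  have hgK : algebraMap (𝓞 K) K g ≠ 0 := by simpa using hg0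
  refine ⟨Units.mk0 _ hgK, ?_, fun v' hv' hne => ?_⟩
  · rw [Units.val_mk0, HeightOneSpectrum.valuation_of_algebraMap]
    have h2 : v.intValuation g ≤ exp (-((1 : ℕ) : ℤ)) := by
      rw [HeightOneSpectrum.intValuation_le_pow_iff_mem, pow_one]
      exact Ideal.le_of_dvd ⟨_, hg'.symm⟩ (Ideal.mem_span_singleton_self g)
    have h3 : ¬ v.intValuation g ≤ exp (-((2 : ℕ) : ℤ)) := by
      rw [HeightOneSpectrum.intValuation_le_pow_iff_mem, ← Ideal.span_singleton_le_iff_mem,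
        ← hg', ← Ideal.dvd_iff_le, pow_two]
      intro h
      exact hS c v hv ((mul_dvd_mul_iff_left v.ne_bot).mp h)
    have h0 : v.intValuation g ≠ 0 := v.intValuation_ne_zero g hg0
    rw [← exp_log h0] at h2 h3 ⊢
    rw [exp_le_exp] at h2 h3
    rw [exp_inj]
    omega
  · rw [Units.val_mk0, HeightOneSpectrum.valuation_of_algebraMap,
      HeightOneSpectrum.intValuation_eq_one_iff]
    intro h
    rw [← Ideal.span_singleton_le_iff_mem, ← hg', ← Ideal.dvd_iff_le] at h
    rcases v'.prime.dvd_or_dvd h with h | h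
    · have := v.isMaximal.eq_of_le v'.isPrime.ne_top (Ideal.dvd_iff_le.mp h)
      exact hne (HeightOneSpectrum.ext this.symm)
    · exact hS c v' hv' h

namespace KummerDatum

variable {K L : Type*} [Field K] [NumberField K] [Field L] [NumberField L] [Algebra K L]
  {p : ℕ} {ζ a : K} {α : L} {σ : L ≃ₐ[K] L} (D : KummerDatum p ζ a α σ)
include D

theorem card_infinitePlace {a' : Kˣ} (ha : (a' : K) = a) (hpos : a' ∈ totPos K) :
    Fintype.card (InfinitePlace L) = p * Fintype.card (InfinitePlace K) := by
  have := D.isGalois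
  have hun : IsUnramifiedAtInfinitePlaces K L := by
    rcases D.prime.eq_two_or_odd' with rfl | hodd
    · refine ⟨fun w => ?_⟩
      rw [← InfinitePlace.mk_embedding w, InfinitePlace.isUnramified_mk_iff_forall_isConj]
      intro τ hτ
      set φ := w.embedding
      have h1 := hτ.isReal_comp.coe_embedding_apply a
      have h2 : (φ α) ^ 2 = ((hτ.isReal_comp.embedding a : ℝ) : ℂ) := by
        rw [h1, ← map_pow, D.pow_eq]
        rfl
      have h3 : 0 < hτ.isReal_comp.embedding a := ha ▸ hpos hτ.isReal_comp.embedding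
      have h4 : φ (τ α) = φ α := by
        rw [hτ.eq]
        set r := Real.sqrt (hτ.isReal_comp.embedding a)
        have h5 : (φ α) ^ 2 = (r : ℂ) ^ 2 := by
          rw [h2, ← Complex.ofReal_pow, Real.sq_sqrt h3.le]
        rcases sq_eq_sq_iff_eq_or_eq_neg.mp h5 with h | h <;> rw [h] <;> simp
      replace h4 := φ.injective h4
      obtain ⟨i, hi, rfl⟩ := D.exists_eq_pow τ
      rw [D.pow_apply_root, ← map_pow] at h4
      have h6 : algebraMap K L (ζ ^ i) = 1 := by
        exact mul_right_cancel₀ D.root_ne_zero (h4.trans (one_mul α).symm)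
      have h7 : ζ ^ i = 1 :=
        (algebraMap K L).injective (h6.trans (map_one _).symm)
      have h8 := Nat.eq_zero_of_dvd_of_lt (D.prim.dvd_of_pow_eq_one i h7) hi
      rw [h8, pow_zero]
    · exact IsUnramifiedAtInfinitePlaces_of_odd_finrank (D.finrank_eq.symm ▸ hodd)
  rw [IsUnramifiedAtInfinitePlaces.card_infinitePlace K L, D.finrank_eq, mul_comm]

end KummerDatum

end ClassGroupAndInfinity

section NormIndex

open NumberField IsDedekindDomain WithZero

theorem Subgroup.relIndex_zpowers_le {G : Type*} [CommGroup G] {H : Subgroup G} {p : ℕ}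
    (hp : p ≠ 0) {a : G} (hap : a ^ p ∈ H) : H.relIndex (Subgroup.zpowers a) ≤ p := by
  classical
  have : NeZero p := ⟨hp⟩
  have hex : ∀ x : G, ∃ j : ℤ, x ∈ Subgroup.zpowers a → a ^ j = x := fun x => by
    by_cases h : x ∈ Subgroup.zpowers a
    · obtain ⟨j, hj⟩ := Subgroup.mem_zpowers_iff.mp h
      exact ⟨j, fun _ => hj⟩
    · exact ⟨0, fun h' => absurd h' h⟩
  choose e he using hex
  have := (Subgroup.relIndex_le_card_of_separating H (Subgroup.zpowers a)
    (fun x => (e x : ZMod p)) fun x hx y hy hxy => ?_).2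
  · simpa using this
  · rw [ZMod.intCast_eq_intCast_iff_dvd_sub] at hxy
    obtain ⟨m, hm⟩ := hxy
    rw [← he x hx, ← he y hy, ← zpow_neg, ← zpow_add, neg_add_eq_sub, hm, zpow_mul, zpow_natCast]
    exact zpow_mem hap m

theorem Subgroup.index_eq_zero_of_ge {G : Type*} [Group G] {H J : Subgroup G} (h : H ≤ J)
    (hJ : J.index = 0) : H.index = 0 := by
  have := Subgroup.index_dvd_of_le h
  rwa [hJ, zero_dvd_iff] at this

variable {K L : Type*} [Field K] [NumberField K] [Field L] [NumberField L] [Algebra K L]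

theorem locPow_index_ne_zero {p : ℕ} (hp : p.Prime) {ζ : K} (hζ : IsPrimitiveRoot ζ p)
    (v : HeightOneSpectrum (𝓞 K)) : (locPow p v).index ≠ 0 := by
  have h0 : v.valuation K p ≠ 0 := by simpa using hp.ne_zero
  have h1 := HeightOneSpectrum.valuation_natCast_le_one v p
  rw [← exp_log h0, ← exp_zero, exp_le_exp] at h1
  exact (locPow_index v hp hζ (e := (-log (v.valuation K p)).toNat)
    (by rw [Int.toNat_of_nonneg (by omega), neg_neg, exp_log h0])).1

namespace KummerDatum

variable {p : ℕ} {ζ a : K} {α : L} {σ : L ≃ₐ[K] L} (D : KummerDatum p ζ a α σ)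
  {S : Finset (HeightOneSpectrum (𝓞 K))}
include D

theorem map_norm_sUnit_le :
    ((placesOver L S).unit L).map (Units.map (Algebra.norm K : L →* K)) ≤
      (S : Set (HeightOneSpectrum (𝓞 K))).unit K := by
  rintro _ ⟨x, hx, rfl⟩ v hv
  obtain ⟨w, rfl⟩ := under_surjective (L := L) v
  change (w.under (𝓞 K)).valuation K (Algebra.norm K (x : L)) = 1
  rw [← valuation_algebraMap_eq_one_iff, D.algebraMap_norm, map_prod]
  refine Finset.prod_eq_one fun i _ => ?_
  rw [valuation_gal_eq]
  refine hx _ ?_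
  change (galPrime _ w).under (𝓞 K) ∉ S
  rw [galPrime_under]
  exact hv

theorem exists_mem_sUnit_locPows {a' : Kˣ} (ha : (a' : K) = a)
    (haS : a' ∈ (S : Set (HeightOneSpectrum (𝓞 K))).unit K) {T : Finset (HeightOneSpectrum (𝓞 K))}
    {k : ℕ} (hk : k + 1 < S.card + Fintype.card (InfinitePlace K))
    (hne : (locPows p T).relIndex ((S : Set (HeightOneSpectrum (𝓞 K))).unit K) ≠ 0)
    (hT : (locPows p T).relIndex ((S : Set (HeightOneSpectrum (𝓞 K))).unit K) ≤ p ^ k) :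
    ∃ u ∈ (S : Set (HeightOneSpectrum (𝓞 K))).unit K, u ∈ locPows p T ∧
      ∀ (j : ℕ) (c : K), (u : K) ≠ a ^ j * c ^ p := by
  by_contra! hcon
  have hp := D.prime
  have : Fact p.Prime := ⟨hp⟩
  set U := (S : Set (HeightOneSpectrum (𝓞 K))).unit K with hU
  have hpow := sUnit_relIndex_pow (S : Set (HeightOneSpectrum (𝓞 K))) S.finite_toSet p D.prim
  rw [Set.ncard_coe_finset, ← hU] at hpow
  set V := U.map (powMonoidHom p) with hV
  have hVU : V ≤ U := by
    rintro _ ⟨x, hx, rfl⟩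
    exact pow_mem hx p
  have h1 : locPows p T ⊓ U ≤ V ⊔ Subgroup.zpowers a' := by
    rintro u ⟨hu1, hu2⟩
    obtain ⟨j, c, h⟩ := hcon u hu2 hu1
    have hc : c ≠ 0 := by
      rintro rfl
      rw [zero_pow hp.ne_zero, mul_zero] at h
      exact u.ne_zero h
    have h2 : u = (Units.mk0 c hc) ^ p * a' ^ j := by
      apply Units.ext
      rw [h, ← ha]
      simp [mul_comm]
    have h3 : (Units.mk0 c hc) ^ p ∈ U := by
      have : (Units.mk0 c hc) ^ p = u * (a' ^ j)⁻¹ := by rw [h2]; group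
      rw [this]
      exact mul_mem hu2 (inv_mem (pow_mem haS j))
    rw [h2]
    refine Subgroup.mul_mem_sup ⟨Units.mk0 c hc, fun v hv => ?_, rfl⟩
      (pow_mem (Subgroup.mem_zpowers a') j)
    have := h3 v hv
    change v.valuation K (((Units.mk0 c hc) ^ p : Kˣ) : K) = 1 at this
    rw [Units.val_pow_eq_pow_val, map_pow, pow_eq_one_iff_left hp.ne_zero] at this
    exact this
  have h2 : (V ⊔ Subgroup.zpowers a').relIndex U ≤ p ^ k := by
    have h3 : (locPows p T ⊓ U).relIndex U ≠ 0 := by rwa [Subgroup.inf_relIndex_right]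
    exact (Subgroup.relIndex_le_of_le_left h1 h3).trans (by rwa [Subgroup.inf_relIndex_right])
  have h3 := Subgroup.relIndex_zpowers_le (H := V) hp.ne_zero (a := a') ⟨a', haS, rfl⟩
  rw [← Subgroup.relIndex_sup_left] at h3
  have h4 := Subgroup.relIndex_mul_relIndex V (V ⊔ Subgroup.zpowers a') U le_sup_left
    (sup_le hVU ((Subgroup.zpowers_le).mpr haS))
  have h5 : p ^ (S.card + Fintype.card (InfinitePlace K)) ≤ p ^ (k + 1) := by
    rw [← hpow, ← h4, pow_succ, mul_comm]
    exact Nat.mul_le_mul h2 h3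
  exact absurd ((Nat.pow_le_pow_iff_right hp.one_lt).mp h5) (by omega)

/-- Auxiliary primes at which `a` is a local power and which detect the `S`-units modulo `a`. -/
theorem exists_auxiliary_primes {a' : Kˣ} (ha : (a' : K) = a)
    (haS : a' ∈ (S : Set (HeightOneSpectrum (𝓞 K))).unit K)
    (hpS : ∀ v ∉ S, v.valuation K (p : K) = 1) (k : ℕ)
    (hk : k < S.card + Fintype.card (InfinitePlace K)) :
    ∃ T : Finset (HeightOneSpectrum (𝓞 K)), Disjoint S T ∧ T.card = k ∧
      (∀ t ∈ T, a' ∈ locPow p t) ∧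
      ((locPows p T).relIndex ((S : Set (HeightOneSpectrum (𝓞 K))).unit K) ≠ 0 ∧
        (locPows p T).relIndex ((S : Set (HeightOneSpectrum (𝓞 K))).unit K) ≤ p ^ k) ∧
      ∀ x : HeightOneSpectrum (𝓞 K) → Kˣ, (∀ t ∈ T, t.valuation K (x t : K) = 1) →
        ∃ u ∈ (S : Set (HeightOneSpectrum (𝓞 K))).unit K,
          ∀ t ∈ T, (x t)⁻¹ * u ∈ locPow p t := by
  classical
  have hp := D.prime
  induction k with
  | zero =>
    refine ⟨∅, by simp, rfl, by simp, ?_, fun x _ => ⟨1, one_mem _, by simp⟩⟩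
    have : (locPows p (∅ : Finset (HeightOneSpectrum (𝓞 K)))) = ⊤ := by simp [locPows]
    rw [this, Subgroup.relIndex_top_left]
    simp
  | succ k ih =>
    obtain ⟨T, hdis, hcard, haT, ⟨hne, hle⟩, hsurj⟩ := ih (by omega)
    obtain ⟨u, huS, huT, hu⟩ := D.exists_mem_sUnit_locPows ha haS (k := k) (by omega) hne hle
    obtain ⟨t, ht, hat, hut⟩ := D.exists_prime_locPow ha hu (S ∪ T)
    rw [Finset.mem_union, not_or] at ht
    obtain ⟨htS, htT⟩ := ht
    have hidx := locPow_relIndex_unitBall t hp D.prim (e := 0) (by rw [hpS t htS]; simp)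
    rw [pow_zero, mul_one] at hidx
    have hball : (S : Set (HeightOneSpectrum (𝓞 K))).unit K ≤ unitBall t 0 := fun x hx =>
      (mem_unitBall_zero t).mpr (hx t htS)
    refine ⟨insert t T, ?_, ?_, ?_, ?_, fun x hx => ?_⟩
    · rw [Finset.disjoint_insert_right]
      exact ⟨htS, hdis⟩
    · rw [Finset.card_insert_of_notMem htT, hcard]
    · simpa using ⟨hat, haT⟩
    · rw [locPows_insert, ← Subgroup.relIndex_inf_mul_relIndex]
      have h1 : locPows p T ⊓ (S : Set (HeightOneSpectrum (𝓞 K))).unit K ≤ unitBall t 0 :=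
        inf_le_right.trans hball
      refine ⟨mul_ne_zero (fun h => hidx.1 ?_) hne, ?_⟩
      · exact Subgroup.relIndex_eq_zero_of_le_right h1 h
      · rw [pow_succ, mul_comm]
        exact Nat.mul_le_mul hle ((Subgroup.relIndex_le_of_le_right h1 hidx.1).trans hidx.2)
    · obtain ⟨y, hyS, hy⟩ := hsurj x fun s hs => hx s (Finset.mem_insert_of_mem hs)
      have h1 : x t * y⁻¹ ∈ unitBall t 0 :=
        mul_mem ((mem_unitBall_zero t).mpr (hx t (Finset.mem_insert_self _ _)))
          (inv_mem (hball hyS))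
      obtain ⟨j, h, hh, hj⟩ := Subgroup.exists_zpow_mul_of_relIndex_le hp hidx.1 hidx.2
        (hball huS) hut (pow_mem_locPow p t u) h1
      refine ⟨y * u ^ j, mul_mem hyS (zpow_mem huS j), fun s hs => ?_⟩
      rcases Finset.mem_insert.mp hs with rfl | hs
      · have : (x s)⁻¹ * (y * u ^ j) = h⁻¹ := by
          rw [mul_inv_eq_iff_eq_mul] at hj
          rw [inv_mul_eq_iff_eq_mul, hj, mul_right_comm, mul_inv_cancel_right, mul_comm]
        rw [this]
        exact inv_mem hh
      · rw [← mul_assoc]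
        exact mul_mem (hy s hs) (zpow_mem (mem_locPows.mp huT s hs) j)

omit D [NumberField L] in
theorem exists_sUnit_inv_mul_mem {T : Finset (HeightOneSpectrum (𝓞 K))}
    [DecidableEq (HeightOneSpectrum (𝓞 K))] (hcl : GeneratesClassGroup S)
    (hdis : Disjoint S T)
    (hsurj : ∀ x : HeightOneSpectrum (𝓞 K) → Kˣ, (∀ t ∈ T, t.valuation K (x t : K) = 1) →
        ∃ u ∈ (S : Set (HeightOneSpectrum (𝓞 K))).unit K,
          ∀ t ∈ T, (x t)⁻¹ * u ∈ locPow p t) (x : HeightOneSpectrum (𝓞 K) → Kˣ) :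
    ∃ u ∈ ((S ∪ T : Finset _) : Set (HeightOneSpectrum (𝓞 K))).unit K,
      ∀ t ∈ T, (x t)⁻¹ * u ∈ locPow p t := by
  obtain ⟨z, hz⟩ := hcl.exists_valuation_eq
    (fun v => if v ∈ T then log (v.valuation K (x v : K)) else 0) T fun v hv _ => if_neg hv
  obtain ⟨u, hu, hu'⟩ := hsurj (fun v => x v * z⁻¹) fun t ht => by
    have h1 := hz t (Finset.disjoint_right.mp hdis ht)
    rw [if_pos ht, exp_log (by simp)] at h1
    rw [Units.val_mul, Units.val_inv_eq_inv_val, map_mul, map_inv₀, h1, mul_inv_cancel₀ (by simp)]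
  refine ⟨z * u, fun v hv => ?_, fun t ht => ?_⟩
  · rw [Finset.coe_union, Set.mem_union, not_or] at hv
    have h1 := hz v hv.1
    rw [if_neg fun h : v ∈ T => hv.2 h, exp_zero] at h1
    have h2 : v.valuation K (u : K) = 1 := hu v hv.1
    change v.valuation K ((z * u : Kˣ) : K) = 1
    rw [Units.val_mul, map_mul, h1, h2, one_mul]
  · have := hu' t ht
    rwa [mul_inv, inv_inv, mul_assoc] at this

end KummerDatum

theorem isPow_of_mem_locPow {p : ℕ} (hp : p.Prime) {ζ : K} (hζ : IsPrimitiveRoot ζ p)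
    {S T : Finset (HeightOneSpectrum (𝓞 K))} [DecidableEq (HeightOneSpectrum (𝓞 K))]
    (hpS : ∀ v ∉ S, v.valuation K (p : K) = 1)
    (hcl : GeneratesClassGroup S) (hdis : Disjoint S T)
    (hsurj : ∀ x : HeightOneSpectrum (𝓞 K) → Kˣ,
      ∃ u ∈ ((S ∪ T : Finset _) : Set (HeightOneSpectrum (𝓞 K))).unit K,
        ∀ t ∈ T, (x t)⁻¹ * u ∈ locPow p t) {y : Kˣ}
    (hyU : y ∈ ((S ∪ T : Finset _) : Set (HeightOneSpectrum (𝓞 K))).unit K)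
    (hyS : ∀ v ∈ S, y ∈ locPow p v) (hypos : y ∈ totPos K) : ∃ c : K, c ^ p = y := by
  by_contra! hcon
  obtain ⟨hirr, τ, E⟩ := exists_kummerDatum hp hζ y.ne_zero hcon
  set M := AdjoinRoot (Polynomial.X ^ p - Polynomial.C (y : K)) with hM
  have := E.finiteDimensional
  have : CharZero M := charZero_of_injective_algebraMap (algebraMap K M).injective
  have : NumberField M := NumberField.of_module_finite K M
  have hherb := E.relIndex_norm_sUnit (hcl.mono Finset.subset_union_left)
    (fun w hw => E.ramIdx_eq_one (hpS _ fun h => hw (Finset.mem_union_left _ h)) (hyU _ hw))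
    (E.card_infinitePlace rfl hypos)
  have hns : ∀ v ∈ nonsplit M p (S ∪ T), v ∈ T := fun v hv => by
    rw [mem_nonsplit, Finset.mem_union] at hv
    exact hv.1.resolve_left fun h => hv.2 (E.ncard_primeFiber_of_mem_locPow rfl (hyS v h))
  have hlow := Subgroup.card_pow_le_relIndex_iInf (nonsplit M p (S ∪ T))
    (((S ∪ T : Finset _) : Set (HeightOneSpectrum (𝓞 K))).unit K)
    (fun v => locPow p v ⊔ (Units.map (Algebra.norm K : M →* K)).range) p
    (fun v hv => E.locPow_sup_norm_ne_top
      (hpS v (Finset.disjoint_right.mp hdis (hns v hv))) ((mem_nonsplit _).mp hv).2)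
    (fun v _ x => (le_sup_left : locPow p v ≤ _) (pow_mem_locPow p v x)) hp
    (fun v _ h => locPow_index_ne_zero hp hζ v (Subgroup.index_eq_zero_of_ge le_sup_left h))
    (fun x => by
      obtain ⟨u, hu, hu'⟩ := hsurj x
      exact ⟨u, hu, fun v hv => (le_sup_left : locPow p v ≤ _) (hu' v (hns v hv))⟩)
  have hle : ((placesOver M (S ∪ T)).unit M).map (Units.map (Algebra.norm K : M →* K)) ≤
      ⨅ v ∈ nonsplit M p (S ∪ T),
        (locPow p v ⊔ (Units.map (Algebra.norm K : M →* K)).range) :=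
    le_iInf₂ fun v _ => (Subgroup.map_le_range _ _).trans le_sup_right
  have hpos : 0 < p ^ (nonsplit M p (S ∪ T)).card := pow_pos hp.pos _
  rw [← hherb] at hlow hpos
  have h1 := Nat.pos_of_mul_pos_right hpos
  have h2 := hlow.trans (Subgroup.relIndex_le_of_le_left hle h1.ne')
  have := hp.two_le
  nlinarith

namespace KummerDatum

variable {p : ℕ} {ζ a : K} {α : L} {σ : L ≃ₐ[K] L} (D : KummerDatum p ζ a α σ)
include D

/-- The Hasse norm theorem for a Kummer extension of prime degree that is split at the places
above `p` and at infinity. -/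
theorem exists_norm_eq {a' b : Kˣ} (ha : (a' : K) = a) (hpos : a' ∈ totPos K)
    (hap : ∀ v : HeightOneSpectrum (𝓞 K), v.valuation K (p : K) ≠ 1 → a' ∈ locPow p v)
    (hb : ∀ v : HeightOneSpectrum (𝓞 K), v.valuation K (p : K) = 1 → a' ∉ locPow p v →
      b ∈ locPow p v ⊔ (Units.map (Algebra.norm K : L →* K)).range) :
    ∃ y : L, Algebra.norm K y = b := by
  classical
  have hp := D.prime
  have : Fact p.Prime := ⟨hp⟩
  have hpK : (p : K) ≠ 0 := by exact_mod_cast hp.ne_zero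
  obtain ⟨S₀, hS₀⟩ := exists_generatesClassGroup K
  set S : Finset (HeightOneSpectrum (𝓞 K)) := S₀ ∪ ((finite_valuation_ne_one hpK).toFinset ∪
    ((finite_valuation_ne_one a'.ne_zero).toFinset ∪ (finite_valuation_ne_one b.ne_zero).toFinset))
    with hS
  have hcl : GeneratesClassGroup S := hS₀.mono Finset.subset_union_left
  have hout : ∀ v ∉ S, v.valuation K (p : K) = 1 ∧ v.valuation K (a' : K) = 1 ∧
      v.valuation K (b : K) = 1 := fun v hv => by
    simp only [hS, Finset.mem_union, Set.Finite.mem_toFinset, Set.mem_ofPred_eq, not_or, not_not]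
      at hv
    exact hv.2
  clear_value S
  have hcardpos : 0 < Fintype.card (InfinitePlace K) := Fintype.card_pos
  obtain ⟨T, hdis, hTcard, haT, -, hsurj⟩ := D.exists_auxiliary_primes ha
    (fun v hv => (hout v hv).2.1) (fun v hv => (hout v hv).1)
    (S.card + Fintype.card (InfinitePlace K) - 1) (by omega)
  have hsurj' := exists_sUnit_inv_mul_mem hcl hdis hsurj
  set U := ((S ∪ T : Finset _) : Set (HeightOneSpectrum (𝓞 K))).unit K with hU
  have hsub : ∀ v ∉ S ∪ T, v ∉ S := fun v hv h => hv (Finset.mem_union_left _ h)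
  have hherb := D.relIndex_norm_sUnit (hcl.mono (Finset.subset_union_left (s₂ := T)))
    (fun w hw => D.ramIdx_eq_one (hout _ (hsub _ hw)).1 (ha ▸ (hout _ (hsub _ hw)).2.1))
    (D.card_infinitePlace ha hpos)
  rw [← hU] at hherb
  set NU := ((placesOver L (S ∪ T)).unit L).map (Units.map (Algebra.norm K : L →* K)) with hNU
  have hNUU : NU ≤ U := D.map_norm_sUnit_le
  have hns : ∀ v ∈ nonsplit L p (S ∪ T), v ∈ S ∧ v.valuation K (p : K) = 1 ∧ a' ∉ locPow p v :=
    fun v hv => by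
      rw [mem_nonsplit, Finset.mem_union] at hv
      have h1 : a' ∉ locPow p v := fun h => hv.2 (D.ncard_primeFiber_of_mem_locPow ha h)
      exact ⟨hv.1.resolve_right fun h => h1 (haT v h), not_not.mp fun h => h1 (hap v h), h1⟩
  set N : HeightOneSpectrum (𝓞 K) → Subgroup Kˣ :=
    fun v => locPow p v ⊔ (Units.map (Algebra.norm K : L →* K)).range with hN
  set W := ⨅ v ∈ nonsplit L p (S ∪ T), N v with hW
  have hlow : p ^ (nonsplit L p (S ∪ T)).card ≤ W.index := by
    rw [← Subgroup.relIndex_top_right]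
    refine Subgroup.card_pow_le_relIndex_iInf _ ⊤ N p
      (fun v hv => D.locPow_sup_norm_ne_top (hns v hv).2.1 ((mem_nonsplit _).mp hv).2)
      (fun v _ x => (le_sup_left : locPow p v ≤ _) (pow_mem_locPow p v x)) hp
      (fun v _ h => locPow_index_ne_zero hp D.prim v (Subgroup.index_eq_zero_of_ge le_sup_left h))
      fun x => ?_
    obtain ⟨y, hy⟩ := exists_forall_inv_mul_mem_near hp.ne_zero (nonsplit L p (S ∪ T)) x
    exact ⟨y, Subgroup.mem_top _, fun v hv =>
      (le_sup_left : locPow p v ≤ _) (near_le_locPow p v (hy v hv))⟩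
  obtain ⟨hQ0, hQ⟩ := totPos_inf_locPows_index hp D.prim S
  set Q := totPos K ⊓ locPows p S with hQdef
  have hQU : Q.relIndex U = p ^ (2 * (S.card + Fintype.card (InfinitePlace K)) - 1) := by
    have h1 : Q ⊓ U = U.map (powMonoidHom p) := by
      apply le_antisymm
      · rintro y ⟨⟨hy1, hy2⟩, hy3⟩
        obtain ⟨c, hc⟩ := isPow_of_mem_locPow hp D.prim (fun v hv => (hout v hv).1) hcl hdis hsurj'
          hy3 (mem_locPows.mp hy2) hy1
        have hc0 : c ≠ 0 := by
          rintro rfl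
          rw [zero_pow hp.ne_zero] at hc
          exact y.ne_zero hc.symm
        refine ⟨Units.mk0 c hc0, fun v hv => ?_, Units.ext hc⟩
        have h2 : v.valuation K (y : K) = 1 := hy3 v hv
        rw [← hc, map_pow, pow_eq_one_iff_left hp.ne_zero] at h2
        exact h2
      · rintro _ ⟨x, hx, rfl⟩
        exact ⟨⟨pow_mem_totPos hp D.prim x, mem_locPows.mpr fun v _ => pow_mem_locPow p v x⟩,
          pow_mem hx p⟩
    rw [← Subgroup.inf_relIndex_right, h1, hU,
      sUnit_relIndex_pow _ (Finset.finite_toSet _) p D.prim, Set.ncard_coe_finset,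
      Finset.card_union_of_disjoint hdis, hTcard]
    congr 1
    omega
  have hUQ : (U ⊔ Q).index ≤ p := by
    have h1 := Subgroup.relIndex_mul_index (le_sup_right : Q ≤ U ⊔ Q)
    rw [Subgroup.relIndex_sup_right, hQU] at h1
    rw [← h1] at hQ
    have h2 : p ^ (2 * (S.card + Fintype.card (InfinitePlace K))) =
        p ^ (2 * (S.card + Fintype.card (InfinitePlace K)) - 1) * p := by
      rw [← pow_succ]
      congr 1
      omega
    rw [h2] at hQ
    exact Nat.le_of_mul_le_mul_left hQ (pow_pos hp.pos _)
  have hQW : Q ≤ W := le_iInf₂ fun v hv x hx =>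
    (le_sup_left : locPow p v ≤ N v) (mem_locPows.mp hx.2 v (hns v hv).1)
  have hUQ0 : (U ⊔ Q).index ≠ 0 := fun h => hQ0 (Subgroup.index_eq_zero_of_ge le_sup_right h)
  have hUW : (U ⊔ W).index ≤ p := (Nat.le_of_dvd (Nat.pos_of_ne_zero hUQ0)
    (Subgroup.index_dvd_of_le (sup_le_sup_left hQW U))).trans hUQ
  have hWU : NU.relIndex U ≤ W.relIndex U := by
    have h1 := Subgroup.relIndex_mul_index (le_sup_right : W ≤ U ⊔ W)
    rw [Subgroup.relIndex_sup_right] at h1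
    rw [← h1, ← hherb] at hlow
    exact Nat.le_of_mul_le_mul_right (hlow.trans (Nat.mul_le_mul_left _ hUW)) hp.pos
  have hNUW : NU ≤ W ⊓ U := le_inf
    (le_iInf₂ fun v _ => (Subgroup.map_le_range _ _).trans le_sup_right) hNUU
  have hfin : W ⊓ U ≤ NU := by
    have hpos : 0 < p ^ (nonsplit L p (S ∪ T)).card := pow_pos hp.pos _
    rw [← hherb] at hpos
    have h0 := Nat.pos_of_mul_pos_right hpos
    have h1 := Subgroup.relIndex_mul_relIndex NU (W ⊓ U) U hNUW inf_le_right
    rw [Subgroup.inf_relIndex_right] at h1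
    rw [← Subgroup.relIndex_eq_one]
    rw [← h1] at h0 hWU
    have h2 := Nat.pos_of_mul_pos_right h0
    have h3 := Nat.pos_of_mul_pos_left h0
    nlinarith
  have hbW : b ∈ W ⊓ U := by
    refine Subgroup.mem_inf.mpr ⟨?_, fun v hv => (hout v (hsub v hv)).2.2⟩
    rw [hW, Subgroup.mem_iInf]
    intro v
    rw [Subgroup.mem_iInf]
    exact fun hv => hb v (hns v hv).2.1 (hns v hv).2.2
  obtain ⟨y, -, hy⟩ := hfin hbW
  exact ⟨y, congrArg Units.val hy⟩

end KummerDatum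

end NormIndex

section SymbolAlgebras

open Polynomial

variable {K : Type*} [Field K]

/-- The symbol algebra `(a, b)` of degree `p` over `K` has a `p`-dimensional representation. -/
def SymbolSplit (p : ℕ) (ζ a b : K) : Prop :=
  ∃ A B : Module.End K (Fin p → K), A ^ p = algebraMap K _ a ∧ B ^ p = algebraMap K _ b ∧
    B * A = ζ • (A * B)

/-- The polynomial `h` represents an element of norm `n` in `K[T] / (T ^ p - a)`. -/
def IsNormPoly (p : ℕ) (ζ a : K) (h : K[X]) (n : K) : Prop :=
  (X ^ p - C a) ∣ ∏ i ∈ Finset.range p, h.comp (C (ζ ^ i) * X) - C n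

theorem SymbolSplit.of_end {p : ℕ} {ζ a b : K} (hp : 0 < p) {Z : Type*} [AddCommGroup Z]
    [Module K Z] (hZ : Module.finrank K Z = p) (A B : Module.End K Z)
    (hA : A ^ p = algebraMap K _ a) (hB : B ^ p = algebraMap K _ b) (hBA : B * A = ζ • (A * B)) :
    SymbolSplit p ζ a b := by
  have : FiniteDimensional K Z := Module.finite_of_finrank_pos (hZ ▸ hp)
  let e : Z ≃ₗ[K] (Fin p → K) := LinearEquiv.ofFinrankEq _ _ (by simp [hZ])
  let f := e.conjAlgEquiv K
  refine ⟨f A, f B, ?_, ?_, ?_⟩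
  · rw [← map_pow, hA, AlgEquiv.commutes]
  · rw [← map_pow, hB, AlgEquiv.commutes]
  · rw [← map_mul, hBA, map_smul, map_mul]

theorem SymbolSplit.swap {p : ℕ} {ζ a b : K} (ha : a ≠ 0) (hp : p ≠ 0)
    (h : SymbolSplit p ζ a b) : SymbolSplit p ζ b a⁻¹ := by
  obtain ⟨A, B, hA, hB, hBA⟩ := h
  have hu : IsUnit A := (isUnit_pow_iff hp).mp (hA ▸ (IsUnit.mk0 a ha).map (algebraMap K _))
  obtain ⟨u, rfl⟩ := hu
  refine ⟨B, ((u⁻¹ : (Module.End K (Fin p → K))ˣ) : Module.End K (Fin p → K)), hB, ?_, ?_⟩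
  · have h1 : (u : Module.End K (Fin p → K)) ^ p * algebraMap K _ a⁻¹ = 1 := by
      rw [hA, ← map_mul, mul_inv_cancel₀ ha, map_one]
    rw [← Units.val_pow_eq_pow_val, inv_pow]
    rw [← Units.val_pow_eq_pow_val] at h1
    exact (Units.inv_mul_eq_iff_eq_mul (u ^ p)).mpr h1.symm |>.symm ▸ by simp
  · rw [Units.inv_mul_eq_iff_eq_mul, mul_smul_comm, ← mul_assoc, ← smul_mul_assoc, ← hBA,
      mul_assoc, Units.mul_inv, mul_one]

theorem mul_aeval_eq_of_mul_eq {R : Type*} [Ring R] [Algebra K R] {A x y : R} (h : A * x = y * A)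
    (q : K[X]) : A * aeval x q = aeval y q * A := by
  induction q using Polynomial.induction_on' with
  | add f g hf hg => rw [map_add, map_add, mul_add, add_mul, hf, hg]
  | monomial n c =>
    rw [aeval_monomial, aeval_monomial, ← mul_assoc, ← Algebra.commutes, mul_assoc, mul_assoc]
    congr 1
    exact (SemiconjBy.pow_right (show SemiconjBy A x y from h) n)

theorem prod_comp_twist (ζ : K) (h : K[X]) (k : ℕ) :
    (∏ i ∈ Finset.range k, h.comp (C (ζ ^ i) * X)).comp (C ζ * X) * h =
      ∏ i ∈ Finset.range (k + 1), h.comp (C (ζ ^ i) * X) := by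
  rw [Finset.prod_range_succ', prod_comp]
  congr 1
  · refine Finset.prod_congr rfl fun i _ => ?_
    rw [comp_assoc, mul_comp, C_comp, X_comp, ← mul_assoc, ← C_mul, pow_succ]
  · simp

theorem aeval_comp_twist {R : Type*} [Ring R] [Algebra K R] (c : K) (x : R) (q : K[X]) :
    aeval x (q.comp (C c * X)) = aeval (c • x) q := by
  rw [aeval_comp, map_mul, aeval_C, aeval_X, Algebra.smul_def]

theorem SymbolSplit.mul_norm {p : ℕ} {ζ a b n : K} {h : K[X]} (hs : SymbolSplit p ζ a b)
    (hn : IsNormPoly p ζ b h n) : SymbolSplit p ζ (a * n) b := by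
  obtain ⟨A, B, hA, hB, hBA⟩ := hs
  have hAB : A * (ζ • B) = B * A := by rw [hBA, mul_smul_comm]
  refine ⟨A * aeval B h, B, ?_, hB, ?_⟩
  · have key : ∀ k, (A * aeval B h) ^ k =
        A ^ k * aeval B (∏ i ∈ Finset.range k, h.comp (C (ζ ^ i) * X)) := by
      intro k
      induction k with
      | zero => simp
      | succ k ih =>
        rw [pow_succ, ih, ← prod_comp_twist, map_mul, aeval_comp_twist, pow_succ]
        simp only [mul_assoc]
        congr 1
        rw [← mul_assoc, ← mul_assoc, mul_aeval_eq_of_mul_eq hAB]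
    obtain ⟨q, hq⟩ := hn
    rw [key, sub_eq_iff_eq_add.mp hq, hA, map_add, map_mul, map_sub, map_pow, aeval_X, aeval_C, hB,
      sub_self, zero_mul, zero_add, aeval_C, ← map_mul]
  · have : Commute B (aeval B h) := by
      have := Commute.map (Commute.all (X : K[X]) h) (aeval B)
      rwa [aeval_X] at this
    rw [← mul_assoc, hBA, smul_mul_assoc, mul_assoc, this.eq, mul_assoc]

theorem SymbolSplit.exists_isNormPoly_of_irreducible {p : ℕ} {ζ a b : K} (hp : 0 < p)
    (hs : SymbolSplit p ζ a b) (hirr : Irreducible (X ^ p - C a)) :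
    ∃ h : K[X], IsNormPoly p ζ a h b := by
  obtain ⟨A, B, hA, hB, hBA⟩ := hs
  have : NeZero p := ⟨hp.ne'⟩
  set z : Fin p → K := Pi.single 0 1 with hz
  have hz0 : z ≠ 0 := by simp [hz]
  have hann : aeval A (X ^ p - C a) = 0 := by
    rw [map_sub, map_pow, aeval_X, aeval_C, hA, sub_self]
  have hdvd : ∀ q : K[X], aeval A q z = 0 → (X ^ p - C a) ∣ q := by
    intro q hq
    refine (EuclideanDomain.dvd_or_coprime _ q hirr).resolve_right fun ⟨u, w, h⟩ => hz0 ?_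
    have := congrArg (fun r => aeval A r z) h
    simp only [map_add, map_mul, map_one, hann, mul_zero, zero_add, Module.End.mul_apply, hq,
      map_zero, Module.End.one_apply] at this
    exact this.symm
  let ψ : degreeLT K p →ₗ[K] (Fin p → K) :=
    (LinearMap.applyₗ z).comp ((aeval A).toLinearMap.comp (degreeLT K p).subtype)
  have hψ : Function.Injective ψ := by
    rw [← LinearMap.ker_eq_bot, LinearMap.ker_eq_bot']
    intro q hq
    have h1 := hdvd q hq
    have h2 := mem_degreeLT.mp q.2
    apply Subtype.ext
    refine eq_zero_of_dvd_of_degree_lt h1 ?_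
    rwa [degree_X_pow_sub_C hp]
  have hψs : Function.Surjective ψ := by
    have hf : FiniteDimensional K (degreeLT K p) := (degreeLTEquiv K p).symm.finiteDimensional
    exact (LinearMap.injective_iff_surjective_of_finrank_eq_finrank
      (LinearEquiv.finrank_eq (degreeLTEquiv K p))).mp hψ
  obtain ⟨h, hh⟩ := hψs (B z)
  have hh' : aeval A (h : K[X]) z = B z := hh
  refine ⟨h, hdvd _ ?_⟩
  have hBA' : B * A = (ζ • A) * B := by rw [hBA, smul_mul_assoc]
  have key : ∀ k, (B ^ k) z =
      aeval A (∏ i ∈ Finset.range k, (h : K[X]).comp (C (ζ ^ i) * X)) z := by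
    intro k
    induction k with
    | zero => simp
    | succ k ih =>
      rw [pow_succ', Module.End.mul_apply, ih, ← prod_comp_twist, map_mul, aeval_comp_twist,
        ← Module.End.mul_apply, mul_aeval_eq_of_mul_eq hBA', Module.End.mul_apply,
        Module.End.mul_apply, hh']
  rw [map_sub, LinearMap.sub_apply, ← key, hB, aeval_C, sub_self]

theorem exists_isNormPoly_of_isPow {p : ℕ} (hp : p.Prime) {ζ : K} (hζ : IsPrimitiveRoot ζ p) {d : K}
    (hd : d ≠ 0) (n : K) : ∃ h : K[X], IsNormPoly p ζ (d ^ p) h n := by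
  classical
  have hinj : Set.InjOn (fun i => ζ ^ i * d) (Finset.range p : Set ℕ) := by
    intro i hi j hj h
    rw [Finset.mem_coe, Finset.mem_range] at hi hj
    exact hζ.pow_inj hi hj (mul_right_cancel₀ hd h)
  set h := Lagrange.interpolate (Finset.range p) (fun i => ζ ^ i * d)
    (fun i => if i = 0 then n else 1) with hh
  have heval : ∀ i < p, h.eval (ζ ^ i * d) = if i = 0 then n else 1 := fun i hi =>
    Lagrange.eval_interpolate_at_node _ hinj (Finset.mem_range.mpr hi)
  refine ⟨h, ?_⟩
  unfold IsNormPoly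
  rw [X_pow_sub_C_eq_prod hζ hp.pos rfl]
  refine Finset.prod_dvd_of_coprime (fun i hi j hj hij =>
    isCoprime_X_sub_C_of_isUnit_sub (sub_ne_zero.mpr fun h => hij (hinj hi hj h)).isUnit) ?_
  intro j hj
  rw [Finset.mem_range] at hj
  rw [dvd_iff_isRoot, IsRoot.def, eval_sub, eval_prod, eval_C, sub_eq_zero]
  have hterm : ∀ i, eval (ζ ^ j * d) (h.comp (C (ζ ^ i) * X)) =
      if (i + j) % p = 0 then n else 1 := by
    intro i
    rw [eval_comp, eval_mul, eval_C, eval_X, ← mul_assoc, ← pow_add,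
      ← heval _ (Nat.mod_lt _ hp.pos), ← pow_mod_orderOf ζ (i + j), ← hζ.eq_orderOf]
  rw [Finset.prod_congr rfl fun i _ => hterm i]
  obtain ⟨i₀, hi₀, h0, huniq⟩ : ∃ i₀ < p, (i₀ + j) % p = 0 ∧
      ∀ i < p, (i + j) % p = 0 → i = i₀ := by
    have hcase : ∀ i < p, (i + j) % p = 0 → i + j = 0 ∨ i + j = p := by
      intro i hi h
      obtain ⟨k, hk⟩ := Nat.dvd_of_mod_eq_zero h
      have hk2 : k < 2 := by
        by_contra hk2
        have := Nat.mul_le_mul_left p (not_lt.mp hk2)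
        omega
      interval_cases k <;> omega
    rcases Nat.eq_zero_or_pos j with rfl | hj0
    · exact ⟨0, hp.pos, by simp, fun i hi h => by have := hcase i hi h; omega⟩
    · refine ⟨p - j, by omega, ?_, fun i hi h => by have := hcase i hi h; omega⟩
      rw [Nat.sub_add_cancel hj.le, Nat.mod_self]
  rw [Finset.prod_eq_single i₀, if_pos h0]
  · intro i hi hne
    exact if_neg fun h => hne (huniq i (Finset.mem_range.mp hi) h)
  · intro h
    exact absurd (Finset.mem_range.mpr hi₀) h

theorem SymbolSplit.exists_isNormPoly_inv {p : ℕ} (hp : p.Prime) {ζ a b : K}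
    (hζ : IsPrimitiveRoot ζ p) (ha : a ≠ 0) (hb : b ≠ 0) (hs : SymbolSplit p ζ a b) :
    ∃ h : K[X], IsNormPoly p ζ b h a⁻¹ := by
  by_cases hpow : ∃ d, d ^ p = b
  · obtain ⟨d, rfl⟩ := hpow
    exact exists_isNormPoly_of_isPow hp hζ (by rintro rfl; simp [hp.ne_zero] at hb) _
  · push Not at hpow
    exact (hs.swap ha hp.ne_zero).exists_isNormPoly_of_irreducible hp.pos
      (X_pow_sub_C_irreducible_of_prime hp hpow)

theorem IsNormPoly.map {K' : Type*} [Field K'] (f : K →+* K') {p : ℕ} {ζ a n : K} {h : K[X]}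
    (hn : IsNormPoly p ζ a h n) : IsNormPoly p (f ζ) (f a) (h.map f) (f n) := by
  have := map_dvd (mapRingHom f) hn
  simpa [IsNormPoly, Polynomial.map_prod, map_comp] using this

end SymbolAlgebras

section KummerSymbols

open Polynomial

namespace KummerDatum

variable {K L : Type*} [Field K] [Field L] [Algebra K L] {p : ℕ} {ζ a : K} {α : L}
  {σ : L ≃ₐ[K] L} (D : KummerDatum p ζ a α σ)
include D

theorem aeval_prod_comp_twist (h : K[X]) (n : K) :
    aeval α (∏ i ∈ Finset.range p, h.comp (C (ζ ^ i) * X) - C n) =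
      algebraMap K L (Algebra.norm K (aeval α h)) - algebraMap K L n := by
  rw [map_sub, aeval_C, D.algebraMap_norm, map_prod]
  congr 1
  refine Finset.prod_congr rfl fun i _ => ?_
  have : ζ ^ i • α = (σ ^ i) α := by rw [D.pow_apply_root, Algebra.smul_def, map_pow]
  rw [aeval_comp_twist, this, aeval_algHom_apply (σ ^ i : L ≃ₐ[K] L)]

theorem norm_aeval_of_isNormPoly {h : K[X]} {n : K} (hn : IsNormPoly p ζ a h n) :
    Algebra.norm K (aeval α h) = n := by
  obtain ⟨q, hq⟩ := hn
  have h1 := D.aeval_prod_comp_twist h n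
  rw [hq, map_mul, map_sub, map_pow, aeval_X, aeval_C, D.pow_eq, sub_self, zero_mul, eq_comm,
    sub_eq_zero] at h1
  exact (algebraMap K L).injective h1

theorem irreducible : Irreducible (X ^ p - C a) :=
  X_pow_sub_C_irreducible_of_prime D.prime D.not_isPow

theorem minpoly_root : minpoly K α = X ^ p - C a := by
  refine (minpoly.eq_of_irreducible_of_monic D.irreducible ?_
    (monic_X_pow_sub_C a D.prime.ne_zero)).symm
  rw [map_sub, map_pow, aeval_X, aeval_C, D.pow_eq, sub_self]

theorem exists_aeval_eq (y : L) : ∃ h : K[X], aeval α h = y := by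
  have := D.finiteDimensional
  have htop : IntermediateField.adjoin K {α} = ⊤ := by
    refine IntermediateField.eq_of_le_of_finrank_eq le_top ?_
    rw [IntermediateField.adjoin.finrank (Algebra.IsIntegral.isIntegral α), D.minpoly_root,
      natDegree_X_pow_sub_C, IntermediateField.finrank_top', D.finrank_eq]
  have hy : y ∈ IntermediateField.adjoin K {α} := htop ▸ IntermediateField.mem_top
  rw [← IntermediateField.mem_toSubalgebra,
    IntermediateField.adjoin_simple_toSubalgebra_of_isAlgebraic
    (Algebra.IsAlgebraic.isAlgebraic α), Algebra.adjoin_singleton_eq_range_aeval] at hy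
  exact hy

theorem isNormPoly_norm (h : K[X]) : IsNormPoly p ζ a h (Algebra.norm K (aeval α h)) := by
  unfold IsNormPoly
  rw [← D.minpoly_root, minpoly.dvd_iff, D.aeval_prod_comp_twist, sub_self]

theorem exists_isNormPoly (y : L) : ∃ h : K[X], IsNormPoly p ζ a h (Algebra.norm K y) := by
  obtain ⟨h, rfl⟩ := D.exists_aeval_eq y
  exact ⟨h, D.isNormPoly_norm h⟩

theorem symbolSplit_norm (y : L) : SymbolSplit p ζ a (Algebra.norm K y) := by
  refine SymbolSplit.of_end D.prime.pos D.finrank_eq (Algebra.lmul K L α)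
    (Algebra.lmul K L y * σ.toLinearMap) ?_ ?_ ?_
  · rw [← map_pow, D.pow_eq, AlgHom.commutes]
  · have key : ∀ k x, ((Algebra.lmul K L y * σ.toLinearMap) ^ k) x =
        (∏ i ∈ Finset.range k, (σ ^ i) y) * (σ ^ k) x := by
      intro k
      induction k with
      | zero => simp
      | succ k ih =>
        intro x
        rw [pow_succ, Module.End.mul_apply, ih, Finset.prod_range_succ, mul_assoc]
        congr 1
        simp [pow_succ, AlgEquiv.mul_apply]
    ext x
    rw [key, ← D.algebraMap_norm, D.pow_eq_one, AlgEquiv.one_apply, Module.algebraMap_end_apply,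
      Algebra.smul_def]
  · ext x
    simp only [Module.End.mul_apply, LinearMap.smul_apply, Algebra.coe_lmul_eq_mul,
      LinearMap.mul_apply', AlgEquiv.toLinearMap_apply, map_mul, D.gal]
    simp only [Algebra.smul_def]
    ring

theorem symbolSplit_pow {d : K} : SymbolSplit p ζ (d ^ p) a := by
  have hs : (σ⁻¹ : L ≃ₐ[K] L) ^ p = 1 := by rw [inv_pow, D.pow_eq_one, inv_one]
  have hgal : α = algebraMap K L ζ * (σ⁻¹ : L ≃ₐ[K] L) α := by
    have := congrArg (σ⁻¹ : L ≃ₐ[K] L) D.gal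
    rwa [map_mul, AlgEquiv.commutes, ← AlgEquiv.mul_apply, inv_mul_cancel, AlgEquiv.one_apply]
      at this
  refine SymbolSplit.of_end D.prime.pos D.finrank_eq (d • (σ⁻¹ : L ≃ₐ[K] L).toLinearMap)
    (Algebra.lmul K L α) ?_ ?_ ?_
  · have key : ∀ k, ((σ⁻¹ : L ≃ₐ[K] L).toLinearMap : Module.End K L) ^ k =
        ((σ⁻¹ : L ≃ₐ[K] L) ^ k).toLinearMap := by
      intro k
      induction k with
      | zero => rfl
      | succ k ih => rw [pow_succ, ih, pow_succ]; rfl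
    rw [_root_.smul_pow, key, hs, Algebra.algebraMap_eq_smul_one]
    rfl
  · rw [← map_pow, D.pow_eq, AlgHom.commutes]
  · ext x
    simp only [Module.End.mul_apply, LinearMap.smul_apply, Algebra.coe_lmul_eq_mul,
      LinearMap.mul_apply', AlgEquiv.toLinearMap_apply, map_mul]
    simp only [Algebra.smul_def]
    nth_rewrite 1 [hgal]
    ring

end KummerDatum

end KummerSymbols

section MatrixRepresentations

open scoped TensorProduct

/-- The `F`-algebra `X` has an `N`-dimensional representation over the field `E`, viewed as an
extension of `F` via `f`. -/
def HasMatrixRep {F : Type*} [Field F] (X : Type*) [Ring X] [Algebra F X] {E : Type*} [Field E]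
    (f : F →+* E) (N : ℕ) : Prop :=
  ∃ ρ : X →+* Matrix (Fin N) (Fin N) E, ∀ c, ρ (algebraMap F X c) = algebraMap E _ (f c)

variable {F : Type*} [Field F] {X : Type*} [Ring X] [Algebra F X]

theorem HasMatrixRep.comp {E E' : Type*} [Field E] [Field E'] {f : F →+* E} {N : ℕ}
    (h : HasMatrixRep X f N) (g : E →+* E') : HasMatrixRep X (g.comp f) N := by
  obtain ⟨ρ, hρ⟩ := h
  refine ⟨g.mapMatrix.comp ρ, fun c => ?_⟩
  rw [RingHom.comp_apply, hρ, RingHom.mapMatrix_apply, Matrix.algebraMap_eq_diagonal,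
    Matrix.algebraMap_eq_diagonal, Matrix.diagonal_map (map_zero g)]
  rfl

theorem HasMatrixRep.of_end {E : Type*} [Field E] {f : F →+* E} {N : ℕ} (hN : 0 < N) {V : Type*}
    [AddCommGroup V] [Module E V] (hV : Module.finrank E V = N) (r : X →+* Module.End E V)
    (hr : ∀ c, r (algebraMap F X c) = algebraMap E _ (f c)) : HasMatrixRep X f N := by
  have : FiniteDimensional E V := Module.finite_of_finrank_pos (hV ▸ hN)
  let b : Module.Basis (Fin N) E V := Module.finBasisOfFinrankEq E V hV
  refine ⟨((LinearMap.toMatrixAlgEquiv b : Module.End E V ≃ₐ[E] _) : _ →+* _).comp r, fun c => ?_⟩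
  rw [RingHom.comp_apply, hr]
  exact (LinearMap.toMatrixAlgEquiv b).commutes _

variable [Algebra.IsCentral F X] [IsSimpleRing X]

theorem eq_zero_of_sum_mul_eq_zero {R : Type*} [Ring R] [Nontrivial R] [Algebra F R]
    (ρ : X →ₐ[F] R) {ι : Type*} (e : ι → R) (he : LinearIndependent F e)
    (hc : ∀ i x, Commute (e i) (ρ x)) (s : Finset ι) :
    ∀ x : ι → X, ∑ i ∈ s, e i * ρ (x i) = 0 → ∀ i ∈ s, x i = 0 := by
  classical
  induction s using Finset.induction_on with
  | empty => simp
  | insert j s hj ih =>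
    intro x hx
    suffices h0 : x j = 0 by
      have h1 := ih x (by rwa [Finset.sum_insert hj, h0, map_zero, mul_zero, zero_add] at hx)
      intro i hi
      rcases Finset.mem_insert.mp hi with rfl | hi
      exacts [h0, h1 i hi]
    by_contra h0
    let I : TwoSidedIdeal X := TwoSidedIdeal.mk'
      {w | ∃ y : ι → X, y j = w ∧ ∑ i ∈ insert j s, e i * ρ (y i) = 0}
      ⟨0, by simp⟩
      (by
        rintro _ _ ⟨y, rfl, hy⟩ ⟨z, rfl, hz⟩
        refine ⟨y + z, rfl, ?_⟩
        simp only [Pi.add_apply, map_add, mul_add, Finset.sum_add_distrib, hy, hz, add_zero])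
      (by
        rintro _ ⟨y, rfl, hy⟩
        refine ⟨-y, rfl, ?_⟩
        simp only [Pi.neg_apply, map_neg, mul_neg, Finset.sum_neg_distrib, hy, neg_zero])
      (by
        rintro w _ ⟨y, rfl, hy⟩
        refine ⟨fun i => w * y i, rfl, ?_⟩
        rw [← mul_zero (ρ w), ← hy, Finset.mul_sum]
        refine Finset.sum_congr rfl fun i _ => ?_
        rw [map_mul, ← mul_assoc, (hc i w).eq, mul_assoc])
      (by
        rintro _ w ⟨y, rfl, hy⟩
        refine ⟨fun i => y i * w, rfl, ?_⟩
        rw [← zero_mul (ρ w), ← hy, Finset.sum_mul]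
        refine Finset.sum_congr rfl fun i _ => ?_
        rw [map_mul, ← mul_assoc])
    have h1 : (1 : X) ∈ I := IsSimpleRing.one_mem_of_ne_zero_mem I h0
      ((TwoSidedIdeal.mem_mk' _ _ _ _ _ _ _).mpr ⟨x, rfl, hx⟩)
    obtain ⟨y, hy1, hy⟩ := (TwoSidedIdeal.mem_mk' _ _ _ _ _ _ _).mp h1
    have hcomm : ∀ i ∈ s, ∀ w, w * y i - y i * w = 0 := by
      intro i hi w
      refine ih (fun i => w * y i - y i * w) ?_ i hi
      have h2 : ∑ i ∈ insert j s, e i * ρ (w * y i - y i * w) =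
          ρ w * ∑ i ∈ insert j s, e i * ρ (y i) - (∑ i ∈ insert j s, e i * ρ (y i)) * ρ w := by
        rw [Finset.mul_sum, Finset.sum_mul, ← Finset.sum_sub_distrib]
        refine Finset.sum_congr rfl fun i _ => ?_
        rw [map_sub, map_mul, map_mul, mul_sub, ← mul_assoc, (hc i w).eq, mul_assoc, mul_assoc]
      rwa [hy, mul_zero, zero_mul, sub_zero, Finset.sum_insert hj, hy1, mul_one, one_mul, sub_self,
        map_zero, mul_zero, zero_add] at h2
    have hcen : ∀ i ∈ insert j s, ∃ c : F, y i = algebraMap F X c := by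
      intro i hi
      rw [← Algebra.IsCentral.mem_center_iff F, Subalgebra.mem_center_iff]
      rcases Finset.mem_insert.mp hi with rfl | hi
      · simp [hy1]
      · exact fun w => sub_eq_zero.mp (hcomm i hi w)
    choose! c hc' using hcen
    have h3 : ∑ i ∈ insert j s, c i • e i = 0 := by
      rw [← hy]
      refine Finset.sum_congr rfl fun i hi => ?_
      rw [hc' i hi, AlgHom.commutes, Algebra.smul_def, Algebra.commutes]
    have h4 := linearIndependent_iff'.mp he _ c h3 j (Finset.mem_insert_self j s)
    have h5 := hc' j (Finset.mem_insert_self j s)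
    rw [hy1, h4, map_zero] at h5
    exact one_ne_zero h5

variable [FiniteDimensional F X]

theorem exists_matrix_algHom_extending {E : Type*} [Field E] {f : F →+* E} {N : ℕ} (hN0 : 0 < N)
    (hN : N ^ 2 = Module.finrank F X) (ρ : X →+* Matrix (Fin N) (Fin N) E)
    (hρ : ∀ c, ρ (algebraMap F X c) = algebraMap E _ (f c)) {R : Type*} [Ring R] [Algebra E R]
    (r : X →+* R) (hr : ∀ c, r (algebraMap F X c) = algebraMap E R (f c)) :
    ∃ Θ : Matrix (Fin N) (Fin N) E →ₐ[E] R, (∀ x, Θ (ρ x) = r x) ∧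
      ∀ z, (∀ x, Commute z (r x)) → ∀ M, (∀ c : E, Commute z (algebraMap E R c)) →
        Commute z (Θ M) := by
  classical
  have : Nonempty (Fin N) := ⟨⟨0, hN0⟩⟩
  let _ : Algebra F E := f.toAlgebra
  let M := Matrix (Fin N) (Fin N) E
  let _ : Algebra F R := ((algebraMap E R).comp f).toAlgebra' fun c x => Algebra.commutes _ _
  have : IsScalarTower F E R := IsScalarTower.of_algebraMap_eq fun _ => rfl
  let ρ' : X →ₐ[F] M := { ρ with commutes' := fun c => hρ c }
  let r' : X →ₐ[F] R := { r with commutes' := fun c => hr c }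
  let Φ : E ⊗[F] X →ₐ[E] M := Algebra.TensorProduct.lift (Algebra.ofId E M) ρ'
    fun x y => Algebra.commutes x _
  let Ψ : E ⊗[F] X →ₐ[E] R := Algebra.TensorProduct.lift (Algebra.ofId E R) r'
    fun x y => Algebra.commutes x _
  have hΦ : ∀ c x, Φ (c ⊗ₜ x) = algebraMap E M c * ρ x := fun c x =>
    Algebra.TensorProduct.lift_tmul _ _ _ c x
  have hΨ : ∀ c x, Ψ (c ⊗ₜ x) = algebraMap E R c * r x := fun c x =>
    Algebra.TensorProduct.lift_tmul _ _ _ c x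
  have hinj : Function.Injective Φ := by
    rw [injective_iff_map_eq_zero]
    intro z hz
    let b := Module.Basis.ofVectorSpace F E
    obtain ⟨w, rfl⟩ := (TensorProduct.equivFinsuppOfBasisLeft b).symm.surjective z
    rw [TensorProduct.equivFinsuppOfBasisLeft_symm_apply, Finsupp.sum, map_sum] at hz
    have he : LinearIndependent F fun i => algebraMap E M (b i) := by
      have := b.linearIndependent.map' (Algebra.algHom F E M).toLinearMap
        (LinearMap.ker_eq_bot.mpr (algebraMap E M).injective)
      exact this
    have h0 := eq_zero_of_sum_mul_eq_zero ρ' _ he (fun i x => Algebra.commutes _ _) w.support w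
      (by rw [← hz]; exact Finset.sum_congr rfl fun i _ => (hΦ _ _).symm)
    have : w = 0 := by
      ext i
      by_cases hi : i ∈ w.support
      · exact h0 i hi
      · simpa using hi
    rw [this, map_zero]
  have hbij : Function.Bijective Φ := by
    refine ⟨hinj, ?_⟩
    have : FiniteDimensional E (E ⊗[F] X) := inferInstance
    refine (LinearMap.injective_iff_surjective_of_finrank_eq_finrank (f := Φ.toLinearMap) ?_).mp
      hinj
    rw [Module.finrank_baseChange, ← hN, Module.finrank_matrix]
    simp [sq]
  let e := AlgEquiv.ofBijective Φ hbij
  refine ⟨Ψ.comp e.symm.toAlgHom, fun x => ?_, fun z hz M hzc => ?_⟩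
  · have h1 : ρ x = e (1 ⊗ₜ x) := by
      rw [AlgEquiv.ofBijective_apply, hΦ, map_one, one_mul]
    have h2 : (Ψ.comp e.symm.toAlgHom) (e (1 ⊗ₜ x)) = Ψ (1 ⊗ₜ x) := by simp
    rw [h1, h2, hΨ, map_one, one_mul]
  · obtain ⟨t, rfl⟩ := e.surjective M
    have : ∀ t, (Ψ.comp e.symm.toAlgHom) (e t) = Ψ t := by simp
    induction t using TensorProduct.induction_on with
    | zero => simp
    | tmul c x =>
      rw [this, hΨ]
      exact (hzc c).mul_right (hz x)
    | add s t hs ht => rw [map_add]; rw [map_add]; exact hs.add_right ht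

theorem exists_conj_of_matrix_reps {E : Type*} [Field E] {f : F →+* E} {N : ℕ} (hN0 : 0 < N)
    (hN : N ^ 2 = Module.finrank F X) (ρ r : X →+* Matrix (Fin N) (Fin N) E)
    (hρ : ∀ c, ρ (algebraMap F X c) = algebraMap E _ (f c))
    (hr : ∀ c, r (algebraMap F X c) = algebraMap E _ (f c)) :
    ∃ T : (Fin N → E) ≃ₗ[E] (Fin N → E), ∀ x v, T ((ρ x).mulVec v) = (r x).mulVec (T v) := by
  have : Nonempty (Fin N) := ⟨⟨0, hN0⟩⟩
  obtain ⟨Θ, hΘ, -⟩ := exists_matrix_algHom_extending hN0 hN ρ hρ r hr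
  let e := AlgEquiv.ofBijective Θ Θ.bijective
  let m : Matrix (Fin N) (Fin N) E ≃ₐ[E] Module.End E (Fin N → E) := Matrix.toLinAlgEquiv'
  obtain ⟨T, hT⟩ := ((m.symm.trans e).trans m).eq_linearEquivConjAlgEquiv
  refine ⟨T, fun x v => ?_⟩
  have h1 := congrArg (fun g => g (m (ρ x)) (T v)) hT
  have h2 : e (ρ x) = r x := hΘ x
  simp only [AlgEquiv.trans_apply, AlgEquiv.symm_apply_apply, h2, LinearEquiv.conjAlgEquiv_apply,
    LinearMap.comp_apply, LinearEquiv.coe_coe, LinearEquiv.symm_apply_apply] at h1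
  exact h1.symm

end MatrixRepresentations

section KummerRepresentations

open scoped TensorProduct

variable {F : Type*} [Field F] {X : Type*} [Ring X] [Algebra F X] [Algebra.IsCentral F X]
  [IsSimpleRing X] [FiniteDimensional F X]
variable {K L : Type*} [Field K] [Field L] [Algebra K L] {p : ℕ} {ζ a : K} {α : L}
  {σ : L ≃ₐ[K] L}

theorem KummerDatum.exists_semilinear (D : KummerDatum p ζ a α σ) {f : F →+* K} {N : ℕ}
    (hN0 : 0 < N) (hN : N ^ 2 = Module.finrank F X)
    (h : HasMatrixRep X ((algebraMap K L).comp f) N) :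
    ∃ (r : X →+* Module.End K (Fin N → L)) (φ : Module.End K (Fin N → L)) (b : K), b ≠ 0 ∧
      (∀ c, r (algebraMap F X c) = algebraMap K _ (f c)) ∧
      (∀ x (l : L) v, r x (l • v) = l • r x v) ∧ (∀ x, Commute φ (r x)) ∧
      (∀ (l : L) v, φ (l • v) = σ l • φ v) ∧ φ ^ p = algebraMap K _ b := by
  obtain ⟨ρ, hρ⟩ := h
  have : Nonempty (Fin N) := ⟨⟨0, hN0⟩⟩
  let ρσ : X →+* Matrix (Fin N) (Fin N) L := (σ : L →+* L).mapMatrix.comp ρ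
  have hρσ : ∀ c, ρσ (algebraMap F X c) = algebraMap L _ (((algebraMap K L).comp f) c) := by
    intro c
    change (σ : L →+* L).mapMatrix (ρ _) = _
    rw [hρ, RingHom.mapMatrix_apply, Matrix.algebraMap_eq_diagonal, Matrix.diagonal_map
      (map_zero _)]
    congr 1
    ext i
    simp
  obtain ⟨T, hT⟩ := exists_conj_of_matrix_reps hN0 hN ρσ ρ hρσ hρ
  let r : X →+* Module.End K (Fin N → L) :=
    { toFun := fun x => (Matrix.mulVecLin (ρ x)).restrictScalars K
      map_one' := by ext; simp
      map_mul' := fun x y => by ext; simp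
      map_zero' := by ext; simp
      map_add' := fun x y => by ext; simp }
  have hr : ∀ x v, r x v = (ρ x).mulVec v := fun _ _ => rfl
  let φ : Module.End K (Fin N → L) :=
    (T : (Fin N → L) →ₗ[L] (Fin N → L)).restrictScalars K ∘ₗ σ.toLinearMap.compLeft (Fin N)
  have hφ : ∀ v, φ v = T (σ ∘ v) := fun _ => rfl
  have hsemi : ∀ (l : L) v, φ (l • v) = σ l • φ v := by
    intro l v
    rw [hφ, hφ, ← map_smul]
    congr 1
    ext i
    simp
  have hcomm : ∀ x, Commute φ (r x) := by
    intro x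
    refine LinearMap.ext fun v => ?_
    rw [Module.End.mul_apply, Module.End.mul_apply, hr, hr, hφ, hφ, ← hT]
    congr 1
    ext i
    exact RingHom.map_mulVec (σ : L →+* L) (ρ x) v i
  have hinj : Function.Injective φ := by
    intro v w hvw
    have := T.injective hvw
    ext i
    exact σ.injective (congrFun this i)
  have hpow : ∀ (k : ℕ) (l : L) v, (φ ^ k) (l • v) = (σ ^ k) l • (φ ^ k) v := by
    intro k
    induction k with
    | zero => simp
    | succ k ih =>
      intro l v
      rw [pow_succ', Module.End.mul_apply, ih, hsemi, pow_succ', Module.End.mul_apply]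
      rfl
  let χ : Module.End L (Fin N → L) :=
    { toFun := fun v => (φ ^ p) v
      map_add' := fun v w => map_add _ v w
      map_smul' := fun l v => by rw [hpow, D.pow_eq_one]; rfl }
  let m : Matrix (Fin N) (Fin N) L ≃ₐ[L] Module.End L (Fin N → L) := Matrix.toLinAlgEquiv'
  obtain ⟨Θ, -, hΘ⟩ := exists_matrix_algHom_extending hN0 hN ρ hρ ρ hρ
  have hcen : m.symm χ ∈ Subalgebra.center L (Matrix (Fin N) (Fin N) L) := by
    rw [Subalgebra.mem_center_iff]
    intro M
    obtain ⟨M, rfl⟩ := Θ.bijective.2 M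
    refine (hΘ _ (fun x => ?_) M fun c => (Algebra.commutes _ _).symm).eq.symm
    refine m.injective ?_
    rw [map_mul, map_mul, m.apply_symm_apply]
    refine LinearMap.ext fun v => ?_
    exact congrArg (fun g => g v) ((hcomm x).pow_left p).eq
  obtain ⟨β, hβ⟩ := (Algebra.IsCentral.mem_center_iff L).mp hcen
  have hβ' : ∀ v, (φ ^ p) v = β • v := by
    intro v
    have h1 : χ = algebraMap L _ β := by
      rw [← m.apply_symm_apply χ, hβ, AlgEquiv.commutes]
    exact congrArg (fun g => g v) h1
  let v₀ : Fin N → L := fun _ => 1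
  have hv₀ : v₀ ≠ 0 := fun h => one_ne_zero (congrFun h ⟨0, hN0⟩)
  have hφv : φ v₀ ≠ 0 := fun h => hv₀ (hinj (h.trans (map_zero φ).symm))
  have hfix : σ β = β := by
    have h1 : φ ((φ ^ p) v₀) = (φ ^ p) (φ v₀) := by
      rw [← Module.End.mul_apply, ← Module.End.mul_apply, ← pow_succ', pow_succ]
    rw [hβ', hβ', hsemi, ← sub_eq_zero, ← sub_smul, smul_eq_zero] at h1
    exact sub_eq_zero.mp (h1.resolve_right hφv)
  obtain ⟨b, hb⟩ := D.exists_algebraMap_eq hfix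
  refine ⟨r, φ, b, ?_, ?_, ?_, hcomm, hsemi, ?_⟩
  · rintro rfl
    rw [map_zero] at hb
    have h1 := hβ' v₀
    rw [← hb, zero_smul] at h1
    refine hv₀ ((hinj.iterate p) ?_)
    rw [← Module.End.pow_apply, ← Module.End.pow_apply, h1, map_zero]
  · intro c
    refine LinearMap.ext fun v => ?_
    rw [hr, hρ, Module.algebraMap_end_apply, Algebra.algebraMap_eq_smul_one, Matrix.smul_mulVec,
      Matrix.one_mulVec, RingHom.comp_apply, algebraMap_smul]
  · intro x l v
    rw [hr, hr, Matrix.mulVec_smul]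
  · refine LinearMap.ext fun v => ?_
    rw [hβ', Module.algebraMap_end_apply, ← hb, algebraMap_smul]

theorem symbolSplit_of_commute [CharZero K] {f : F →+* K} {N : ℕ} (hN0 : 0 < N)
    (hN : N ^ 2 = Module.finrank F X) (hp : 0 < p) (h : HasMatrixRep X f N) {Y : Type*}
    [AddCommGroup Y] [Module K Y] (hY : Module.finrank K Y = N * p) (r : X →+* Module.End K Y)
    (hr : ∀ c, r (algebraMap F X c) = algebraMap K _ (f c)) {b : K} (A B : Module.End K Y)
    (hrA : ∀ x, Commute A (r x)) (hrB : ∀ x, Commute B (r x)) (hA : A ^ p = algebraMap K _ a)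
    (hB : B ^ p = algebraMap K _ b) (hBA : B * A = ζ • (A * B)) : SymbolSplit p ζ a b := by
  classical
  obtain ⟨ρ, hρ⟩ := h
  have : FiniteDimensional K Y := Module.finite_of_finrank_pos (by rw [hY]; positivity)
  obtain ⟨Θ, -, hΘ⟩ := exists_matrix_algHom_extending hN0 hN ρ hρ r hr
  let i₀ : Fin N := ⟨0, hN0⟩
  let ε : Fin N → Fin N → Module.End K Y := fun i j => Θ (Matrix.single i j 1)
  have hε : ∀ i j k, ε i j * ε j k = ε i k := by
    intro i j k
    rw [← map_mul, Matrix.single_mul_single_same, one_mul]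
  have hsum : ∑ i, ε i i = 1 := by
    rw [← map_sum, Matrix.sum_single_one, map_one]
  let Z := LinearMap.range (ε i₀ i₀)
  have hidem : IsIdempotentElem (ε i₀ i₀) := hε _ _ _
  have hZ : Module.finrank K Z = p := by
    have h1 : LinearMap.trace K _ (ε i₀ i₀) = (Module.finrank K Z : K) :=
      (LinearMap.IsIdempotentElem.isProj_range _ hidem).trace
    have h2 : ∀ i, LinearMap.trace K _ (ε i i) = (Module.finrank K Z : K) := by
      intro i
      rw [← h1, ← hε i i₀ i, LinearMap.trace_mul_comm, hε]
    have h3 : LinearMap.trace K Y 1 = ((N * p : ℕ) : K) := by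
      rw [LinearMap.trace_one, hY]
    rw [← hsum, map_sum, Finset.sum_congr rfl fun i _ => h2 i] at h3
    simp only [Finset.sum_const, Finset.card_univ, Fintype.card_fin, nsmul_eq_mul] at h3
    exact Nat.eq_of_mul_eq_mul_left hN0 (by exact_mod_cast h3)
  have hmem : ∀ C : Module.End K Y, (∀ x, Commute C (r x)) → ∀ z ∈ Z, C z ∈ Z := by
    rintro C hC _ ⟨w, rfl⟩
    have h1 : Commute C (ε i₀ i₀) := hΘ _ hC _ fun c => (Algebra.commutes _ _).symm
    exact ⟨C w, (congrArg (fun t => t w) h1.eq).symm⟩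
  have hpow : ∀ (C : Module.End K Y) (hC : ∀ x, Commute C (r x)) (c : K),
      C ^ p = algebraMap K _ c → (LinearMap.restrict C (hmem C hC)) ^ p =
        algebraMap K (Module.End K Z) c := by
    intro C hC c h1
    refine LinearMap.ext fun z => Subtype.ext ?_
    rw [Module.End.pow_restrict, LinearMap.coe_restrict_apply, h1]
    rfl
  refine SymbolSplit.of_end hp hZ (LinearMap.restrict A (hmem A hrA))
    (LinearMap.restrict B (hmem B hrB)) (hpow A hrA a hA) (hpow B hrB b hB) ?_
  refine LinearMap.ext fun z => Subtype.ext ?_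
  exact congrArg (fun t => t (z : Y)) hBA

theorem symbolSplit_map_of_commute {f : F →+* K} {N : ℕ} (hN0 : 0 < N)
    (hN : N ^ 2 = Module.finrank F X) (hp : 0 < p) {K' : Type*} [Field K'] [CharZero K']
    (g : K →+* K') (h : HasMatrixRep X (g.comp f) N) {Y : Type*} [AddCommGroup Y] [Module K Y]
    (hY : Module.finrank K Y = N * p) (r : X →+* Module.End K Y)
    (hr : ∀ c, r (algebraMap F X c) = algebraMap K _ (f c)) {b : K} (A B : Module.End K Y)
    (hrA : ∀ x, Commute A (r x)) (hrB : ∀ x, Commute B (r x)) (hA : A ^ p = algebraMap K _ a)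
    (hB : B ^ p = algebraMap K _ b) (hBA : B * A = ζ • (A * B)) :
    SymbolSplit p (g ζ) (g a) (g b) := by
  let _ : Algebra K K' := g.toAlgebra
  have hg : ∀ c, algebraMap K (Module.End K' (K' ⊗[K] Y)) c = algebraMap K' _ (g c) := fun c =>
    IsScalarTower.algebraMap_apply K K' _ c
  let u : Module.End K Y →ₐ[K] Module.End K' (K' ⊗[K] Y) := Module.End.baseChangeHom K K' Y
  refine symbolSplit_of_commute (Y := K' ⊗[K] Y) hN0 hN hp h
    (by rw [Module.finrank_baseChange, hY]) (u.toRingHom.comp r) (fun c => ?_) (u A) (u B)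
    (fun x => (hrA x).map u) (fun x => (hrB x).map u) ?_ ?_ ?_
  · change u (r _) = _
    rw [hr, AlgHom.commutes, hg, RingHom.comp_apply]
  · rw [← map_pow, hA, AlgHom.commutes, hg]
  · rw [← map_pow, hB, AlgHom.commutes, hg]
  · rw [← map_mul, hBA, map_smul, map_mul, ← algebraMap_smul K' ζ]
    rfl

theorem KummerDatum.hasMatrixRep_of_norm [CharZero K] (D : KummerDatum p ζ a α σ) {f : F →+* K}
    {N : ℕ} (hN0 : 0 < N) (r : X →+* Module.End K (Fin N → L))
    (φ : Module.End K (Fin N → L))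
    (hr : ∀ c, r (algebraMap F X c) = algebraMap K _ (f c))
    (hrl : ∀ x (l : L) v, r x (l • v) = l • r x v) (hcomm : ∀ x, Commute φ (r x))
    (hsemi : ∀ (l : L) v, φ (l • v) = σ l • φ v) (y : L) (hy0 : y ≠ 0)
    (hφ : φ ^ p = algebraMap K _ (Algebra.norm K y)) : HasMatrixRep X f N := by
  have := D.finiteDimensional
  have hp0 : (p : K) ≠ 0 := by exact_mod_cast D.prime.ne_zero
  have hL : Module.finrank K (Fin N → L) = N * p := by
    rw [Module.finrank_pi_fintype]
    simp [D.finrank_eq]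
  let P : Module.End K (Fin N → L) := Algebra.lsmul K K (Fin N → L) y⁻¹ * φ
  have hP : ∀ v, P v = y⁻¹ • φ v := fun _ => rfl
  have hPr : ∀ x, Commute P (r x) := by
    intro x
    refine LinearMap.ext fun v => ?_
    change P (r x v) = r x (P v)
    rw [hP, hP, hrl]
    congr 1
    exact congrArg (fun t => t v) (hcomm x).eq
  have hPk : ∀ k v, (P ^ k) v = (∏ i ∈ Finset.range k, (σ ^ i) y⁻¹) • (φ ^ k) v := by
    intro k
    induction k with
    | zero => simp
    | succ k ih =>
      intro v
      rw [pow_succ', Module.End.mul_apply, ih, hP, hsemi, smul_smul, pow_succ',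
        Module.End.mul_apply, Finset.prod_range_succ', map_prod, mul_comm]
      simp [pow_succ', AlgEquiv.mul_apply]
  have hPp : P ^ p = 1 := by
    refine LinearMap.ext fun v => ?_
    rw [hPk, hφ, ← D.algebraMap_norm, Module.algebraMap_end_apply, algebraMap_smul, smul_smul,
      ← map_mul, inv_mul_cancel₀ hy0, map_one, one_smul, Module.End.one_apply]
  let M : L → Module.End K (Fin N → L) := fun l => Algebra.lsmul K K (Fin N → L) l
  have hPM : ∀ k, P ^ k * M α = ζ ^ k • (M α * P ^ k) := by
    intro k
    have h1 : P * M α = ζ • (M α * P) := by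
      refine LinearMap.ext fun v => ?_
      change P (α • v) = ζ • α • P v
      rw [hP, hsemi, D.gal, hP, smul_smul, smul_smul, ← algebraMap_smul L ζ, smul_smul]
      congr 1
      ring
    induction k with
    | zero => simp
    | succ k ih =>
      rw [pow_succ, mul_assoc, h1, mul_smul_comm, ← mul_assoc, ih, smul_mul_assoc, smul_smul,
        mul_assoc, ← pow_succ']
  have hMM : M α * M α⁻¹ = 1 := by
    rw [← map_mul, mul_inv_cancel₀ D.root_ne_zero, map_one]
  have htr : ∀ k, 0 < k → k < p → LinearMap.trace K _ (P ^ k) = 0 := by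
    intro k hk0 hkp
    have h1 : LinearMap.trace K _ (P ^ k) = ζ ^ k * LinearMap.trace K _ (P ^ k) := by
      conv_lhs => rw [← mul_one (P ^ k), ← hMM, ← mul_assoc, hPM, smul_mul_assoc, map_smul,
        mul_assoc, LinearMap.trace_mul_comm, mul_assoc, ← map_mul, inv_mul_cancel₀ D.root_ne_zero,
        map_one, mul_one, smul_eq_mul]
    have h2 : (1 - ζ ^ k) * LinearMap.trace K _ (P ^ k) = 0 := by
      rw [sub_mul, one_mul, ← h1, sub_self]
    refine (mul_eq_zero.mp h2).resolve_left fun h3 => ?_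
    exact D.prim.pow_ne_one_of_pos_of_lt hk0.ne' hkp (sub_eq_zero.mp h3).symm
  let e : Module.End K (Fin N → L) := (p : K)⁻¹ • ∑ i ∈ Finset.range p, P ^ i
  let Y₀ : Submodule K (Fin N → L) := LinearMap.ker (P - 1)
  have hY₀ : ∀ v, v ∈ Y₀ ↔ P v = v := by
    intro v
    rw [LinearMap.mem_ker, LinearMap.sub_apply, Module.End.one_apply, sub_eq_zero]
  have hproj : LinearMap.IsProj Y₀ e := by
    refine ⟨fun v => ?_, fun v hv => ?_⟩
    · rw [hY₀, ← Module.End.mul_apply]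
      congr 1
      rw [mul_smul_comm, Finset.mul_sum]
      congr 1
      simp only [← pow_succ']
      rw [← add_left_inj (P ^ 0), ← Finset.sum_range_succ' (fun i => P ^ i), Finset.sum_range_succ,
        hPp, pow_zero]
    · have h1 : ∀ i, (P ^ i) v = v := by
        intro i
        induction i with
        | zero => rfl
        | succ i ih => rw [pow_succ, Module.End.mul_apply, (hY₀ v).mp hv, ih]
      simp only [e, LinearMap.smul_apply, LinearMap.sum_apply, h1, Finset.sum_const,
        Finset.card_range]
      rw [← Nat.cast_smul_eq_nsmul K, smul_smul, inv_mul_cancel₀ hp0, one_smul]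
  have hdim : Module.finrank K Y₀ = N := by
    have h1 := hproj.trace
    have h2 : LinearMap.trace K _ (∑ i ∈ Finset.range p, P ^ i) = (N * p : ℕ) := by
      rw [map_sum, Finset.sum_eq_single 0, pow_zero, LinearMap.trace_one, hL]
      · intro i hi hi0
        exact htr i (Nat.pos_of_ne_zero hi0) (Finset.mem_range.mp hi)
      · intro h
        exact absurd (Finset.mem_range.mpr D.prime.pos) h
    rw [map_smul, h2, smul_eq_mul, Nat.cast_mul, mul_comm, mul_assoc, mul_inv_cancel₀ hp0,
      mul_one] at h1
    exact_mod_cast h1.symm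
  have hmem : ∀ x, ∀ v ∈ Y₀, r x v ∈ Y₀ := by
    intro x v hv
    rw [hY₀] at hv ⊢
    rw [← Module.End.mul_apply, (hPr x).eq, Module.End.mul_apply, hv]
  let r₀ : X →+* Module.End K Y₀ :=
    { toFun := fun x => LinearMap.restrict (r x) (hmem x)
      map_one' := by ext; simp
      map_mul' := fun x y => by ext; simp
      map_zero' := by ext; simp
      map_add' := fun x y => by ext; simp }
  refine HasMatrixRep.of_end hN0 hdim r₀ fun c => ?_
  refine LinearMap.ext fun v => Subtype.ext ?_
  change r _ (v : Fin N → L) = _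
  rw [hr]
  rfl

end KummerRepresentations

section WeakApproximation

open NumberField IsDedekindDomain WithZero Filter Topology

variable {K : Type*} [Field K] [NumberField K]

theorem denseRange_real_embeddings : DenseRange (fun (x : K) (τ : K →+* ℝ) => τ x) := by
  let P : (K →+* ℝ) → InfinitePlace K := fun τ => InfinitePlace.mk (Complex.ofRealHom.comp τ)
  have hP : ∀ τ x, (P τ).1 x = |τ x| := fun τ x => by
    change P τ x = _
    simp [P, InfinitePlace.apply]
  have hinj : Function.Injective P := by
    intro τ τ' h
    have hc : ∀ τ : K →+* ℝ, ComplexEmbedding.conjugate (Complex.ofRealHom.comp τ) =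
        Complex.ofRealHom.comp τ := fun τ => by
      ext x
      simp [ComplexEmbedding.conjugate]
    have := InfinitePlace.mk_eq_iff.mp h
    rw [hc, or_self] at this
    ext x
    have := congrArg (fun f : K →+* ℂ => f x) this
    simpa using this
  have : Finite (K →+* ℝ) := Finite.of_injective P hinj
  have := Fintype.ofFinite (K →+* ℝ)
  have hd := AbsoluteValue.denseRange_algebraMap_pi (v := fun τ : K →+* ℝ => (P τ).1)
    (fun τ => (P τ).isNontrivial) fun τ τ' hne h =>
      hne (hinj (InfinitePlace.eq_iff_isEquiv.mpr h))
  rw [Metric.denseRange_iff]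
  intro t r hr
  have hq : ∀ τ : K →+* ℝ, ∃ q : ℚ, |t τ - q| < r / 2 := fun τ => by
    obtain ⟨q, h1, h2⟩ := exists_rat_btwn (show t τ - r / 2 < t τ by linarith)
    exact ⟨q, abs_lt.mpr ⟨by linarith, by linarith⟩⟩
  choose q hq using hq
  obtain ⟨x, hx⟩ := Metric.denseRange_iff.mp hd (fun τ => WithAbs.toAbs _ (q τ : K)) (r / 2)
    (half_pos hr)
  refine ⟨x, (dist_pi_lt_iff hr).mpr fun τ => ?_⟩
  have h1 := (dist_pi_lt_iff (half_pos hr)).mp hx τ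
  rw [dist_eq_norm] at h1
  have h2 : ‖(WithAbs.toAbs (P τ).1 (q τ : K)) - WithAbs.toAbs (P τ).1 x‖ = |(q τ : ℝ) - τ x| := by
    rw [← WithAbs.toAbs_sub, WithAbs.norm_toAbs_eq, hP, map_sub, map_ratCast]
  have h3 : |(q τ : ℝ) - τ x| < r / 2 := h2 ▸ h1
  rw [Real.dist_eq]
  calc |t τ - τ x| = |(t τ - q τ) + (q τ - τ x)| := by ring_nf
    _ ≤ _ := abs_add_le _ _
    _ < r := by linarith [hq τ]

theorem isOpen_valued_lt (v : HeightOneSpectrum (𝓞 K)) (c : v.adicCompletion K) :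
    IsOpen {x : v.adicCompletion K | Valued.v x < Valued.v c} := by
  convert Valued.isOpen_ball (v.adicCompletion K) (Valued.v.restrict c) using 1
  ext x
  exact (Valuation.restrict_lt_iff (Valued.v : Valuation (v.adicCompletion K) ℤᵐ⁰)).symm

theorem tendsto_of_valued_sub_le (v : HeightOneSpectrum (𝓞 K)) {y : ℕ → v.adicCompletion K}
    {x : v.adicCompletion K} (h : ∀ n, Valued.v (y n - x) ≤ exp (-(n : ℤ))) :
    Tendsto y atTop (𝓝 x) := by
  intro U hU
  obtain ⟨γ, hγ⟩ := Valued.mem_nhds.mp hU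
  rw [Filter.mem_map]
  have h0 : MonoidWithZeroHom.ValueGroup₀.embedding γ.1 ≠ 0 :=
    (γ.isUnit.map MonoidWithZeroHom.ValueGroup₀.embedding).ne_zero
  filter_upwards [Filter.eventually_ge_atTop
    (1 - log (MonoidWithZeroHom.ValueGroup₀.embedding γ.1)).toNat] with n hn
  refine hγ ?_
  change Valued.v.restrict _ < γ.1
  rw [Valuation.restrict_lt_iff_lt_embedding]
  refine (h n).trans_lt ?_
  rw [← exp_log h0, exp_lt_exp]
  have := Int.self_le_toNat (1 - log (MonoidWithZeroHom.ValueGroup₀.embedding γ.1))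
  omega

theorem denseRange_finite_places (S : Set (HeightOneSpectrum (𝓞 K))) (hS : S.Finite) :
    DenseRange (fun (x : K) (v : S) => algebraMap K (v.1.adicCompletion K) x) := by
  have : Finite S := hS
  rw [DenseRange, dense_iff_inter_open]
  intro U hU hne
  obtain ⟨x, hx⟩ := (DenseRange.piMap fun v : S =>
    HeightOneSpectrum.denseRange_algebraMap (K := K) v.1).exists_mem_open hU hne
  classical
  choose y hy using exists_forall_valuation_sub_le hS.toFinset
    (fun v => if h : v ∈ S then x ⟨v, h⟩ else 0)
  have ht : Tendsto (fun n (v : S) => algebraMap K (v.1.adicCompletion K) (y n)) atTop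
      (𝓝 (Pi.map (fun v : S => algebraMap K (v.1.adicCompletion K)) x)) := by
    rw [tendsto_pi_nhds]
    intro v
    refine tendsto_of_valued_sub_le v.1 fun n => ?_
    have := hy n v.1 (hS.mem_toFinset.mpr v.2)
    rw [dif_pos v.2] at this
    rw [Pi.map_apply, ← map_sub]
    exact (v.1.valuedAdicCompletion_eq_valuation' _).trans_le this
  obtain ⟨n, hn⟩ := (ht.eventually (hU.mem_nhds hx)).exists
  exact ⟨_, hn, y n, rfl⟩

theorem tendsto_pow_div_one_add_pow_zero (v : HeightOneSpectrum (𝓞 K)) {p : ℕ}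
    (hv : v.valuation K p ≠ 1) :
    Tendsto (fun n => algebraMap K (v.adicCompletion K) ((p : K) ^ n / (1 + (p : K) ^ n))) atTop
      (𝓝 0) := by
  have hlt : v.valuation K p < 1 := lt_of_le_of_ne
      (HeightOneSpectrum.valuation_natCast_le_one v p) hv
  have h1 : Tendsto (fun n => algebraMap K (v.adicCompletion K) ((p : K) ^ n)) atTop (𝓝 0) := by
    refine tendsto_of_valued_sub_le v fun n => ?_
    rw [sub_zero]
    refine (v.valuedAdicCompletion_eq_valuation' ((p : K) ^ n)).trans_le ?_
    rw [map_pow]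
    rcases eq_or_ne (v.valuation K p) 0 with h0 | h0
    · rw [h0]
      rcases n with _ | n
      · simp
      · simp
    · have h2 : v.valuation K p ≤ exp (-1) := by
        rw [← exp_log h0] at hlt ⊢
        rw [← exp_zero, exp_lt_exp] at hlt
        rw [exp_le_exp]
        omega
      calc v.valuation K p ^ n ≤ exp (-1) ^ n := pow_le_pow_left' h2 n
        _ = _ := by simp [← exp_nsmul]
  have h2 := h1.div (h1.const_add 1) (by simp)
  rw [zero_div] at h2
  refine h2.congr fun n => ?_
  rw [Pi.div_apply, map_div₀, map_add, map_one]

theorem tendsto_pow_div_one_add_pow_one {p : ℕ} (hp : 1 < p) (τ : K →+* ℝ) :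
    Tendsto (fun n => τ ((p : K) ^ n / (1 + (p : K) ^ n))) atTop (𝓝 1) := by
  have h0 : Tendsto (fun n : ℕ => ((p : ℝ)⁻¹) ^ n) atTop (𝓝 0) :=
    tendsto_pow_atTop_nhds_zero_of_lt_one (by positivity)
      (inv_lt_one_of_one_lt₀ (by exact_mod_cast hp))
  have h1 := (h0.const_add 1).inv₀ (by simp)
  rw [add_zero, inv_one] at h1
  refine h1.congr fun n => ?_
  have : (p : ℝ) ^ n ≠ 0 := pow_ne_zero _ (by positivity)
  have h2 : 1 + (p : ℝ) ^ n ≠ 0 := by positivity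
  simp only [map_div₀, map_add, map_pow, map_natCast, map_one, inv_pow]
  field_simp
  ring

/-- Weak approximation at the places above `p` and the real places. -/
theorem denseRange_places {p : ℕ} (hp : 1 < p) :
    DenseRange (fun x : K => ((fun v : {v : HeightOneSpectrum (𝓞 K) | v.valuation K p ≠ 1} =>
      algebraMap K (v.1.adicCompletion K) x), fun τ : K →+* ℝ => τ x)) := by
  have hS := finite_valuation_ne_one (K := K) (x := p) (by simp; omega)
  rw [DenseRange, dense_iff_inter_open]
  rintro U hU ⟨⟨a, b⟩, hab⟩
  obtain ⟨V, W, hV, hW, haV, hbW, hVW⟩ := isOpen_prod_iff.mp hU a b hab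
  obtain ⟨f, hf⟩ := (denseRange_finite_places _ hS).exists_mem_open hV ⟨a, haV⟩
  obtain ⟨g, hg⟩ := (denseRange_real_embeddings (K := K)).exists_mem_open hW ⟨b, hbW⟩
  let r : ℕ → K := fun n => (p : K) ^ n / (1 + (p : K) ^ n)
  let u : ℕ → K := fun n => f + r n * (g - f)
  have h1 : Tendsto (fun n (v : {v : HeightOneSpectrum (𝓞 K) | v.valuation K p ≠ 1}) =>
      algebraMap K (v.1.adicCompletion K) (u n)) atTop
      (𝓝 fun v => algebraMap K (v.1.adicCompletion K) f) := by
    rw [tendsto_pi_nhds]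
    intro v
    have := ((tendsto_pow_div_one_add_pow_zero v.1 v.2).mul_const
      (algebraMap K (v.1.adicCompletion K) (g - f))).const_add
      (algebraMap K (v.1.adicCompletion K) f)
    rw [zero_mul, add_zero] at this
    refine this.congr fun n => ?_
    rw [← map_mul, ← map_add]
  have h2 : Tendsto (fun n (τ : K →+* ℝ) => τ (u n)) atTop (𝓝 fun τ => τ g) := by
    rw [tendsto_pi_nhds]
    intro τ
    have := ((tendsto_pow_div_one_add_pow_one hp τ).mul_const (τ (g - f))).const_add (τ f)
    rw [one_mul, ← map_add, add_sub_cancel] at this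
    refine this.congr fun n => ?_
    rw [← map_mul, ← map_add]
  obtain ⟨n, hn1, hn2⟩ := ((h1.eventually (hV.mem_nhds hf)).and
    (h2.eventually (hW.mem_nhds hg))).exists
  exact ⟨_, hVW (Set.mk_mem_prod hn1 hn2), u n, rfl⟩

end WeakApproximation

section NormForm

open Polynomial

variable {K : Type*} [Field K] {p : ℕ}

theorem SymbolSplit.exists_isNormPoly (hp : p.Prime) {ζ a b : K}
    (hζ : IsPrimitiveRoot ζ p) (ha : a ≠ 0) (hb : b ≠ 0) (hs : SymbolSplit p ζ a b) :
    ∃ h : K[X], IsNormPoly p ζ a h b := by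
  have h3 := ((hs.swap ha hp.ne_zero).swap hb hp.ne_zero).swap (inv_ne_zero ha) hp.ne_zero
  rw [inv_inv] at h3
  simpa using h3.exists_isNormPoly_inv hp hζ (inv_ne_zero hb) ha

theorem comp_twist_modulus {ζ : K} (hζ : ζ ^ p = 1) (a : K) (i : ℕ) :
    (X ^ p - C a : K[X]).comp (C (ζ ^ i) * X) = X ^ p - C a := by
  rw [sub_comp, pow_comp, X_comp, C_comp, mul_pow, ← C_pow, ← pow_mul, mul_comm i, pow_mul, hζ,
    one_pow, C_1, one_mul]

theorem IsNormPoly.of_dvd_sub {ζ : K} (hζ : ζ ^ p = 1) {a n : K} {h h' : K[X]}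
    (hn : IsNormPoly p ζ a h n) (hd : (X ^ p - C a) ∣ h - h') : IsNormPoly p ζ a h' n := by
  unfold IsNormPoly at hn ⊢
  rw [← AdjoinRoot.mk_eq_mk] at hd hn ⊢
  rw [← hn, map_prod, map_prod]
  refine Finset.prod_congr rfl fun i _ => ?_
  rw [AdjoinRoot.mk_eq_mk] at hd ⊢
  rw [← sub_comp]
  have := map_dvd (compRingHom (C (ζ ^ i) * X)) (dvd_sub_comm.mp hd)
  rwa [coe_compRingHom_apply, coe_compRingHom_apply, comp_twist_modulus hζ] at this

theorem IsNormPoly.exists_fin (hp : 0 < p) {ζ : K} (hζ : ζ ^ p = 1) {a n : K} {h : K[X]}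
    (hn : IsNormPoly p ζ a h n) :
    ∃ c : Fin p → K, IsNormPoly p ζ a (∑ j, C (c j) * X ^ (j : ℕ)) n := by
  have hm : (X ^ p - C a : K[X]).Monic := monic_X_pow_sub_C a hp.ne'
  refine ⟨fun j => (h %ₘ (X ^ p - C a)).coeff j, ?_⟩
  have hdeg : (h %ₘ (X ^ p - C a)).natDegree < p := by
    have := natDegree_modByMonic_lt h hm (by
      intro h1
      have := congrArg natDegree h1
      rw [natDegree_X_pow_sub_C, natDegree_one] at this
      omega)
    rwa [natDegree_X_pow_sub_C] at this
  rw [Fin.sum_univ_eq_sum_range (fun j => C ((h %ₘ (X ^ p - C a)).coeff j) * X ^ j),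
    ← as_sum_range_C_mul_X_pow' _ hdeg]
  refine hn.of_dvd_sub hζ ?_
  exact ⟨h /ₘ (X ^ p - C a), sub_eq_iff_eq_add'.mpr (modByMonic_add_div h _).symm⟩

/-- The norm form of `K[T] / (T ^ p - a)` in the basis of powers of `T`. -/
noncomputable def normForm (p : ℕ) (ζ a : K) : MvPolynomial (Fin p) K :=
  ((∏ i ∈ Finset.range p, (∑ j : Fin p, C (MvPolynomial.X j) * X ^ (j : ℕ)).comp
    (C (MvPolynomial.C ζ ^ i) * X)) %ₘ (X ^ p - C (MvPolynomial.C a))).coeff 0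

theorem IsNormPoly.eval₂_normForm (hp : 0 < p) {ζ a : K} {K' : Type*} [Field K'] (g : K →+* K')
    {c : Fin p → K'} {n : K'}
    (hn : IsNormPoly p (g ζ) (g a) (∑ j, C (c j) * X ^ (j : ℕ)) n) :
    (normForm p ζ a).eval₂ g c = n := by
  have hm : (X ^ p - C (g a) : K'[X]).Monic := monic_X_pow_sub_C (g a) hp.ne'
  have h1 : (normForm p ζ a).eval₂ g c =
      ((∏ i ∈ Finset.range p, (∑ j : Fin p, C (c j) * X ^ (j : ℕ)).comp
        (C (g ζ ^ i) * X)) %ₘ (X ^ p - C (g a))).coeff 0 := by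
    rw [← MvPolynomial.coe_eval₂Hom, normForm, ← coeff_map,
      map_modByMonic _ (monic_X_pow_sub_C _ hp.ne')]
    simp [Polynomial.map_prod, Polynomial.map_sum]
  obtain ⟨q, hq⟩ := hn
  rw [h1, sub_eq_iff_eq_add.mp hq, add_modByMonic, mul_comm, (modByMonic_eq_zero_iff_dvd hm).mpr
    (dvd_mul_left _ _), zero_add,
    (modByMonic_eq_self_iff hm).mpr, coeff_C_zero]
  rw [degree_X_pow_sub_C hp]
  exact degree_C_le.trans_lt (by exact_mod_cast hp)

theorem MvPolynomial.continuous_eval₂ {ι K' : Type*} [Field K'] [TopologicalSpace K']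
    [IsTopologicalRing K'] (g : K →+* K') (f : MvPolynomial ι K) :
    Continuous fun c : ι → K' => f.eval₂ g c := by
  simp_rw [MvPolynomial.eval₂_eq_eval_map]
  exact MvPolynomial.continuous_eval _

theorem eval₂_comp_normForm {K' : Type*} [Field K'] (g : K →+* K') {ι : Type*}
    (f : MvPolynomial ι K) (c : ι → K) : f.eval₂ g (fun i => g (c i)) = g (f.eval c) := by
  rw [MvPolynomial.eval₂_comp]
  rfl

theorem KummerDatum.eval_normForm {L : Type*} [Field L] [Algebra K L] {ζ a : K} {α : L}
    {σ : L ≃ₐ[K] L} (D : KummerDatum p ζ a α σ) (c : Fin p → K) :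
    (normForm p ζ a).eval c = Algebra.norm K (aeval α (∑ j, C (c j) * X ^ (j : ℕ))) :=
  IsNormPoly.eval₂_normForm D.prime.pos (RingHom.id K) (D.isNormPoly_norm _)

end NormForm

section LocalGlobalSymbols

open Polynomial NumberField IsDedekindDomain WithZero Filter Topology

variable {K : Type*} [Field K] [NumberField K] {p : ℕ}

theorem exists_valuation_natCast_ne_one (hp : p.Prime) :
    ∃ v : HeightOneSpectrum (𝓞 K), v.valuation K p ≠ 1 := by
  by_contra! h
  obtain ⟨y, hy⟩ := HeightOneSpectrum.mem_integers_of_valuation_le_one K (p : K)⁻¹ fun v => by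
    rw [map_inv₀, h v, inv_one]
  have h1 : IsIntegral ℤ (algebraMap ℚ K (p : ℚ)⁻¹) := by
    rw [map_inv₀, map_natCast, ← hy]
    exact y.2
  rw [isIntegral_algebraMap_iff (algebraMap ℚ K).injective] at h1
  obtain ⟨m, hm⟩ := IsIntegrallyClosed.algebraMap_eq_of_integral h1
  have hp0 : (p : ℚ) ≠ 0 := by exact_mod_cast hp.ne_zero
  have hm' : m * (p : ℤ) = 1 := by
    have : (m : ℚ) * p = 1 := by
      rw [← eq_intCast (algebraMap ℤ ℚ), hm, inv_mul_cancel₀ hp0]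
    exact_mod_cast this
  have := Int.eq_one_or_neg_one_of_mul_eq_one' hm'
  have := hp.two_le
  omega

theorem SymbolSplit.exists_eval_normForm (hp : p.Prime) {ζ a b : K} (hζ : IsPrimitiveRoot ζ p)
    (ha : a ≠ 0) (hb : b ≠ 0) {K' : Type*} [Field K'] (g : K →+* K')
    (hs : SymbolSplit p (g ζ) (g a) (g b)) : ∃ c : Fin p → K', (normForm p ζ a).eval₂ g c = g b :=
        by
  have hζ' := hζ.map_of_injective g.injective
  obtain ⟨h, hh⟩ := hs.exists_isNormPoly hp hζ' (by simpa) (by simpa)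
  obtain ⟨c, hc⟩ := hh.exists_fin hp.pos hζ'.pow_eq_one
  exact ⟨c, hc.eval₂_normForm hp.pos g⟩

theorem SymbolSplit.exists_eval_normForm_inv (hp : p.Prime) {ζ a b : K} (hζ : IsPrimitiveRoot ζ p)
    (ha : a ≠ 0) (hb : b ≠ 0) {K' : Type*} [Field K'] (g : K →+* K')
    (hs : SymbolSplit p (g ζ) (g a) (g b)) :
    ∃ c : Fin p → K', g a * (normForm p ζ b).eval₂ g c = 1 := by
  have h1 := hs.swap (by simpa) hp.ne_zero
  rw [← map_inv₀] at h1
  obtain ⟨c, hc⟩ := h1.exists_eval_normForm hp hζ hb (inv_ne_zero ha)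
  exact ⟨c, by rw [hc, ← map_mul, mul_inv_cancel₀ ha, map_one]⟩

theorem isOpen_eval_normForm_near (v : HeightOneSpectrum (𝓞 K)) (f : MvPolynomial (Fin p) K)
    (e : K) : IsOpen {c : Fin p → v.adicCompletion K |
      Valued.v (algebraMap K (v.adicCompletion K) e *
        f.eval₂ (algebraMap K (v.adicCompletion K)) c - 1) <
      Valued.v (algebraMap K (v.adicCompletion K) ((p : K) ^ p))} :=
  (isOpen_valued_lt v _).preimage
    ((continuous_const.mul (MvPolynomial.continuous_eval₂ _ f)).sub continuous_const)

theorem valuation_mul_eval_sub_one_lt {v : HeightOneSpectrum (𝓞 K)} {f : MvPolynomial (Fin p) K}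
    {e : K} {c : Fin p → K}
    (h : Valued.v (algebraMap K (v.adicCompletion K) e *
        f.eval₂ (algebraMap K (v.adicCompletion K)) (fun i => algebraMap K _ (c i)) - 1) <
      Valued.v (algebraMap K (v.adicCompletion K) ((p : K) ^ p))) :
    v.valuation K (e * f.eval c - 1) < v.valuation K p ^ p := by
  rw [eval₂_comp_normForm, ← map_mul, ← map_one (algebraMap K (v.adicCompletion K)),
    ← map_sub] at h
  rw [← map_pow]
  exact (v.valuedAdicCompletion_eq_valuation' _).symm.trans_lt
    (h.trans_eq (v.valuedAdicCompletion_eq_valuation' _))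

theorem ne_zero_of_valuation_sub_one_lt {v : HeightOneSpectrum (𝓞 K)} {x : K}
    (h : v.valuation K (x - 1) < v.valuation K p ^ p) : x ≠ 0 := by
  rintro rfl
  rw [zero_sub, Valuation.map_neg, map_one] at h
  exact h.not_ge (pow_le_one' (HeightOneSpectrum.valuation_natCast_le_one v p) p)

variable {L : Type*} [Field L] [NumberField L] [Algebra K L]

/-- If the symbol `(a, b)` splits at `v`, then `b` is a norm up to an element close to `1`. -/
theorem KummerDatum.mem_near_sup_range_norm {ζ a : K} {α : L} {σ : L ≃ₐ[K] L}
    (D : KummerDatum p ζ a α σ) (b : Kˣ) (v : HeightOneSpectrum (𝓞 K))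
    (hs : SymbolSplit p (algebraMap K (v.adicCompletion K) ζ)
      (algebraMap K (v.adicCompletion K) a) (algebraMap K (v.adicCompletion K) b)) :
    b ∈ near p v ⊔ (Units.map (Algebra.norm K : L →* K)).range := by
  have hp := D.prime
  obtain ⟨c, hc⟩ := hs.exists_eval_normForm hp D.prim D.ne_zero b.ne_zero
  have hp0 : (p : K) ≠ 0 := by exact_mod_cast hp.ne_zero
  obtain ⟨x, hx⟩ := (DenseRange.piMap fun _ : Fin p =>
    HeightOneSpectrum.denseRange_algebraMap (K := K) v).exists_mem_open
      (isOpen_eval_normForm_near v (normForm p ζ a) (b : K)⁻¹) ⟨c, by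
        rw [Set.mem_ofPred_eq, hc, ← map_mul, inv_mul_cancel₀ b.ne_zero, map_one, sub_self,
          map_zero,
          zero_lt_iff, Valuation.ne_zero_iff, _root_.map_ne_zero]
        exact pow_ne_zero _ hp0⟩
  have h1 := valuation_mul_eval_sub_one_lt hx
  have h2 := ne_zero_of_valuation_sub_one_lt h1
  rw [D.eval_normForm] at h1 h2
  set y : L := aeval α (∑ j : Fin p, C (x j) * X ^ (j : ℕ))
  have hy : y ≠ 0 := by
    rintro hy
    have := D.finiteDimensional
    rw [hy, Algebra.norm_zero, mul_zero] at h2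
    exact h2 rfl
  have h3 : b⁻¹ * Units.map (Algebra.norm K : L →* K) (Units.mk0 y hy) ∈ near p v := by
    rw [mem_near hp.ne_zero]
    simpa using h1
  have h4 : b = (b⁻¹ * Units.map (Algebra.norm K : L →* K) (Units.mk0 y hy))⁻¹ *
      Units.map (Algebra.norm K : L →* K) (Units.mk0 y hy) := by
    rw [mul_inv, inv_inv, inv_mul_cancel_right]
  rw [h4]
  exact Subgroup.mul_mem_sup (inv_mem h3) ⟨_, rfl⟩

/-- Multiplying `a` by a suitable norm from `K(b ^ (1 / p))` moves it close to `1` at the places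
dividing `p` and makes it positive at the real places. -/
theorem KummerDatum.exists_norm_mul_near {ζ a b : K} {β : L} {σ : L ≃ₐ[K] L}
    (D : KummerDatum p ζ b β σ) (ha : a ≠ 0)
    (hfin : ∀ v : HeightOneSpectrum (𝓞 K), SymbolSplit p (algebraMap K (v.adicCompletion K) ζ)
      (algebraMap K (v.adicCompletion K) a) (algebraMap K (v.adicCompletion K) b))
    (hreal : ∀ τ : K →+* ℝ, SymbolSplit p (τ ζ) (τ a) (τ b)) :
    ∃ (z : L) (a' : Kˣ), (a' : K) = a * Algebra.norm K z ∧ a' ∈ totPos K ∧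
      ∀ v : HeightOneSpectrum (𝓞 K), v.valuation K p ≠ 1 → a' ∈ near p v := by
  have hp := D.prime
  have hp0 : (p : K) ≠ 0 := by exact_mod_cast hp.ne_zero
  choose cf hcf using fun v => (hfin v).exists_eval_normForm_inv hp D.prim ha D.ne_zero
  choose cr hcr using fun τ => (hreal τ).exists_eval_normForm_inv hp D.prim ha D.ne_zero
  let S : Set (HeightOneSpectrum (𝓞 K)) := {v | v.valuation K p ≠ 1}
  have hS : Finite S := finite_valuation_ne_one (K := K) hp0
  have : Finite (K →+* ℝ) := inferInstance
  let O : Set (Fin p → (∀ v : S, v.1.adicCompletion K) × ((K →+* ℝ) → ℝ)) :=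
    (⋂ v : S, (fun c j => (c j).1 v) ⁻¹' {c : Fin p → v.1.adicCompletion K |
      Valued.v (algebraMap K (v.1.adicCompletion K) a *
        (normForm p ζ b).eval₂ (algebraMap K (v.1.adicCompletion K)) c - 1) <
      Valued.v (algebraMap K (v.1.adicCompletion K) ((p : K) ^ p))}) ∩
    ⋂ τ : K →+* ℝ, {c | 0 < τ a * (normForm p ζ b).eval₂ τ fun j => (c j).2 τ}
  have hO : IsOpen O := by
    have hc1 : ∀ v : S, Continuous fun (c : Fin p → (∀ v : S, v.1.adicCompletion K) ×
        ((K →+* ℝ) → ℝ)) (j : Fin p) => (c j).1 v := fun v =>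
      continuous_pi fun j => (continuous_apply v).comp (continuous_fst.comp (continuous_apply j))
    have hc2 : ∀ τ : K →+* ℝ, Continuous fun (c : Fin p → (∀ v : S, v.1.adicCompletion K) ×
        ((K →+* ℝ) → ℝ)) (j : Fin p) => (c j).2 τ := fun τ =>
      continuous_pi fun j => (continuous_apply τ).comp (continuous_snd.comp (continuous_apply j))
    refine IsOpen.inter (isOpen_iInter_of_finite fun v => ?_) (isOpen_iInter_of_finite fun τ => ?_)
    · exact (isOpen_eval_normForm_near v.1 (normForm p ζ b) a).preimage (hc1 v)
    · exact isOpen_lt continuous_const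
        (continuous_const.mul ((MvPolynomial.continuous_eval₂ τ (normForm p ζ b)).comp (hc2 τ)))
  obtain ⟨x, hx⟩ := (DenseRange.piMap fun _ : Fin p =>
    denseRange_places (K := K) hp.one_lt).exists_mem_open hO
      ⟨fun j => (fun v => cf v.1 j, fun τ => cr τ j), by
        refine ⟨Set.mem_iInter.mpr fun v => ?_, Set.mem_iInter.mpr fun τ => ?_⟩
        · rw [Set.mem_preimage, Set.mem_ofPred_eq, hcf, sub_self, map_zero, zero_lt_iff,
            Valuation.ne_zero_iff, _root_.map_ne_zero]
          exact pow_ne_zero _ hp0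
        · rw [Set.mem_ofPred_eq, hcr]
          exact one_pos⟩
  have h1 : ∀ v : HeightOneSpectrum (𝓞 K), v.valuation K p ≠ 1 →
      v.valuation K (a * (normForm p ζ b).eval x - 1) < v.valuation K p ^ p := fun v hv =>
    valuation_mul_eval_sub_one_lt (Set.mem_iInter.mp hx.1 ⟨v, hv⟩)
  obtain ⟨v₀, hv₀⟩ := exists_valuation_natCast_ne_one (K := K) hp
  have h2 := ne_zero_of_valuation_sub_one_lt (h1 v₀ hv₀)
  refine ⟨aeval β (∑ j : Fin p, C (x j) * X ^ (j : ℕ)), Units.mk0 _ h2, ?_, fun τ => ?_,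
    fun v hv => ?_⟩
  · rw [Units.val_mk0, D.eval_normForm]
  · have := Set.mem_iInter.mp hx.2 τ
    rw [Units.val_mk0, map_mul, ← eval₂_comp_normForm]
    exact this
  · rw [mem_near hp.ne_zero, Units.val_mk0]
    exact h1 v hv

/-- If the symbol `(a, b)` splits at all finite and real places, then it splits. -/
theorem KummerDatum.symbolSplit_of_local {ζ a b : K} {β : L} {σ : L ≃ₐ[K] L}
    (D : KummerDatum p ζ b β σ) (ha : a ≠ 0)
    (hfin : ∀ v : HeightOneSpectrum (𝓞 K), SymbolSplit p (algebraMap K (v.adicCompletion K) ζ)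
      (algebraMap K (v.adicCompletion K) a) (algebraMap K (v.adicCompletion K) b))
    (hreal : ∀ τ : K →+* ℝ, SymbolSplit p (τ ζ) (τ a) (τ b)) : SymbolSplit p ζ a b := by
  have hp := D.prime
  obtain ⟨z, a', ha', hpos, hnear⟩ := D.exists_norm_mul_near ha hfin hreal
  have hz : Algebra.norm K z ≠ 0 := fun h => a'.ne_zero (by rw [ha', h, mul_zero])
  have hz0 : z ≠ 0 := by
    rintro rfl
    have := D.finiteDimensional
    exact hz (Algebra.norm_zero)
  obtain ⟨hpol, hhpol⟩ := D.exists_isNormPoly z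
  have hloc : ∀ v : HeightOneSpectrum (𝓞 K), SymbolSplit p (algebraMap K (v.adicCompletion K) ζ)
      (algebraMap K (v.adicCompletion K) a') (algebraMap K (v.adicCompletion K) b) := fun v => by
    rw [ha', map_mul]
    exact (hfin v).mul_norm (hhpol.map _)
  have key : SymbolSplit p ζ a' b := by
    by_cases hpow : ∃ d : K, d ^ p = a'
    · obtain ⟨d, hd⟩ := hpow
      rw [← hd]
      exact D.symbolSplit_pow
    · push Not at hpow
      obtain ⟨_, σ', D'⟩ := exists_kummerDatum hp D.prim a'.ne_zero hpow
      have := D'.finiteDimensional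
      have : CharZero (AdjoinRoot (X ^ p - C (a' : K))) :=
        charZero_of_injective_algebraMap (algebraMap K _).injective
      have : NumberField (AdjoinRoot (X ^ p - C (a' : K))) := NumberField.of_module_finite K _
      obtain ⟨y, hy⟩ := D'.exists_norm_eq (a' := a') (b := Units.mk0 b D.ne_zero) rfl hpos
        (fun v hv => near_le_locPow p v (hnear v hv)) fun v _ _ =>
          sup_le_sup_right (near_le_locPow p v) _ (D'.mem_near_sup_range_norm _ v (hloc v))
      have := D'.symbolSplit_norm y
      rwa [hy] at this
  obtain ⟨h', hh'⟩ := D.exists_isNormPoly z⁻¹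
  have := key.mul_norm hh'
  rwa [ha', mul_assoc, ← map_mul, mul_inv_cancel₀ hz0, map_one, mul_one] at this

/-- Local-global principle for norms from a cyclic Kummer extension of prime degree, in terms of
symbols. -/
theorem KummerDatum.exists_norm_eq_of_local {ζ a b : K} {α : L} {σ : L ≃ₐ[K] L}
    (D : KummerDatum p ζ a α σ) (hb : b ≠ 0)
    (hfin : ∀ v : HeightOneSpectrum (𝓞 K), SymbolSplit p (algebraMap K (v.adicCompletion K) ζ)
      (algebraMap K (v.adicCompletion K) a) (algebraMap K (v.adicCompletion K) b))
    (hreal : ∀ τ : K →+* ℝ, SymbolSplit p (τ ζ) (τ a) (τ b)) :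
    ∃ y : L, Algebra.norm K y = b := by
  have hp := D.prime
  by_cases hpow : ∃ d : K, d ^ p = b
  · obtain ⟨d, rfl⟩ := hpow
    exact ⟨algebraMap K L d, by rw [Algebra.norm_algebraMap, D.finrank_eq]⟩
  · push Not at hpow
    obtain ⟨_, σ', D'⟩ := exists_kummerDatum hp D.prim hb hpow
    have := D'.finiteDimensional
    have : CharZero (AdjoinRoot (X ^ p - C b)) :=
      charZero_of_injective_algebraMap (algebraMap K _).injective
    have : NumberField (AdjoinRoot (X ^ p - C b)) := NumberField.of_module_finite K _
    obtain ⟨h, hh⟩ := (D'.symbolSplit_of_local D.ne_zero hfin hreal).exists_isNormPoly hp D.prim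
      D.ne_zero hb
    exact ⟨_, D.norm_aeval_of_isNormPoly hh⟩

end LocalGlobalSymbols

section LocalTransfer

open NumberField IsDedekindDomain

variable {K L : Type*} [Field K] [NumberField K] [Field L] [NumberField L] [Algebra K L]

theorem exists_adicCompletion_ringHom (w : HeightOneSpectrum (𝓞 L)) :
    ∃ g : (w.under (𝓞 K)).adicCompletion K →+* w.adicCompletion L,
      g.comp (algebraMap K _) = (algebraMap L _).comp (algebraMap K L) := by
  have : w.asIdeal.LiesOver (w.under (𝓞 K)).asIdeal := ⟨rfl⟩
  have hc := (HeightOneSpectrum.uniformContinuous_algebraMap_liesOver K L (w.under (𝓞 K))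
      w).continuous
  refine ⟨((HeightOneSpectrum.adicCompletion.equiv L w).symm : _ →+* _).comp
    ((UniformSpace.Completion.mapRingHom _ hc).comp
      (HeightOneSpectrum.adicCompletion.equiv K (w.under (𝓞 K)) : _ →+* _)), ?_⟩
  refine RingHom.ext fun x => ?_
  exact congrArg (HeightOneSpectrum.adicCompletion.equiv L w).symm
    (UniformSpace.Completion.mapRingHom_coe hc (WithVal.toVal _ x))

variable {F : Type*} [Field F] {X : Type*} [Ring X] [Algebra F X]

/-- `X` has an `N`-dimensional representation over every finite and real completion of `K`. -/
def HasLocalReps (X : Type*) [Ring X] [Algebra F X] (f : F →+* K) (N : ℕ) : Prop :=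
  (∀ v : HeightOneSpectrum (𝓞 K), HasMatrixRep X ((algebraMap K (v.adicCompletion K)).comp f) N) ∧
    ∀ τ : K →+* ℝ, HasMatrixRep X (τ.comp f) N

theorem HasLocalReps.comp {f : F →+* K} {N : ℕ} (h : HasLocalReps X f N) :
    HasLocalReps X ((algebraMap K L).comp f) N := by
  refine ⟨fun w => ?_, fun τ => ?_⟩
  · obtain ⟨g, hg⟩ := exists_adicCompletion_ringHom (K := K) w
    rw [← RingHom.comp_assoc, ← hg, RingHom.comp_assoc]
    exact (h.1 _).comp g
  · rw [← RingHom.comp_assoc]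
    exact h.2 _

theorem KummerDatum.hasMatrixRep_of_local [FiniteDimensional F X] [Algebra.IsCentral F X]
    [IsSimpleRing X] {p : ℕ} {ζ a : K} {α : L} {σ : L ≃ₐ[K] L} (D : KummerDatum p ζ a α σ)
    {f : F →+* K} {N : ℕ} (hN0 : 0 < N) (hN : N ^ 2 = Module.finrank F X)
    (h : HasLocalReps X f N) (hL : HasMatrixRep X ((algebraMap K L).comp f) N) :
    HasMatrixRep X f N := by
  have := D.finiteDimensional
  obtain ⟨r, φ, b, hb, hr, hrl, hcomm, hsemi, hφ⟩ := D.exists_semilinear hN0 hN hL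
  have hY : Module.finrank K (Fin N → L) = N * p := by
    rw [Module.finrank_pi_fintype]
    simp [D.finrank_eq]
  have hA : ∀ x, Commute (Algebra.lsmul K K (Fin N → L) α) (r x) := fun x =>
    LinearMap.ext fun v => (hrl x α v).symm
  have hAp : (Algebra.lsmul K K (Fin N → L) α) ^ p = algebraMap K _ a := by
    rw [← map_pow, D.pow_eq, AlgHom.commutes]
  have hBA : φ * Algebra.lsmul K K (Fin N → L) α =
      ζ • (Algebra.lsmul K K (Fin N → L) α * φ) := by
    refine LinearMap.ext fun v => ?_
    change φ (α • v) = ζ • α • φ v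
    rw [hsemi, D.gal, mul_smul, algebraMap_smul]
  obtain ⟨y, hy⟩ := D.exists_norm_eq_of_local hb
    (fun v => by
      have : CharZero (v.adicCompletion K) :=
        charZero_of_injective_algebraMap (algebraMap K _).injective
      exact symbolSplit_map_of_commute hN0 hN D.prime.pos _ (h.1 v) hY r hr _ φ hA hcomm hAp
        hφ hBA)
    (fun τ => symbolSplit_map_of_commute hN0 hN D.prime.pos _ (h.2 τ) hY r hr _ φ hA hcomm hAp hφ
        hBA)
  refine D.hasMatrixRep_of_norm hN0 r φ hr hrl hcomm hsemi y ?_ (by rw [hφ, hy])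
  rintro rfl
  exact hb (by rw [← hy, Algebra.norm_zero])

end LocalTransfer

section GaloisDescent

open NumberField Module

theorem exists_kummerDatum_of_isGalois {K M : Type*} [Field K] [Field M] [Algebra K M]
    [FiniteDimensional K M] [IsGalois K M] {p : ℕ} (hp : p.Prime) (hM : finrank K M = p) {ζ : K}
    (hζ : IsPrimitiveRoot ζ p) :
    ∃ (ζ' a : K) (α : M) (σ : M ≃ₐ[K] M), KummerDatum p ζ' a α σ := by
  have : Fact p.Prime := ⟨hp⟩
  have hcard : Nat.card (M ≃ₐ[K] M) = p := by rw [IsGalois.card_aut_eq_finrank, hM]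
  have : IsCyclic (M ≃ₐ[K] M) := isCyclic_of_prime_card hcard
  obtain ⟨α, ⟨a, ha⟩, hα⟩ := exists_root_adjoin_eq_top_of_isCyclic K M
    ⟨ζ, by rw [hM]; exact (mem_primitiveRoots hp.pos).2 hζ⟩
  rw [hM] at ha
  have hα' : α ∉ (⊥ : IntermediateField K M) := by
    intro h
    rw [IntermediateField.adjoin_simple_eq_bot_iff.2 h] at hα
    have h1 : finrank K (⊥ : IntermediateField K M) = 1 := IntermediateField.finrank_bot
    rw [hα, IntermediateField.finrank_top', hM] at h1
    exact hp.one_lt.ne' h1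
  have hα0 : α ≠ 0 := by
    rintro rfl
    exact hα' (zero_mem _)
  obtain ⟨σ, hσ⟩ : ∃ σ : M ≃ₐ[K] M, σ α ≠ α := by
    by_contra! h
    exact hα' ((IsGalois.mem_bot_iff_fixed α).2 h)
  have hpow : (σ α / α) ^ p = 1 := by
    rw [div_pow, ← map_pow, ← ha, AlgEquiv.commutes, div_self]
    rw [ha]
    exact pow_ne_zero _ hα0
  obtain ⟨i, -, hi⟩ := (hζ.map_of_injective (algebraMap K M).injective).eq_pow_of_pow_eq_one hpow
  rw [← map_pow] at hi
  refine ⟨ζ ^ i, a, α, σ, hp, ?_, ?_, ha.symm, hM, ?_⟩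
  · refine IsPrimitiveRoot.iff_orderOf.2 (orderOf_eq_prime ?_ ?_)
    · rw [← pow_mul, mul_comm, pow_mul, hζ.pow_eq_one, one_pow]
    · intro h
      rw [h, map_one] at hi
      exact hσ (div_eq_one_iff_eq hα0 |>.1 hi.symm)
  · rintro rfl
    rw [map_zero] at ha
    exact pow_ne_zero _ hα0 ha.symm
  · rw [hi, div_mul_cancel₀ _ hα0]

universe u

variable {F : Type*} [Field F] {X : Type*} [Ring X] [Algebra F X] [FiniteDimensional F X]
  [Algebra.IsCentral F X] [IsSimpleRing X]

theorem hasMatrixRep_of_isGalois_prime_pow {p : ℕ} (hp : p.Prime) {N : ℕ} (hN0 : 0 < N)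
    (hN : N ^ 2 = finrank F X) {L : Type u} [Field L] [NumberField L] (n : ℕ) :
    ∀ (K : Type u) [Field K] [NumberField K] [Algebra K L] [IsGalois K L]
      (_ : finrank K L = p ^ n) (ζ : K) (_ : IsPrimitiveRoot ζ p) (f : F →+* K)
      (_ : HasMatrixRep X ((algebraMap K L).comp f) N) (_ : HasLocalReps X f N),
      HasMatrixRep X f N := by
  induction n with
  | zero =>
    intro K _ _ _ _ hK ζ hζ f hL _
    have hbij : Function.Bijective (algebraMap K L) :=
      bijective_algebraMap_of_linearEquiv
        (LinearEquiv.ofFinrankEq K L (by rw [finrank_self, hK, pow_zero]))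
    have := hL.comp (RingEquiv.ofBijective _ hbij).symm.toRingHom
    rwa [← RingHom.comp_assoc, show (RingEquiv.ofBijective _ hbij).symm.toRingHom.comp
      (algebraMap K L) = RingHom.id K from RingHom.ext fun x =>
        (RingEquiv.ofBijective _ hbij).symm_apply_apply x, RingHom.id_comp] at this
  | succ n ih =>
    intro K _ _ _ _ hK ζ hζ f hL hloc
    have : Fact p.Prime := ⟨hp⟩
    have hcard : Nat.card (L ≃ₐ[K] L) = p ^ (n + 1) := by rw [IsGalois.card_aut_eq_finrank, hK]
    obtain ⟨H, hH⟩ := Sylow.exists_subgroup_card_pow_prime (G := L ≃ₐ[K] L) p (n := n)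
      (by rw [hcard]; exact pow_dvd_pow _ n.le_succ)
    have hidx : H.index = p := by
      have := H.card_mul_index
      rw [hH, hcard, pow_succ] at this
      exact Nat.eq_of_mul_eq_mul_left (pow_pos hp.pos n) this
    have : H.Normal := Subgroup.normal_of_index_eq_minFac_card (by
      rw [hidx, hcard, Nat.Prime.pow_minFac hp n.succ_ne_zero])
    have hML : finrank (IntermediateField.fixedField H) L = p ^ n := by
      rw [IntermediateField.finrank_fixedField_eq_card, hH]
    have hKM : finrank K (IntermediateField.fixedField H) = p := by
      have := finrank_mul_finrank K (IntermediateField.fixedField H) L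
      rw [hML, hK, pow_succ, mul_comm] at this
      exact Nat.eq_of_mul_eq_mul_left (pow_pos hp.pos n) this
    obtain ⟨ζ', a, α, σ, D⟩ := exists_kummerDatum_of_isGalois hp hKM hζ
    refine D.hasMatrixRep_of_local hN0 hN hloc ?_
    refine ih (IntermediateField.fixedField H) hML _
      (hζ.map_of_injective (algebraMap K (IntermediateField.fixedField H)).injective) _ ?_ hloc.comp
    rwa [← RingHom.comp_assoc, ← IsScalarTower.algebraMap_eq]

end GaloisDescent

section SylowDescent

open NumberField Module

universe u

variable {F : Type u} [Field F] [NumberField F] {X : Type*} [Ring X] [Algebra F X]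
  [FiniteDimensional F X] [Algebra.IsCentral F X] [IsSimpleRing X]

theorem exists_hasMatrixRep_not_dvd_finrank {p : ℕ} (hp : p.Prime) {N : ℕ} (hN0 : 0 < N)
    (hN : N ^ 2 = finrank F X) {L : Type u} [Field L] [NumberField L] [Algebra F L] [IsGalois F L]
    {ζ : L} (hζ : IsPrimitiveRoot ζ p) (hL : HasMatrixRep X (algebraMap F L) N)
    (hloc : HasLocalReps X (RingHom.id F) N) :
    ∃ K : IntermediateField F L, ¬ p ∣ finrank F K ∧ HasMatrixRep X (algebraMap F K) N := by
  have : Fact p.Prime := ⟨hp⟩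
  have : NeZero p := ⟨hp.ne_zero⟩
  obtain ⟨P⟩ : Nonempty (Sylow p (L ≃ₐ[F] L)) := inferInstance
  obtain ⟨n, hn⟩ := IsPGroup.iff_card.1 P.isPGroup'
  have hKL : finrank (IntermediateField.fixedField (P : Subgroup (L ≃ₐ[F] L))) L = p ^ n := by
    rw [IntermediateField.finrank_fixedField_eq_card]
    exact hn
  refine ⟨IntermediateField.fixedField (P : Subgroup (L ≃ₐ[F] L)), ?_, ?_⟩
  · have h1 := finrank_mul_finrank F (IntermediateField.fixedField (P : Subgroup (L ≃ₐ[F] L))) L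
    have h2 := (P : Subgroup (L ≃ₐ[F] L)).card_mul_index
    rw [IsGalois.card_aut_eq_finrank, ← h1, hKL, mul_comm] at h2
    have h3 : Nat.card (P : Subgroup (L ≃ₐ[F] L)) = p ^ n := hn
    rw [h3] at h2
    rw [← Nat.eq_of_mul_eq_mul_right (pow_pos hp.pos n) h2]
    exact P.not_dvd_index
  · have hfix : ζ ∈ IntermediateField.fixedField (P : Subgroup (L ≃ₐ[F] L)) := by
      rw [IntermediateField.mem_fixedField_iff]
      intro σ hσ
      have h1 : orderOf (hζ.autToPow F σ) ∣ p ^ n := by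
        refine orderOf_dvd_of_pow_eq_one ?_
        rw [← map_pow]
        have : σ ^ p ^ n = 1 := by
          have := pow_card_eq_one' (x := (⟨σ, hσ⟩ : (P : Subgroup (L ≃ₐ[F] L))))
          rw [show Nat.card (P : Subgroup (L ≃ₐ[F] L)) = p ^ n from hn] at this
          exact congrArg Subtype.val this
        rw [this, map_one]
      have h2 : orderOf (hζ.autToPow F σ) ∣ p - 1 := by
        rw [← ZMod.card_units p]
        exact orderOf_dvd_card
      have h3 : Nat.Coprime (p ^ n) (p - 1) :=
        Nat.Coprime.pow_left _ ((Nat.Prime.coprime_iff_not_dvd hp).2 fun h =>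
          absurd (Nat.le_of_dvd (Nat.sub_pos_of_lt hp.one_lt) h) (by have := hp.pos; omega))
      have h4 : hζ.autToPow F σ = 1 :=
        orderOf_eq_one_iff.1 (Nat.dvd_one.1 (h3 ▸ Nat.dvd_gcd h1 h2))
      have h5 := hζ.autToPow_spec F σ
      rw [h4, Units.val_one, ZMod.val_one, pow_one] at h5
      exact h5.symm
    have := hloc.comp (L := IntermediateField.fixedField (P : Subgroup (L ≃ₐ[F] L)))
    rw [RingHom.comp_id] at this
    refine hasMatrixRep_of_isGalois_prime_pow hp hN0 hN n _ hKL ⟨ζ, hfix⟩ ?_ _ ?_ this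
    · exact IsPrimitiveRoot.of_map_of_injective (f := algebraMap
        (IntermediateField.fixedField (P : Subgroup (L ≃ₐ[F] L))) L) hζ
        (algebraMap (IntermediateField.fixedField (P : Subgroup (L ≃ₐ[F] L))) L).injective
    · rwa [← IsScalarTower.algebraMap_eq]

end SylowDescent

section BaseChange

open Module
open scoped TensorProduct

variable {F : Type*} [Field F] {X : Type*} [Ring X] [Algebra F X] [Algebra.IsCentral F X]
  [IsSimpleRing X]

theorem injective_of_surjective_tensorProduct (E : Type*) [Field E] [Algebra F E] {R : Type*}
    [Ring R] [Nontrivial R] (q : E ⊗[F] X →+* R) (hq : Function.Surjective q) :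
    Function.Injective q := by
  let _ : Algebra F R := (q.comp (algebraMap F (E ⊗[F] X))).toAlgebra' fun c x => by
    obtain ⟨x, rfl⟩ := hq x
    rw [RingHom.comp_apply, ← map_mul, ← map_mul, Algebra.commutes]
  let Φ : E ⊗[F] X →ₐ[F] R := { q with commutes' := fun c => rfl }
  let ρ : X →ₐ[F] R := Φ.comp Algebra.TensorProduct.includeRight
  let η : E →ₐ[F] R := Φ.comp Algebra.TensorProduct.includeLeft
  have hΦ : ∀ c x, Φ (c ⊗ₜ x) = η c * ρ x := fun c x => by
    change Φ (c ⊗ₜ x) = Φ (c ⊗ₜ 1) * Φ (1 ⊗ₜ x)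
    rw [← map_mul, Algebra.TensorProduct.tmul_mul_tmul, mul_one, one_mul]
  have hcomm : ∀ c x, Commute (η c) (ρ x) := fun c x => by
    change Φ (c ⊗ₜ 1) * Φ (1 ⊗ₜ x) = Φ (1 ⊗ₜ x) * Φ (c ⊗ₜ 1)
    rw [← map_mul, ← map_mul, Algebra.TensorProduct.tmul_mul_tmul,
      Algebra.TensorProduct.tmul_mul_tmul, mul_one, one_mul, mul_one, one_mul]
  change Function.Injective Φ
  rw [injective_iff_map_eq_zero]
  intro z hz
  classical
  let b := Module.Basis.ofVectorSpace F E
  obtain ⟨w, rfl⟩ := (TensorProduct.equivFinsuppOfBasisLeft b).symm.surjective z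
  rw [TensorProduct.equivFinsuppOfBasisLeft_symm_apply, Finsupp.sum, map_sum] at hz
  have he : LinearIndependent F fun i => η (b i) :=
    b.linearIndependent.map' η.toLinearMap (LinearMap.ker_eq_bot.mpr η.toRingHom.injective)
  have h0 := eq_zero_of_sum_mul_eq_zero ρ _ he (fun i x => hcomm _ _) w.support w
    (by rw [← hz]; exact Finset.sum_congr rfl fun i _ => (hΦ _ _).symm)
  have : w = 0 := by
    ext i
    by_cases hi : i ∈ w.support
    · exact h0 i hi
    · simpa using hi
  rw [this, map_zero]

theorem isSimpleRing_tensorProduct (E : Type*) [Field E] [Algebra F E] :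
    IsSimpleRing (E ⊗[F] X) := by
  have : Nontrivial (E ⊗[F] X) :=
    (Algebra.TensorProduct.includeRight_injective
      (algebraMap F E).injective : Function.Injective
        (Algebra.TensorProduct.includeRight : X →ₐ[F] E ⊗[F] X)).nontrivial
  refine .of_eq_bot_or_eq_top fun I => or_iff_not_imp_right.2 fun hI => ?_
  have : Nontrivial I.ringCon.Quotient := by
    by_contra h
    rw [not_nontrivial_iff_subsingleton] at h
    refine hI (top_le_iff.1 ?_)
    rw [← I.ker_ringCon_mk']
    intro x _
    exact (TwoSidedIdeal.mem_ker _).2 (Subsingleton.elim _ _)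
  rw [← I.ker_ringCon_mk']
  exact (TwoSidedIdeal.ker_eq_bot _).2
    (injective_of_surjective_tensorProduct E _ (RingCon.mk'_surjective _))

variable [FiniteDimensional F X]

/-- Splitting after base change, without reference to a particular commutation instance. -/
theorem hasMatrixRep_of_algEquiv {A : Type*} [Field A] [Algebra F A] [SMulCommClass F A A]
    {n N : ℕ} (hN : N ^ 2 = finrank F X)
    (e : (A ⊗[F] X) ≃ₐ[A] Matrix (Fin n) (Fin n) A) : HasMatrixRep X (algebraMap F A) N := by
  have h : n ^ 2 = N ^ 2 := by
    rw [hN, ← finrank_baseChange (R := A), e.toLinearEquiv.finrank_eq, finrank_matrix]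
    simp [sq]
  obtain rfl := Nat.pow_left_injective two_ne_zero h
  refine ⟨(e : A ⊗[F] X →+* _).comp
    (Algebra.TensorProduct.includeRight : X →ₐ[F] A ⊗[F] X).toRingHom, fun c => ?_⟩
  change e (1 ⊗ₜ algebraMap F X c) = _
  rw [← e.commutes, Algebra.algebraMap_eq_smul_one, ← TensorProduct.smul_tmul,
    ← Algebra.algebraMap_eq_smul_one]
  rfl

variable (F X) in
theorem exists_sq_eq_finrank : ∃ N : ℕ, 0 < N ∧ N ^ 2 = finrank F X ∧
    HasMatrixRep X (algebraMap F (AlgebraicClosure F)) N := by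
  have := isSimpleRing_tensorProduct (F := F) (X := X) (AlgebraicClosure F)
  obtain ⟨n, hn, ⟨e⟩⟩ := IsSimpleRing.exists_algEquiv_matrix_of_isAlgClosed (AlgebraicClosure F)
    (AlgebraicClosure F ⊗[F] X)
  have hN : n ^ 2 = finrank F X := by
    rw [← finrank_baseChange (R := AlgebraicClosure F), e.toLinearEquiv.finrank_eq, finrank_matrix]
    simp [sq]
  exact ⟨n, hn.pos, hN, hasMatrixRep_of_algEquiv hN e⟩

end BaseChange

section NumberFieldRep

open NumberField Module

universe u

variable {F : Type u} [Field F] {X : Type*} [Ring X] [Algebra F X]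

theorem HasMatrixRep.descend {E L : Type*} [Field E] [Field L] [Algebra F E] [Algebra F L]
    (g : L →ₐ[F] E) {N : ℕ} {ι : Type*} (b : Basis ι F X) (ρ : X →+* Matrix (Fin N) (Fin N) E)
    (hρ : ∀ c, ρ (algebraMap F X c) = algebraMap E _ (algebraMap F E c))
    (h : ∀ k i j, ρ (b k) i j ∈ g.range) : HasMatrixRep X (algebraMap F L) N := by
  let G : Matrix (Fin N) (Fin N) L →+* Matrix (Fin N) (Fin N) E := (g : L →+* E).mapMatrix
  have hG : Function.Injective G := fun A B h => Matrix.ext fun i j =>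
    g.toRingHom.injective (congrFun (congrFun h i) j)
  have hmem : ∀ x, ρ x ∈ G.range := by
    have key : ∀ x i j, ρ x i j ∈ g.range := by
      intro x
      induction b.mem_span x using Submodule.span_induction with
      | mem x hx =>
        obtain ⟨k, rfl⟩ := hx
        exact h k
      | zero =>
        intro i j
        rw [map_zero]
        exact zero_mem _
      | add x y _ _ hx hy =>
        intro i j
        rw [map_add]
        exact add_mem (hx i j) (hy i j)
      | smul c x _ hx =>
        intro i j
        rw [Algebra.smul_def, map_mul, hρ, ← Algebra.smul_def, Matrix.smul_apply, smul_eq_mul]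
        exact mul_mem (g.range.algebraMap_mem c) (hx i j)
    intro x
    choose y hy using key x
    exact ⟨Matrix.of y, Matrix.ext hy⟩
  let e : Matrix (Fin N) (Fin N) L ≃+* G.range :=
    RingEquiv.ofBijective G.rangeRestrict
      ⟨fun x y hxy => hG (congrArg Subtype.val hxy), G.rangeRestrict_surjective⟩
  refine ⟨(e.symm : _ →+* _).comp (ρ.codRestrict G.range hmem), fun c => ?_⟩
  refine e.symm_apply_eq.2 (Subtype.ext ?_)
  change ρ _ = G _
  rw [hρ, Matrix.algebraMap_eq_diagonal, Matrix.algebraMap_eq_diagonal, RingHom.mapMatrix_apply,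
    Matrix.diagonal_map (map_zero _)]
  congr 1
  funext i
  exact (g.commutes c).symm

theorem HasMatrixRep.exists_isGalois [NumberField F] [FiniteDimensional F X] {N : ℕ}
    (h : HasMatrixRep X (algebraMap F (AlgebraicClosure F)) N) {p : ℕ} (hp : p ≠ 0) :
    ∃ (L : IntermediateField F (AlgebraicClosure F)) (_ : FiniteDimensional F L) (_ : IsGalois F L)
      (ζ : L), IsPrimitiveRoot ζ p ∧ HasMatrixRep X (algebraMap F L) N := by
  obtain ⟨ρ, hρ⟩ := h
  have : NeZero (p : AlgebraicClosure F) := ⟨Nat.cast_ne_zero.2 hp⟩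
  obtain ⟨ζ, hζ⟩ := HasEnoughRootsOfUnity.exists_primitiveRoot (AlgebraicClosure F) p
  let b := finBasis F X
  let S : Set (AlgebraicClosure F) :=
    insert ζ (Set.range fun t : Fin (finrank F X) × Fin N × Fin N => ρ (b t.1) t.2.1 t.2.2)
  have hS : S.Finite := (Set.finite_range _).insert _
  have := hS.to_subtype
  have : FiniteDimensional F (IntermediateField.adjoin F S) :=
    IntermediateField.finiteDimensional_adjoin fun x _ => Algebra.IsIntegral.isIntegral x
  let L := IntermediateField.normalClosure F (IntermediateField.adjoin F S) (AlgebraicClosure F)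
  have hL : S ⊆ L := fun x hx =>
    (IntermediateField.adjoin F S).le_normalClosure (IntermediateField.subset_adjoin F S hx)
  have : IsGalois F L := {}
  refine ⟨L, inferInstance, this, ⟨ζ, hL (Set.mem_insert _ _)⟩, ?_, ?_⟩
  · exact IsPrimitiveRoot.of_map_of_injective (f := algebraMap L (AlgebraicClosure F)) hζ
      (algebraMap L (AlgebraicClosure F)).injective
  · refine HasMatrixRep.descend L.val b ρ hρ fun k i j => ?_
    rw [IntermediateField.range_val]
    exact hL (Set.mem_insert_of_mem _ ⟨(k, i, j), rfl⟩)

end NumberFieldRep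

section Index

open Module

variable {F : Type*} [Field F] {X : Type*} [Ring X] [Algebra F X] [FiniteDimensional F X]
  [IsSimpleRing X]

theorem finrank_simple_dvd (S : Submodule X X) [IsSimpleModule X S] {V : Type*} [AddCommGroup V]
    [Module F V] [FiniteDimensional F V] [Module X V] [IsScalarTower F X V] :
    finrank F S ∣ finrank F V := by
  have := IsArtinianRing.of_finite F X
  let i : S →ₗ[X] V × X := (LinearMap.inr X V X).comp S.subtype
  have hi : Function.Injective i := LinearMap.inr_injective.comp S.injective_subtype
  let e := LinearEquiv.ofInjective i hi
  have : IsSimpleModule X (LinearMap.range i) := IsSimpleModule.congr e.symm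
  have h := IsSimpleRing.isIsotypic X (V × X) (LinearMap.range i)
  have hV : IsIsotypicOfType X V (LinearMap.range i) :=
    h.of_injective (LinearMap.inl X V X) LinearMap.inl_injective
  have : Module.Finite X V := Module.Finite.of_restrictScalars_finite F X V
  obtain ⟨n, ⟨e'⟩⟩ := hV.linearEquiv_fun
  have : FiniteDimensional F (LinearMap.range i) := (e.restrictScalars F).finiteDimensional
  have h1 := (e'.restrictScalars F).finrank_eq
  have h2 := (e.restrictScalars F).finrank_eq
  rw [h1, finrank_pi_fintype, Finset.sum_const, h2, Finset.card_univ, Fintype.card_fin,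
    smul_eq_mul]
  exact dvd_mul_left _ _

theorem HasMatrixRep.finrank_simple_dvd {K : Type*} [Field K] [Algebra F K] [FiniteDimensional F K]
    {N : ℕ} (h : HasMatrixRep X (algebraMap F K) N) (S : Submodule X X) [IsSimpleModule X S] :
    finrank F S ∣ N * finrank F K := by
  obtain ⟨ρ, hρ⟩ := h
  let r : X →+* Module.End K (Fin N → K) := (Matrix.toLinAlgEquiv' : _ ≃ₐ[K] _).toRingHom.comp ρ
  have hr : ∀ c, r (algebraMap F X c) = algebraMap K _ (algebraMap F K c) := fun c => by
    rw [RingHom.comp_apply, hρ]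
    exact (Matrix.toLinAlgEquiv' : _ ≃ₐ[K] Module.End K (Fin N → K)).commutes _
  let _ : Module X (Fin N → K) := Module.compHom (Fin N → K) r
  have : IsScalarTower F X (Fin N → K) := ⟨fun c x v => by
    change r (c • x) v = c • r x v
    rw [Algebra.smul_def, map_mul, hr, ← algebraMap_smul K c]
    rfl⟩
  have := _root_.finrank_simple_dvd (F := F) S (V := Fin N → K)
  rwa [finrank_pi_fintype, Finset.sum_const, Finset.card_univ, Fintype.card_fin,
    smul_eq_mul] at this

theorem Nat.dvd_of_forall_prime_exists {t N : ℕ} (hN : 0 < N)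
    (h : ∀ p, p.Prime → ∃ m, ¬ p ∣ m ∧ t ∣ N * m) : t ∣ N := by
  by_contra hd
  have ht : 0 < t := by
    obtain ⟨m, hm, hm'⟩ := h 2 Nat.prime_two
    refine Nat.pos_of_ne_zero fun h0 => ?_
    rw [h0, zero_dvd_iff] at hm'
    rcases Nat.mul_eq_zero.1 hm' with h | h
    · omega
    · exact hm (h ▸ dvd_zero _)
  have hg : 0 < t.gcd N := Nat.gcd_pos_of_pos_left _ ht
  have h1 : t / t.gcd N ≠ 1 := by
    intro h1
    have := Nat.div_mul_cancel (Nat.gcd_dvd_left t N)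
    rw [h1, one_mul] at this
    exact hd (this ▸ Nat.gcd_dvd_right t N)
  obtain ⟨p, hp, hpd⟩ := Nat.exists_prime_and_dvd h1
  obtain ⟨m, hm, hm'⟩ := h p hp
  refine hm (hpd.trans ((Nat.coprime_div_gcd_div_gcd hg).dvd_of_dvd_mul_left ?_))
  have h2 : t / t.gcd N * t.gcd N ∣ N / t.gcd N * m * t.gcd N := by
    rw [Nat.div_mul_cancel (Nat.gcd_dvd_left t N), mul_right_comm,
      Nat.div_mul_cancel (Nat.gcd_dvd_right t N)]
    exact hm'
  exact Nat.dvd_of_mul_dvd_mul_right hg h2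

theorem hasMatrixRep_of_finrank_simple_dvd (S : Submodule X X) {N : ℕ} (hN : 0 < N)
    (h : finrank F S ∣ N) : HasMatrixRep X (RingHom.id F) N := by
  obtain ⟨m, rfl⟩ := h
  refine HasMatrixRep.of_end hN (V := Fin m → S) ?_ (Algebra.lsmul F F (Fin m → S)).toRingHom
    fun c => ?_
  · rw [finrank_pi_fintype, Finset.sum_const, Finset.card_univ, Fintype.card_fin, smul_eq_mul,
      mul_comm]
  · exact (Algebra.lsmul F F (Fin m → S)).commutes c

theorem HasMatrixRep.nonempty_algEquiv {N : ℕ} (hN0 : 0 < N) (hN : N ^ 2 = finrank F X)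
    (h : HasMatrixRep X (RingHom.id F) N) : Nonempty (X ≃ₐ[F] Matrix (Fin N) (Fin N) F) := by
  have : Nonempty (Fin N) := ⟨⟨0, hN0⟩⟩
  obtain ⟨ρ, hρ⟩ := h
  let Φ : X →ₐ[F] Matrix (Fin N) (Fin N) F := { ρ with commutes' := fun c => hρ c }
  have hinj : Function.Injective Φ := Φ.toRingHom.injective
  refine ⟨AlgEquiv.ofBijective Φ ⟨hinj, ?_⟩⟩
  refine (LinearMap.injective_iff_surjective_of_finrank_eq_finrank (f := Φ.toLinearMap) ?_).mp hinj
  rw [← hN, finrank_matrix]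
  simp [sq]

end Index

/-- Albert–Brauer–Hasse–Noether local-global principle: a central simple algebra over a
number field `F` that becomes a matrix algebra over every completion of `F` (at all finite
and infinite places) is a matrix algebra over `F`. -/
theorem split_everywhere_locally_implies_split
    (F : Type*) [Field F] [NumberField F]
    (X : Type*) [Ring X] [Algebra F X] [FiniteDimensional F X]
    [Algebra.IsCentral F X] [IsSimpleRing X]
    (hfin : ∀ v : IsDedekindDomain.HeightOneSpectrum (NumberField.RingOfIntegers F),
      SplitsAtFinitePlace F X v)
    (hreal : ∀ τ : F →+* ℝ, SplitsAtRealPlace F X τ)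
    (hcomplex : ∀ τ : F →+* ℂ, SplitsAtComplexPlace F X τ) :
    ∃ n : ℕ, 0 < n ∧ Nonempty (X ≃ₐ[F] Matrix (Fin n) (Fin n) F) := by
  obtain ⟨N, hN0, hN, hbar⟩ := exists_sq_eq_finrank F X
  have hloc : HasLocalReps X (RingHom.id F) N := by
    refine ⟨fun v => ?_, fun τ => ?_⟩
    · obtain ⟨n, -, ⟨e⟩⟩ := hfin v
      exact @hasMatrixRep_of_algEquiv F _ X _ _ _ _ _ _ _ _ Algebra.to_smulCommClass n N hN e
    · obtain ⟨n, -, ⟨e⟩⟩ := hreal τ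
      let _ : Algebra F ℝ := τ.toAlgebra
      exact hasMatrixRep_of_algEquiv hN e
  have := IsArtinianRing.of_finite F X
  obtain ⟨S, hS⟩ := IsAtomic.exists_atom (Submodule X X)
  rw [← isSimpleModule_iff_isAtom] at hS
  refine ⟨N, hN0, HasMatrixRep.nonempty_algEquiv hN0 hN
    (hasMatrixRep_of_finrank_simple_dvd S hN0 (Nat.dvd_of_forall_prime_exists hN0 fun p hp => ?_))⟩
  obtain ⟨L, _, _, ζ, hζ, hL⟩ := hbar.exists_isGalois hp.ne_zero
  have : NumberField L := NumberField.of_module_finite F L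
  obtain ⟨K, hK, hrep⟩ := exists_hasMatrixRep_not_dvd_finrank hp hN0 hN hζ hL hloc
  exact ⟨_, hK, hrep.finrank_simple_dvd S⟩
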